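/- Let u ∈ C^∞(ℝ⁴) and set R := −6e^{−2u}(Δu + |∇u|²) (the scalar curvature of g = e^{2u}|dx|²) and M(x) := −Hess u(x) + ∇u(x)⊗∇u(x) − (1/2)|∇u(x)|² I₄, σ₂(M) := (1/2)((tr M)² − tr(M²)). Assume: the metric e^{2u}|dx|² is complete; ∫_{ℝ⁴}|Δ²u| dx < ∞; ∫_{ℝ⁴} R² e^{4u} dx < ∞; σ₂(M(·)) is Lebesgue integrable on ℝ⁴ with ∫_{ℝ⁴} σ₂(M(x)) dx < 2π². Then there exist H ≥ 1, an H-quasiconformal orientation-preserving homeomorphism F : ℝ⁴ → ℝ⁴, and a constant C ≥ 1 such that F is differentiable at almost every x with C^{−1} e^{4u(x)} ≤ |det DF(x)| ≤ C e^{4u(x)} for almost every x. -/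

import Mathlib

open MeasureTheory Metric Filter Set

noncomputable section

/-- Euclidean space `ℝⁿ`. -/
abbrev Eu (n : ℕ) := EuclideanSpace ℝ (Fin n)

/-- The Euclidean Laplacian `Δu(x) = ∑ᵢ ∂²u/∂xᵢ²`. -/
def lap {n : ℕ} (u : Eu n → ℝ) (x : Eu n) : ℝ :=
  ∑ i : Fin n, iteratedFDeriv ℝ 2 u x ![EuclideanSpace.single i 1, EuclideanSpace.single i 1]

/-- Iterated Laplacian `Δᵏ`. -/
def lapIter {n : ℕ} : ℕ → (Eu n → ℝ) → Eu n → ℝ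
  | 0, u => u
  | k + 1, u => lap (lapIter k u)

/-- A path `γ : [0,1] → ℝⁿ` which is continuous and differentiable away from
finitely many points (piecewise C¹). -/
def PiecewiseC1 {n : ℕ} (γ : ℝ → Eu n) : Prop :=
  ContinuousOn γ (Set.Icc 0 1) ∧
    ∃ S : Finset ℝ, ∀ t ∈ Set.Icc (0 : ℝ) 1, t ∉ S → DifferentiableAt ℝ γ t

/-- Length of the path `γ` in the conformal metric `e^{2u}|dx|²`. -/
def confLength {n : ℕ} (u : Eu n → ℝ) (γ : ℝ → Eu n) : ℝ :=
  ∫ t in (0 : ℝ)..1, Real.exp (u (γ t)) * ‖deriv γ t‖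

/-- The distance `d_u` induced by the conformal metric `e^{2u}|dx|²`. -/
def confDist {n : ℕ} (u : Eu n → ℝ) (x y : Eu n) : ℝ :=
  sInf { L | ∃ γ : ℝ → Eu n, γ 0 = x ∧ γ 1 = y ∧ PiecewiseC1 γ ∧ L = confLength u γ }

/-- Completeness of the conformal metric `e^{2u}|dx|²`: every sequence which is Cauchy
for `d_u` converges for `d_u`. -/
def ConfComplete {n : ℕ} (u : Eu n → ℝ) : Prop :=
  ∀ s : ℕ → Eu n,
    (∀ ε : ℝ, 0 < ε → ∃ N : ℕ, ∀ m ≥ N, ∀ l ≥ N, confDist u (s m) (s l) < ε) →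
      ∃ x : Eu n, ∀ ε : ℝ, 0 < ε → ∃ N : ℕ, ∀ m ≥ N, confDist u (s m) x < ε

/-- The ratio `(sup_{|a-x|=r} |F a - F x|) / (inf_{|b-x|=r} |F b - F x|)`. -/
def dilatQuot {n : ℕ} (F : Eu n → Eu n) (x : Eu n) (r : ℝ) : ℝ :=
  sSup ((fun a => ‖F a - F x‖) '' sphere x r) / sInf ((fun b => ‖F b - F x‖) '' sphere x r)

/-- `F` is `H`-quasiconformal: at every point the limsup as `r → 0⁺` of the dilation
quotient is at most `H`. -/
def QuasiconformalWith {n : ℕ} (H : ℝ) (F : Eu n → Eu n) : Prop :=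
  ∀ x : Eu n, Filter.limsup (fun r => dilatQuot F x r) (nhdsWithin 0 (Set.Ioi 0)) ≤ H

/-- The Jacobian determinant of `F` at `x`. -/
def jacDet {n : ℕ} (F : Eu n → Eu n) (x : Eu n) : ℝ :=
  LinearMap.det ((fderiv ℝ F x) : Eu n →ₗ[ℝ] Eu n)

/-- The matrix `M(x) = -Hess u(x) + ∇u(x) ⊗ ∇u(x) - (1/2)|∇u(x)|² I₄` of the Schouten
tensor of `e^{2u}|dx|²` in Euclidean coordinates on `ℝ⁴`. -/
def schoutenMatrix (u : Eu 4 → ℝ) (x : Eu 4) : Matrix (Fin 4) (Fin 4) ℝ :=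
  fun i j =>
    -(iteratedFDeriv ℝ 2 u x ![EuclideanSpace.single i 1, EuclideanSpace.single j 1]) +
      gradient u x i * gradient u x j -
      (1 / 2) * ‖gradient u x‖ ^ 2 * (if i = j then 1 else 0)

/-- The second elementary symmetric function of the eigenvalues of a matrix:
`σ₂(M) = (1/2)((tr M)² - tr(M²))`. -/
def sigma2 (M : Matrix (Fin 4) (Fin 4) ℝ) : ℝ :=
  (1 / 2) * ((Matrix.trace M) ^ 2 - Matrix.trace (M * M))

open scoped ContDiff Topology

/-- The partial derivative `∂ᵢ g`. -/
def pd (i : Fin 4) (g : Eu 4 → ℝ) (x : Eu 4) : ℝ := fderiv ℝ g x (EuclideanSpace.single i 1)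

/-- Smooth compactly supported functions. -/
structure IsTest (φ : Eu 4 → ℝ) : Prop where
  smooth : ContDiff ℝ ∞ φ
  compact : HasCompactSupport φ

lemma contDiff_pd {g : Eu 4 → ℝ} (hg : ContDiff ℝ ∞ g) (i : Fin 4) : ContDiff ℝ ∞ (pd i g) :=
  (hg.fderiv_right (m := ∞) (by simp)).clm_apply contDiff_const

lemma pd_pd_eq {g : Eu 4 → ℝ} (hg : ContDiff ℝ ∞ g) (i j : Fin 4) (x : Eu 4) :
    pd i (pd j g) x
      = fderiv ℝ (fderiv ℝ g) x (EuclideanSpace.single i 1) (EuclideanSpace.single j 1) := by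
  have h : DifferentiableAt ℝ (fderiv ℝ g) x :=
    ((hg.fderiv_right (m := ∞) (by simp)).differentiable (by simp)) x
  change fderiv ℝ (fun y => fderiv ℝ g y (EuclideanSpace.single j 1)) x _ = _
  rw [fderiv_clm_apply h (differentiableAt_const _)]
  simp

lemma iteratedFDeriv_two_eq_pd {g : Eu 4 → ℝ} (hg : ContDiff ℝ ∞ g) (i j : Fin 4) (x : Eu 4) :
    iteratedFDeriv ℝ 2 g x ![EuclideanSpace.single i 1, EuclideanSpace.single j 1]
      = pd i (pd j g) x := by
  rw [iteratedFDeriv_two_apply, pd_pd_eq hg]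
  simp

lemma lap_eq {g : Eu 4 → ℝ} (hg : ContDiff ℝ ∞ g) : lap g = fun x => ∑ i, pd i (pd i g) x := by
  ext x
  exact Finset.sum_congr rfl fun i _ => iteratedFDeriv_two_eq_pd hg i i x

lemma pd_comm {g : Eu 4 → ℝ} (hg : ContDiff ℝ ∞ g) (i j : Fin 4) :
    pd i (pd j g) = pd j (pd i g) := by
  ext x
  have hs : IsSymmSndFDerivAt ℝ g x := (hg.contDiffAt).isSymmSndFDerivAt (by
    simp only [minSmoothness_of_isRCLikeNormedField]; exact WithTop.coe_le_coe.2 (le_top : (2 : ℕ∞) ≤ ⊤))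
  rw [pd_pd_eq hg, pd_pd_eq hg]
  exact hs.eq _ _

lemma contDiff_lap {g : Eu 4 → ℝ} (hg : ContDiff ℝ ∞ g) : ContDiff ℝ ∞ (lap g) := by
  rw [lap_eq hg]
  exact ContDiff.sum fun i _ => contDiff_pd (contDiff_pd hg i) i

lemma gradient_apply_eq_pd (g : Eu 4 → ℝ) (x : Eu 4) (i : Fin 4) : gradient g x i = pd i g x := by
  have h : inner ℝ (gradient g x) (EuclideanSpace.single i (1 : ℝ)) = pd i g x := by
    simp [gradient, pd]
  rw [← h, EuclideanSpace.inner_single_right]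
  simp

lemma norm_gradient_sq (g : Eu 4 → ℝ) (x : Eu 4) : ‖gradient g x‖ ^ 2 = ∑ i, pd i g x ^ 2 := by
  rw [EuclideanSpace.norm_sq_eq]
  simp [gradient_apply_eq_pd]

lemma differentiable_of_smooth {g : Eu 4 → ℝ} (hg : ContDiff ℝ ∞ g) : Differentiable ℝ g :=
  hg.differentiable (by simp)

lemma pd_mul {g h : Eu 4 → ℝ} (hg : ContDiff ℝ ∞ g) (hh : ContDiff ℝ ∞ h) (i : Fin 4) :
    pd i (fun x => g x * h x) = fun x => pd i g x * h x + g x * pd i h x := by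
  ext x
  simp only [pd]
  rw [fderiv_fun_mul (differentiable_of_smooth hg x) (differentiable_of_smooth hh x)]
  simp; ring

lemma pd_add {g h : Eu 4 → ℝ} (hg : ContDiff ℝ ∞ g) (hh : ContDiff ℝ ∞ h) (i : Fin 4) :
    pd i (fun x => g x + h x) = fun x => pd i g x + pd i h x := by
  ext x
  simp only [pd]
  rw [fderiv_fun_add (differentiable_of_smooth hg x) (differentiable_of_smooth hh x)]
  simp

lemma pd_sub {g h : Eu 4 → ℝ} (hg : ContDiff ℝ ∞ g) (hh : ContDiff ℝ ∞ h) (i : Fin 4) :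
    pd i (fun x => g x - h x) = fun x => pd i g x - pd i h x := by
  ext x
  simp only [pd]
  rw [fderiv_fun_sub (differentiable_of_smooth hg x) (differentiable_of_smooth hh x)]
  simp

lemma pd_sum {g : Fin 4 → Eu 4 → ℝ} (hg : ∀ j, ContDiff ℝ ∞ (g j)) (i : Fin 4) :
    pd i (fun x => ∑ j, g j x) = fun x => ∑ j, pd i (g j) x := by
  ext x
  simp only [pd]
  rw [fderiv_fun_sum fun j _ => differentiable_of_smooth (hg j) x]
  simp

/-- Chain rule for an affine rescaling and reflection. -/
lemma pd_comp_smul_sub {g : Eu 4 → ℝ} (hg : ContDiff ℝ ∞ g) (i : Fin 4) (c : ℝ) (p : Eu 4) :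
    pd i (fun y => g (c • (p - y))) = fun y => -(c * pd i g (c • (p - y))) := by
  ext y
  have h1 : HasFDerivAt (fun y : Eu 4 => c • (p - y))
      (c • (-ContinuousLinearMap.id ℝ (Eu 4))) y := by
    exact ((hasFDerivAt_id (𝕜 := ℝ) y).const_sub p).fun_const_smul c
  have h2 := (differentiable_of_smooth hg (c • (p - y))).hasFDerivAt.comp y h1
  simp only [pd]
  have h3 := h2.fderiv
  simp only [Function.comp_def] at h3
  rw [h3]
  simp

lemma pd_comp_smul {g : Eu 4 → ℝ} (hg : ContDiff ℝ ∞ g) (i : Fin 4) (c : ℝ) :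
    pd i (fun y => g (c • y)) = fun y => c * pd i g (c • y) := by
  have h := pd_comp_smul_sub hg i (-c) 0
  ext y
  have := congrFun h y
  simpa using this

namespace IsTest

variable {φ ψ : Eu 4 → ℝ}

lemma continuous (h : IsTest φ) : Continuous φ := h.smooth.continuous

lemma pd (h : IsTest φ) (i : Fin 4) : IsTest (pd i φ) :=
  ⟨contDiff_pd h.smooth i, h.compact.fderiv_apply (𝕜 := ℝ) _⟩

lemma mul_left (h : IsTest φ) {g : Eu 4 → ℝ} (hg : ContDiff ℝ ∞ g) :
    IsTest (fun x => g x * φ x) := ⟨hg.mul h.smooth, h.compact.mul_left⟩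

lemma mul_right (h : IsTest φ) {g : Eu 4 → ℝ} (hg : ContDiff ℝ ∞ g) :
    IsTest (fun x => φ x * g x) := ⟨h.smooth.mul hg, h.compact.mul_right⟩

lemma sum {φ : Fin 4 → Eu 4 → ℝ} (h : ∀ i, IsTest (φ i)) : IsTest (fun x => ∑ i, φ i x) := by
  refine ⟨ContDiff.sum fun i _ => (h i).smooth, ?_⟩
  have : (fun x => ∑ i, φ i x) = φ 0 + φ 1 + φ 2 + φ 3 := by
    ext x; simp [Fin.sum_univ_four]
  rw [this]
  exact (((h 0).compact.add (h 1).compact).add (h 2).compact).add (h 3).compact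

lemma lap (h : IsTest φ) : IsTest (lap φ) := by
  rw [lap_eq h.smooth]
  exact sum fun i => (h.pd i).pd i

lemma integrable (h : IsTest φ) : Integrable φ :=
  h.continuous.integrable_of_hasCompactSupport h.compact

/-- Products with continuous functions are integrable. -/
lemma integrable_mul (h : IsTest φ) {g : Eu 4 → ℝ} (hg : Continuous g) :
    Integrable (fun x => φ x * g x) :=
  (h.continuous.mul hg).integrable_of_hasCompactSupport h.compact.mul_right

lemma comp_smul_sub (h : IsTest φ) {c : ℝ} (hc : c ≠ 0) (p : Eu 4) :
    IsTest (fun y => φ (c • (p - y))) := by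
  refine ⟨h.smooth.comp (g := φ) (f := fun y => c • (p - y)) (by fun_prop), ?_⟩
  have : (fun y => φ (c • (p - y))) =
      φ ∘ ((Homeomorph.subLeft p).trans (Homeomorph.smulOfNeZero c hc)) := by
    ext y; simp
  rw [this]
  exact h.compact.comp_homeomorph _

lemma comp_smul (h : IsTest φ) {c : ℝ} (hc : c ≠ 0) : IsTest (fun y => φ (c • y)) := by
  have := h.comp_smul_sub (neg_ne_zero.mpr hc) 0
  simpa using this

/-- A test function is bounded. -/
lemma exists_bound (h : IsTest φ) : ∃ C, 0 ≤ C ∧ ∀ x, |φ x| ≤ C := by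
  obtain ⟨C, hC⟩ := h.continuous.bounded_above_of_compact_support h.compact
  exact ⟨max C 0, le_max_right _ _, fun x => (hC x).trans (le_max_left _ _)⟩

/-- A test function is supported in a ball. -/
lemma exists_radius (h : IsTest φ) : ∃ K, 0 < K ∧ ∀ x, K < ‖x‖ → φ x = 0 := by
  obtain ⟨K, hK⟩ := h.compact.isCompact.isBounded.exists_norm_le
  refine ⟨max K 1, by positivity, fun x hx => ?_⟩
  by_contra hne
  have := hK x (subset_tsupport _ hne)
  exact absurd (this.trans (le_max_left K 1)) (not_le.mpr hx)

end IsTest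

/-- Integration by parts against a test function. -/
lemma integral_mul_pd {φ g : Eu 4 → ℝ} (hφ : IsTest φ) (hg : ContDiff ℝ ∞ g) (i : Fin 4) :
    ∫ x, φ x * pd i g x = -∫ x, pd i φ x * g x := by
  have h := integral_mul_fderiv_eq_neg_fderiv_mul_of_integrable (μ := (volume : Measure (Eu 4)))
    (f := φ) (g := g) (v := EuclideanSpace.single i (1 : ℝ))
    ((hφ.pd i).integrable_mul hg.continuous)
    (hφ.integrable_mul (contDiff_pd hg i).continuous)
    (hφ.integrable_mul hg.continuous)
    (fun x _ => differentiable_of_smooth hφ.smooth x) (fun x _ => differentiable_of_smooth hg x)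
  exact h

lemma integral_mul_lap {φ g : Eu 4 → ℝ} (hφ : IsTest φ) (hg : ContDiff ℝ ∞ g) :
    ∫ x, φ x * lap g x = -∑ i, ∫ x, pd i φ x * pd i g x := by
  rw [lap_eq hg]
  simp only [Finset.mul_sum]
  rw [integral_finsetSum _ fun i _ =>
    hφ.integrable_mul (contDiff_pd (contDiff_pd hg i) i).continuous, ← Finset.sum_neg_distrib]
  exact Finset.sum_congr rfl fun i _ => integral_mul_pd hφ (contDiff_pd hg i) i

lemma integral_mul_lap_comm {φ g : Eu 4 → ℝ} (hφ : IsTest φ) (hg : ContDiff ℝ ∞ g) :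
    ∫ x, φ x * lap g x = ∫ x, lap φ x * g x := by
  rw [integral_mul_lap hφ hg, lap_eq hφ.smooth]
  simp only [Finset.sum_mul]
  rw [integral_finsetSum _ fun i _ => ((hφ.pd i).pd i).integrable_mul hg.continuous,
    ← Finset.sum_neg_distrib]
  refine Finset.sum_congr rfl fun i _ => ?_
  rw [integral_mul_pd (hφ.pd i) hg i, neg_neg]

/-- The squared length of the Euclidean gradient. -/
def gradSq (u : Eu 4 → ℝ) (x : Eu 4) : ℝ := ∑ i, pd i u x ^ 2

lemma gradSq_nonneg (u : Eu 4 → ℝ) (x : Eu 4) : 0 ≤ gradSq u x :=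
  Finset.sum_nonneg fun _ _ => sq_nonneg _

lemma contDiff_gradSq {u : Eu 4 → ℝ} (hu : ContDiff ℝ ∞ u) : ContDiff ℝ ∞ (gradSq u) :=
  ContDiff.sum fun i _ => (contDiff_pd hu i).pow 2

/-- The function `y ↦ φ((p - y)/r)`. -/
def rescale (φ : Eu 4 → ℝ) (p : Eu 4) (r : ℝ) (y : Eu 4) : ℝ := φ (r⁻¹ • (p - y))

lemma contDiff_rescale {φ : Eu 4 → ℝ} (h : ContDiff ℝ ∞ φ) (p : Eu 4) (r : ℝ) :
    ContDiff ℝ ∞ (rescale φ p r) :=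
  h.comp (g := φ) (f := fun y => r⁻¹ • (p - y)) (by fun_prop)

lemma IsTest.rescale {φ : Eu 4 → ℝ} (h : IsTest φ) (p : Eu 4) {r : ℝ} (hr : 0 < r) :
    IsTest (rescale φ p r) := h.comp_smul_sub (inv_ne_zero hr.ne') p

lemma pd_rescale {φ : Eu 4 → ℝ} (h : ContDiff ℝ ∞ φ) (p : Eu 4) (r : ℝ) (i : Fin 4) :
    pd i (rescale φ p r) = fun y => -(r⁻¹ * rescale (pd i φ) p r y) :=
  pd_comp_smul_sub h i r⁻¹ p

lemma pd_const_mul {φ : Eu 4 → ℝ} (h : ContDiff ℝ ∞ φ) (c : ℝ) (i : Fin 4) :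
    pd i (fun y => c * φ y) = fun y => c * pd i φ y := by
  rw [pd_mul contDiff_const h]
  ext y
  simp [pd]

lemma lap_rescale {φ : Eu 4 → ℝ} (h : ContDiff ℝ ∞ φ) (p : Eu 4) (r : ℝ) :
    lap (rescale φ p r) = fun y => r⁻¹ ^ 2 * rescale (lap φ) p r y := by
  rw [lap_eq (contDiff_rescale h p r)]
  ext y
  have : ∀ i, pd i (pd i (rescale φ p r)) y = r⁻¹ ^ 2 * rescale (pd i (pd i φ)) p r y := by
    intro i
    rw [pd_rescale h]
    have h2 : (fun y => -(r⁻¹ * rescale (pd i φ) p r y)) =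
      fun y => (-r⁻¹) * rescale (pd i φ) p r y := by ext; ring
    rw [h2, pd_const_mul (contDiff_rescale (contDiff_pd h i) p r), pd_rescale (contDiff_pd h i)]
    ring
  simp only [this, rescale]
  rw [lap_eq h, Finset.mul_sum]

lemma integral_rescale (φ : Eu 4 → ℝ) (p : Eu 4) {r : ℝ} (hr : 0 < r) :
    ∫ y, rescale φ p r y = r ^ 4 * ∫ y, φ y := by
  have h1 := integral_sub_left_eq_self (fun y => φ (r⁻¹ • y)) (volume : Measure (Eu 4)) p
  have h2 := Measure.integral_comp_inv_smul (volume : Measure (Eu 4)) φ r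
  simp only [rescale]
  rw [h1, h2]
  simp [abs_of_pos hr]

/-- A radial cutoff: `1` on the unit ball, `0` outside the ball of radius `2`. -/
def cutoff (x : Eu 4) : ℝ := Real.smoothTransition ((4 - ‖x‖ ^ 2) / 3)

lemma cutoff_nonneg (x : Eu 4) : 0 ≤ cutoff x := Real.smoothTransition.nonneg _

lemma cutoff_le_one (x : Eu 4) : cutoff x ≤ 1 := Real.smoothTransition.le_one _

lemma cutoff_eq_one {x : Eu 4} (hx : ‖x‖ ≤ 1) : cutoff x = 1 :=
  Real.smoothTransition.one_of_one_le (by nlinarith [norm_nonneg x])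

lemma cutoff_eq_zero {x : Eu 4} (hx : 2 ≤ ‖x‖) : cutoff x = 0 :=
  Real.smoothTransition.zero_of_nonpos (by nlinarith [norm_nonneg x])

lemma isTest_of_support {φ : Eu 4 → ℝ} (h : ContDiff ℝ ∞ φ) {K : ℝ}
    (h0 : ∀ x, K < ‖x‖ → φ x = 0) : IsTest φ :=
  ⟨h, HasCompactSupport.intro (isCompact_closedBall 0 K) fun x hx => h0 x (by
    simpa using hx)⟩

lemma isTest_cutoff : IsTest cutoff :=
  isTest_of_support (Real.smoothTransition.contDiff.comp
    (((contDiff_const.sub (contDiff_norm_sq ℝ)).div_const 3))) (K := 2)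
    fun _ hx => cutoff_eq_zero hx.le

lemma setIntegral_le_integral_of_le {s : Set (Eu 4)} (hs : MeasurableSet s) {g h : Eu 4 → ℝ}
    (hg : IntegrableOn g s) (hh : Integrable h) (h0 : ∀ x, 0 ≤ h x) (hle : ∀ x ∈ s, g x ≤ h x) :
    ∫ x in s, g x ≤ ∫ x, h x :=
  (setIntegral_mono_on hg hh.integrableOn hs hle).trans
    (setIntegral_le_integral hh (Eventually.of_forall h0))

lemma integrableOn_ball {g : Eu 4 → ℝ} (hg : Continuous g) (p : Eu 4) (r : ℝ) :
    IntegrableOn g (ball p r) :=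
  (hg.continuousOn.integrableOn_compact (isCompact_closedBall p r)).mono_set ball_subset_closedBall

lemma IsTest.sq {η : Eu 4 → ℝ} (h : IsTest η) : IsTest (fun x => η x ^ 2) := by
  have := h.mul_left h.smooth
  simpa only [← pow_two] using this

lemma IsTest.gradSq {η : Eu 4 → ℝ} (h : IsTest η) : IsTest (gradSq η) :=
  IsTest.sum fun i => (h.pd i).sq

lemma pd_sq {η : Eu 4 → ℝ} (h : ContDiff ℝ ∞ η) (i : Fin 4) :
    pd i (fun x => η x ^ 2) = fun x => 2 * η x * pd i η x := by
  simp only [sq]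
  rw [pd_mul h h]
  ext x
  ring

/-- Energy inequality tested with a squared cutoff. -/
lemma integral_sq_mul_gradSq_le {u η : Eu 4 → ℝ} (hu : ContDiff ℝ ∞ u) (hη : IsTest η) :
    ∫ x, η x ^ 2 * gradSq u x ≤
      2 * (∫ x, η x ^ 2 * (lap u x + gradSq u x)) + 4 * ∫ x, gradSq η x := by
  have hlap : Continuous (lap u) := (contDiff_lap hu).continuous
  have hg : Continuous (gradSq u) := (contDiff_gradSq hu).continuous
  have h1 : ∫ x, η x ^ 2 * (lap u x + gradSq u x) =
      (∫ x, η x ^ 2 * lap u x) + ∫ x, η x ^ 2 * gradSq u x := by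
    simp only [mul_add]
    exact integral_add (hη.sq.integrable_mul hlap) (hη.sq.integrable_mul hg)
  have hint : ∀ i, Integrable fun x => 2 * η x * pd i η x * pd i u x := fun i => by
    have := (hη.sq.pd i).integrable_mul (contDiff_pd hu i).continuous
    rwa [pd_sq hη.smooth] at this
  have h2 : ∫ x, η x ^ 2 * lap u x = -∫ x, ∑ i, 2 * η x * pd i η x * pd i u x := by
    rw [integral_mul_lap hη.sq hu, integral_finsetSum _ fun i _ => hint i]
    simp only [pd_sq hη.smooth]
  have h3 : ∫ x, ∑ i, 2 * η x * pd i η x * pd i u x ≤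
      ∫ x, (1 / 2 * (η x ^ 2 * gradSq u x) + 2 * gradSq η x) := by
    refine integral_mono (integrable_finsetSum _ fun i _ => hint i)
      (((hη.sq.integrable_mul hg).const_mul _).add (hη.gradSq.integrable.const_mul _)) fun x => ?_
    simp only [gradSq, Finset.mul_sum, ← Finset.sum_add_distrib]
    refine Finset.sum_le_sum fun i _ => ?_
    nlinarith [sq_nonneg (η x * pd i u x - 2 * pd i η x)]
  rw [integral_add ((hη.sq.integrable_mul hg).const_mul _) (hη.gradSq.integrable.const_mul _),
    integral_const_mul, integral_const_mul] at h3
  linarith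

lemma gradSq_rescale {φ : Eu 4 → ℝ} (h : ContDiff ℝ ∞ φ) (p : Eu 4) (r : ℝ) (y : Eu 4) :
    gradSq (rescale φ p r) y = r⁻¹ ^ 2 * rescale (gradSq φ) p r y := by
  simp only [gradSq, pd_rescale h, rescale, Finset.mul_sum]
  refine Finset.sum_congr rfl fun i _ => ?_
  ring

/-- The Caccioppoli inequality. -/
lemma exists_gradSq_ball_le {u : Eu 4 → ℝ} (hu : ContDiff ℝ ∞ u)
    (hE : Integrable fun x => (lap u x + gradSq u x) ^ 2) :
    ∃ C, 0 ≤ C ∧ ∀ p r, 0 < r → ∫ y in ball p r, gradSq u y ≤ C * r ^ 2 := by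
  set e := ∫ x, (lap u x + gradSq u x) ^ 2 with he
  set k := ∫ x, cutoff x ^ 4 with hk
  set g := ∫ x, gradSq cutoff x with hg
  have he0 : 0 ≤ e := integral_nonneg fun _ => sq_nonneg _
  have hk0 : 0 ≤ k := integral_nonneg fun _ => by positivity
  have hg0 : 0 ≤ g := integral_nonneg fun _ => gradSq_nonneg _ _
  refine ⟨k + e + 4 * g, by positivity, fun p r hr => ?_⟩
  have hη := isTest_cutoff.rescale p hr
  set η := rescale cutoff p r with hηdef
  have h1 : ∫ y in ball p r, gradSq u y ≤ ∫ y, η y ^ 2 * gradSq u y := by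
    refine setIntegral_le_integral_of_le measurableSet_ball
      (integrableOn_ball (contDiff_gradSq hu).continuous p r)
      (hη.sq.integrable_mul (contDiff_gradSq hu).continuous)
      (fun x => mul_nonneg (sq_nonneg _) (gradSq_nonneg _ _)) fun x hx => ?_
    have : η x = 1 := cutoff_eq_one (by
      rw [norm_smul, norm_inv, Real.norm_of_nonneg hr.le, inv_mul_le_iff₀ hr, mul_one,
        ← dist_eq_norm, dist_comm]
      exact (mem_ball.mp hx).le)
    simp [this]
  have h2 := integral_sq_mul_gradSq_le hu hη
  have h3 : ∫ x, gradSq η x = r ^ 2 * g := by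
    simp only [hηdef, gradSq_rescale isTest_cutoff.smooth]
    rw [integral_const_mul, integral_rescale _ _ hr]
    rw [← hg]
    field_simp
  have hi4 : Integrable fun x => η x ^ 4 := by
    have := (hη.sq.mul_left hη.sq.smooth).integrable
    refine this.congr (Eventually.of_forall fun x => ?_)
    simp only; ring
  have h4 : ∫ x, η x ^ 4 = r ^ 4 * k := integral_rescale (fun x => cutoff x ^ 4) p hr
  have h5 : ∫ x, η x ^ 2 * (lap u x + gradSq u x) ≤
      ∫ x, (1 / 2 * r⁻¹ ^ 2 * η x ^ 4 + 1 / 2 * r ^ 2 * (lap u x + gradSq u x) ^ 2) := by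
    refine integral_mono (hη.sq.integrable_mul
      ((contDiff_lap hu).add (contDiff_gradSq hu)).continuous)
      ((hi4.const_mul _).add (hE.const_mul _)) fun x => ?_
    have hx : r⁻¹ * r = 1 := inv_mul_cancel₀ hr.ne'
    have h6 : η x ^ 2 * (lap u x + gradSq u x) =
      (r⁻¹ * η x ^ 2) * (r * (lap u x + gradSq u x)) := by
      linear_combination (-(η x ^ 2 * (lap u x + gradSq u x))) * hx
    simp only [h6]
    nlinarith [sq_nonneg (r⁻¹ * η x ^ 2 - r * (lap u x + gradSq u x))]
  rw [integral_add (hi4.const_mul _) (hE.const_mul _), integral_const_mul, integral_const_mul,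
    h4, ← he] at h5
  have h6 : 1 / 2 * r⁻¹ ^ 2 * (r ^ 4 * k) = 1 / 2 * r ^ 2 * k := by field_simp
  rw [h6] at h5
  rw [h3] at h2
  nlinarith

lemma volume_real_ball (p : Eu 4) {r : ℝ} (hr : 0 ≤ r) :
    (volume : Measure (Eu 4)).real (ball p r) = r ^ 4 * (Real.pi ^ 2 / 2) := by
  have hG : Real.Gamma ((4 : ℝ) / 2 + 1) = 2 := by
    have := Real.Gamma_nat_eq_factorial 2
    norm_num [Nat.factorial] at this ⊢
  have hs : √Real.pi ^ 4 = Real.pi ^ 2 := by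
    rw [show (4 : ℕ) = 2 * 2 by norm_num, pow_mul, Real.sq_sqrt Real.pi_pos.le]
  rw [Measure.real, EuclideanSpace.volume_ball]
  simp only [Fintype.card_fin, Nat.cast_ofNat]
  rw [hG, hs, ENNReal.toReal_mul, ENNReal.toReal_pow, ENNReal.toReal_ofReal hr,
    ENNReal.toReal_ofReal (by positivity)]

lemma integral_radial (h : ℝ → ℝ) :
    ∫ x : Eu 4, h ‖x‖ = 2 * Real.pi ^ 2 * ∫ y in Ioi (0 : ℝ), y ^ 3 * h y := by
  rw [integral_fun_norm_addHaar, volume_real_ball 0 zero_le_one]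
  simp
  ring

lemma integral_Ioi_deriv {F F' : ℝ → ℝ} (hF : ∀ y, HasDerivAt F (F' y) y) (hF' : Continuous F')
    {M L : ℝ} (hM : 0 ≤ M) (hL : ∀ y, M < y → F y = L) : ∫ y in Ioi (0 : ℝ), F' y = L - F 0 := by
  have h0 : ∀ y, M < y → F' y = 0 := fun y hy => by
    have h1 : F =ᶠ[𝓝 y] fun _ => L := by
      filter_upwards [lt_mem_nhds hy] with z hz using hL z hz
    rw [← (hF y).deriv, h1.deriv_eq, deriv_const]
  refine integral_Ioi_of_hasDerivAt_of_tendsto (hF 0).continuousAt.continuousWithinAt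
    (fun x _ => hF x) ?_ ?_
  · rw [← Ioc_union_Ioi_eq_Ioi hM]
    refine IntegrableOn.union ?_ ?_
    · exact (hF'.continuousOn.integrableOn_compact isCompact_Icc).mono_set Ioc_subset_Icc_self
    · exact integrableOn_zero.congr_fun (fun y hy => (h0 y hy).symm) measurableSet_Ioi
  · refine tendsto_const_nhds.congr' ?_
    filter_upwards [eventually_gt_atTop M] with y hy using (hL y hy).symm

lemma pd_coord (i j : Fin 4) (x : Eu 4) :
    pd i (fun y : Eu 4 => y j) x = if i = j then 1 else 0 := by
  have : (fun y : Eu 4 => y j) = EuclideanSpace.proj (𝕜 := ℝ) j := rfl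
  rw [pd, this, ContinuousLinearMap.fderiv]
  simp [eq_comm]

lemma contDiff_coord (j : Fin 4) : ContDiff ℝ ∞ (fun y : Eu 4 => y j) :=
  (EuclideanSpace.proj (𝕜 := ℝ) j : Eu 4 →L[ℝ] ℝ).contDiff

lemma contDiff_radial {G : ℝ → ℝ} (hG : ContDiff ℝ ∞ G) :
    ContDiff ℝ ∞ (fun x : Eu 4 => G (‖x‖ ^ 2)) := hG.comp (contDiff_norm_sq ℝ)

lemma contDiff_deriv {G : ℝ → ℝ} (hG : ContDiff ℝ ∞ G) : ContDiff ℝ ∞ (deriv G) :=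
  ((contDiff_infty_iff_deriv (𝕜 := ℝ)).1 hG).2

lemma hasDerivAt_of_smooth {G : ℝ → ℝ} (hG : ContDiff ℝ ∞ G) (s : ℝ) :
    HasDerivAt G (deriv G s) s := (hG.differentiable (by simp) s).hasDerivAt

lemma pd_radial {G : ℝ → ℝ} {x : Eu 4} (hG : DifferentiableAt ℝ G (‖x‖ ^ 2)) (i : Fin 4) :
    pd i (fun x => G (‖x‖ ^ 2)) x = 2 * x i * deriv G (‖x‖ ^ 2) := by
  have h1 : HasFDerivAt (fun x : Eu 4 => ‖x‖ ^ 2) (2 • (innerSL ℝ) x) x :=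
    (hasStrictFDerivAt_norm_sq x).hasFDerivAt
  have h2 := hG.hasDerivAt.comp_hasFDerivAt x h1
  rw [pd]
  have h3 := h2.fderiv
  simp only [Function.comp_def] at h3
  rw [h3]
  simp [EuclideanSpace.inner_single_right]
  ring

/-- The Laplacian of a radial function of `‖x‖²`, as a function of `s = ‖x‖²`. -/
def radLap (G : ℝ → ℝ) (s : ℝ) : ℝ := 8 * deriv G s + 4 * s * deriv (deriv G) s

lemma contDiff_radLap {G : ℝ → ℝ} (hG : ContDiff ℝ ∞ G) : ContDiff ℝ ∞ (radLap G) :=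
  (contDiff_const.mul (contDiff_deriv hG)).add
    ((contDiff_const.mul contDiff_id).mul (contDiff_deriv (contDiff_deriv hG)))

lemma lap_radial {G : ℝ → ℝ} (hG : ContDiff ℝ ∞ G) :
    lap (fun x : Eu 4 => G (‖x‖ ^ 2)) = fun x => radLap G (‖x‖ ^ 2) := by
  rw [lap_eq (contDiff_radial hG)]
  ext x
  have h1 : ∀ i, pd i (fun x : Eu 4 => G (‖x‖ ^ 2)) = fun x => x i * (2 * deriv G (‖x‖ ^ 2)) := by
    intro i
    ext x
    rw [pd_radial (hG.differentiable (by simp) _)]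
    ring
  have h2 : ∀ i, pd i (pd i (fun x : Eu 4 => G (‖x‖ ^ 2))) x =
      2 * deriv G (‖x‖ ^ 2) + 4 * x i ^ 2 * deriv (deriv G) (‖x‖ ^ 2) := by
    intro i
    rw [h1, pd_mul (contDiff_coord i) (contDiff_const.mul (contDiff_radial (contDiff_deriv hG))),
      pd_const_mul (contDiff_radial (contDiff_deriv hG))]
    simp only [pd_coord]
    rw [pd_radial ((contDiff_deriv hG).differentiable (by simp) _)]
    simp
    ring
  have hn : ∑ i, x i ^ 2 = ‖x‖ ^ 2 := by simp [EuclideanSpace.norm_sq_eq]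
  simp only [h2, radLap, Finset.sum_add_distrib]
  rw [← Finset.sum_mul, ← Finset.sum_mul, ← Finset.mul_sum, hn]
  simp only [Finset.sum_const, Finset.card_univ, Fintype.card_fin, nsmul_eq_mul]
  push_cast
  ring

/-- The integral of the Laplacian of a radial function. -/
lemma integral_radLap {H : ℝ → ℝ} (hH : ContDiff ℝ ∞ H) {M L : ℝ} (hM : 0 ≤ M)
    (hL : ∀ s, M < s → s ^ 2 * deriv H s = L) :
    ∫ x : Eu 4, radLap H (‖x‖ ^ 2) = 4 * Real.pi ^ 2 * L := by
  rw [integral_radial (fun y => radLap H (y ^ 2))]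
  have h1 : ∀ y : ℝ, HasDerivAt (fun y => 2 * y ^ 4 * deriv H (y ^ 2))
      (y ^ 3 * radLap H (y ^ 2)) y := by
    intro y
    have h2 := (hasDerivAt_of_smooth (contDiff_deriv hH) (y ^ 2)).comp y (hasDerivAt_pow 2 y)
    have h3 := ((hasDerivAt_pow 4 y).const_mul 2).fun_mul h2
    refine h3.congr_deriv ?_
    simp [radLap]
    ring
  rw [integral_Ioi_deriv h1 (M := M + 1) (L := 2 * L)]
  · simp; ring
  · exact (continuous_pow 3).mul ((contDiff_radLap hH).continuous.comp (continuous_pow 2))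
  · linarith
  · intro y hy
    rw [← hL (y ^ 2) (by nlinarith)]
    ring

/-- A smooth profile equal to `(log s)/2` for `s ≥ 1` and to `0` for `s ≤ 1/4`. -/
def logProfile (s : ℝ) : ℝ := Real.smoothTransition ((4 * s - 1) / 3) * (Real.log s / 2)

lemma logProfile_of_le {s : ℝ} (hs : s ≤ 1 / 4) : logProfile s = 0 := by
  rw [logProfile, Real.smoothTransition.zero_of_nonpos (by linarith), zero_mul]

lemma logProfile_of_ge {s : ℝ} (hs : 1 ≤ s) : logProfile s = Real.log s / 2 := by
  rw [logProfile, Real.smoothTransition.one_of_one_le (by linarith), one_mul]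

lemma contDiff_logProfile : ContDiff ℝ ∞ logProfile := by
  rw [contDiff_iff_contDiffAt]
  intro s
  rcases lt_or_ge s (1 / 4) with h | h
  · refine (contDiffAt_const (c := (0 : ℝ))).congr_of_eventuallyEq ?_
    filter_upwards [gt_mem_nhds h] with t ht using logProfile_of_le ht.le
  · have h1 : ContDiff ℝ ∞ fun s : ℝ => Real.smoothTransition ((4 * s - 1) / 3) :=
      Real.smoothTransition.contDiff.comp (f := fun s : ℝ => (4 * s - 1) / 3) (by fun_prop)
    exact h1.contDiffAt.mul ((Real.contDiffAt_log.2 (by linarith)).div_const 2)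

lemma deriv_eq_of_eqOn_Ioi {G K K' : ℝ → ℝ} {a : ℝ} (h : ∀ s, a < s → G s = K s)
    (hK : ∀ s, a < s → HasDerivAt K (K' s) s) {s : ℝ} (hs : a < s) : deriv G s = K' s := by
  have h1 : G =ᶠ[𝓝 s] K := by
    filter_upwards [lt_mem_nhds hs] with t ht using h t ht
  rw [h1.deriv_eq, (hK s hs).deriv]

lemma deriv_logProfile {s : ℝ} (hs : 1 < s) : deriv logProfile s = s⁻¹ / 2 :=
  deriv_eq_of_eqOn_Ioi (K := fun s => Real.log s / 2) (fun _ h => logProfile_of_ge h.le)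
    (fun t ht => (Real.hasDerivAt_log (by linarith)).div_const 2) hs

lemma deriv_deriv_logProfile {s : ℝ} (hs : 1 < s) :
    deriv (deriv logProfile) s = -(s ^ 2)⁻¹ / 2 :=
  deriv_eq_of_eqOn_Ioi (K := fun s => s⁻¹ / 2) (fun _ h => deriv_logProfile h)
    (fun _ ht => (hasDerivAt_inv (zero_lt_one.trans ht).ne').div_const 2) hs

lemma radLap_logProfile {s : ℝ} (hs : 1 < s) : radLap logProfile s = 2 * s⁻¹ := by
  have : s ≠ 0 := by linarith
  rw [radLap, deriv_logProfile hs, deriv_deriv_logProfile hs]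
  field_simp
  norm_num

lemma deriv_radLap_logProfile {s : ℝ} (hs : 1 < s) :
    deriv (radLap logProfile) s = 2 * -(s ^ 2)⁻¹ :=
  deriv_eq_of_eqOn_Ioi (K := fun s => 2 * s⁻¹) (fun _ h => radLap_logProfile h)
    (fun _ ht => (hasDerivAt_inv (zero_lt_one.trans ht).ne').const_mul 2) hs

lemma deriv_deriv_radLap_logProfile {s : ℝ} (hs : 1 < s) :
    deriv (deriv (radLap logProfile)) s = 4 * (s ^ 3)⁻¹ := by
  refine deriv_eq_of_eqOn_Ioi (K := fun s => 2 * -(s ^ 2)⁻¹)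
    (fun _ h => deriv_radLap_logProfile h) (K' := fun s => 4 * (s ^ 3)⁻¹) (fun t ht => ?_) hs
  have ht0 : t ≠ 0 := by linarith
  refine (((hasDerivAt_pow 2 t).inv (pow_ne_zero 2 ht0)).neg.const_mul 2).congr_deriv ?_
  field_simp
  push_cast
  ring

lemma radLap_radLap_logProfile {s : ℝ} (hs : 1 < s) : radLap (radLap logProfile) s = 0 := by
  have : s ≠ 0 := by linarith
  rw [radLap, deriv_radLap_logProfile hs, deriv_deriv_radLap_logProfile hs]
  field_simp
  norm_num

/-- A smooth function on `ℝ⁴` equal to `log ‖z‖` outside the unit ball. -/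
def logKernel (z : Eu 4) : ℝ := logProfile (‖z‖ ^ 2)

lemma contDiff_logKernel : ContDiff ℝ ∞ logKernel := contDiff_radial contDiff_logProfile

lemma logKernel_of_ge {z : Eu 4} (hz : 1 ≤ ‖z‖) : logKernel z = Real.log ‖z‖ := by
  rw [logKernel, logProfile_of_ge (by nlinarith), Real.log_pow]
  push_cast
  ring

lemma logKernel_of_le {z : Eu 4} (hz : ‖z‖ ≤ 1 / 2) : logKernel z = 0 :=
  logProfile_of_le (by nlinarith [norm_nonneg z])

/-- The bi-Laplacian of `logKernel`, a smooth bump supported in the unit ball. -/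
def biKernel : Eu 4 → ℝ := lap (lap logKernel)

lemma biKernel_eq (z : Eu 4) : biKernel z = radLap (radLap logProfile) (‖z‖ ^ 2) := by
  have h1 : lap logKernel = fun x => radLap logProfile (‖x‖ ^ 2) :=
    lap_radial contDiff_logProfile
  rw [biKernel, h1, lap_radial (contDiff_radLap contDiff_logProfile)]

lemma biKernel_eq_zero {z : Eu 4} (hz : 1 < ‖z‖) : biKernel z = 0 := by
  rw [biKernel_eq, radLap_radLap_logProfile (by nlinarith)]

lemma isTest_biKernel : IsTest biKernel :=
  isTest_of_support (contDiff_lap (contDiff_lap contDiff_logKernel)) fun _ => biKernel_eq_zero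

lemma integral_biKernel : ∫ z, biKernel z = -(8 * Real.pi ^ 2) := by
  simp only [biKernel_eq]
  rw [integral_radLap (contDiff_radLap contDiff_logProfile) zero_le_one (L := -2)]
  · ring
  · intro s hs
    have : s ≠ 0 := by linarith
    rw [deriv_radLap_logProfile hs]
    field_simp

lemma pd_logKernel {z : Eu 4} (hz : 1 < ‖z‖) (i : Fin 4) :
    pd i logKernel z = z i / ‖z‖ ^ 2 := by
  have h := pd_radial (x := z) (contDiff_logProfile.differentiable (by simp) _) i
  have h2 : pd i logKernel z = 2 * z i * deriv logProfile (‖z‖ ^ 2) := h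
  rw [h2, deriv_logProfile (by nlinarith)]
  field_simp

lemma abs_coord_le (z : Eu 4) (i : Fin 4) : |z i| ≤ ‖z‖ := by
  simpa using PiLp.norm_apply_le z i

lemma exists_pd_logKernel_bound (i : Fin 4) :
    ∃ C, 0 ≤ C ∧ ∀ z, |pd i logKernel z| ≤ C ∧ |pd i logKernel z| ≤ C * ‖z‖⁻¹ := by
  obtain ⟨C, hC⟩ := (isCompact_closedBall (0 : Eu 4) 1).exists_bound_of_continuousOn
    (contDiff_pd contDiff_logKernel i).continuous.continuousOn
  have h0 : pd i logKernel 0 = 0 := by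
    have h := pd_radial (x := (0 : Eu 4)) (contDiff_logProfile.differentiable (by simp) _) i
    have h2 : pd i logKernel 0 = 2 * (0 : Eu 4) i * deriv logProfile (‖(0 : Eu 4)‖ ^ 2) := h
    simpa using h2
  refine ⟨max C 1, by positivity, fun z => ?_⟩
  rcases le_or_gt ‖z‖ 1 with hz | hz
  · have h1 : |pd i logKernel z| ≤ max C 1 := (hC z (by simpa using hz)).trans (le_max_left _ _)
    refine ⟨h1, ?_⟩
    rcases eq_or_ne z 0 with rfl | hne
    · simp [h0]
    · have h3 : 1 ≤ ‖z‖⁻¹ := (one_le_inv₀ (norm_pos_iff.mpr hne)).2 hz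
      nlinarith [abs_nonneg (pd i logKernel z)]
  · have hz0 : 0 < ‖z‖ := by linarith
    have h1 : |pd i logKernel z| ≤ ‖z‖⁻¹ := by
      rw [pd_logKernel hz, abs_div, abs_of_pos (by positivity : 0 < ‖z‖ ^ 2), div_le_iff₀
        (by positivity), pow_two, inv_mul_cancel_left₀ hz0.ne']
      exact abs_coord_le z i
    have h2 : ‖z‖⁻¹ ≤ 1 := inv_le_one_of_one_le₀ hz.le
    have h3 : (1 : ℝ) ≤ max C 1 := le_max_right _ _
    have h4 : 0 < ‖z‖⁻¹ := inv_pos.mpr hz0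
    exact ⟨by linarith, by nlinarith⟩

lemma lap_pd {u : Eu 4 → ℝ} (hu : ContDiff ℝ ∞ u) (i : Fin 4) :
    lap (pd i u) = pd i (lap u) := by
  rw [lap_eq hu, lap_eq (contDiff_pd hu i), pd_sum fun j => contDiff_pd (contDiff_pd hu j) j]
  ext x
  refine Finset.sum_congr rfl fun j _ => ?_
  rw [pd_comm hu j i, pd_comm (contDiff_pd hu j) j i]

/-- Weighted averages of `g` at scale `r`, including `r = 0`. -/
def mollify (φ g : Eu 4 → ℝ) (x : Eu 4) (r : ℝ) : ℝ := ∫ z, φ z * g (x - r • z)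

lemma mollify_zero (φ g : Eu 4 → ℝ) (x : Eu 4) : mollify φ g x 0 = (∫ z, φ z) * g x := by
  simp [mollify, integral_mul_const]

lemma integral_rescale_mul (φ g : Eu 4 → ℝ) (x : Eu 4) {r : ℝ} (hr : 0 < r) :
    ∫ y, rescale φ x r y * g y = r ^ 4 * mollify φ g x r := by
  have h := integral_rescale (fun z => φ z * g (x - r • z)) x hr
  rw [mollify, ← h]
  refine integral_congr_ae (Eventually.of_forall fun y => ?_)
  simp only [rescale]
  rw [smul_smul, mul_inv_cancel₀ hr.ne', one_smul, sub_sub_cancel]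

lemma continuous_mollify {φ g : Eu 4 → ℝ} (hφ : IsTest φ) (hg : Continuous g) :
    Continuous fun q : Eu 4 × ℝ => mollify φ g q.1 q.2 := by
  have h1 : Continuous (Function.uncurry fun (q : Eu 4 × ℝ) z => φ z * g (q.1 - q.2 • z)) :=
    (hφ.continuous.comp continuous_snd).mul (hg.comp (by fun_prop))
  have h2 := continuous_parametric_integral_of_continuous (μ := (volume : Measure (Eu 4))) h1
    (s := tsupport φ) hφ.compact
  refine h2.congr fun q => ?_
  refine setIntegral_eq_integral_of_forall_compl_eq_zero fun z hz => ?_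
  rw [image_eq_zero_of_notMem_tsupport hz, zero_mul]

lemma abs_integral_rescale_mul_le {φ g : Eu 4 → ℝ} {C K : ℝ}
    (hC : ∀ z, |φ z| ≤ C) (hK : ∀ z, K ≤ ‖z‖ → φ z = 0) (hg : Continuous g) (x : Eu 4) {r : ℝ}
    (hr : 0 < r) : |∫ y, rescale φ x r y * g y| ≤ C * ∫ y in ball x (K * r), |g y| := by
  have h1 : ∫ y, rescale φ x r y * g y = ∫ y in ball x (K * r), rescale φ x r y * g y := by
    refine (setIntegral_eq_integral_of_forall_compl_eq_zero fun y hy => ?_).symm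
    rw [rescale, hK, zero_mul]
    rw [norm_smul, norm_inv, Real.norm_of_nonneg hr.le, le_inv_mul_iff₀ hr, ← dist_eq_norm,
      dist_comm, mul_comm]
    simpa using hy
  rw [h1, ← integral_const_mul]
  refine (abs_integral_le_integral_abs).trans (integral_mono_of_nonneg
    (Eventually.of_forall fun _ => abs_nonneg _) ((integrableOn_ball hg.abs x _).const_mul C)
    (Eventually.of_forall fun y => ?_))
  simp only [abs_mul, rescale]
  exact mul_le_mul_of_nonneg_right (hC _) (abs_nonneg _)

lemma integrableOn_inv_norm_sq (r : ℝ) :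
    IntegrableOn (fun x : Eu 4 => (‖x‖ ^ 2)⁻¹) (ball 0 r) := by
  rw [integrableOn_fun_norm_addHaar volume (f := fun y : ℝ => (y ^ 2)⁻¹)]
  have h1 : IntegrableOn (fun y : ℝ => y) (Ioo 0 r) :=
    (continuous_id.continuousOn.integrableOn_compact isCompact_Icc).mono_set Ioo_subset_Icc_self
  refine h1.congr_fun (fun y hy => ?_) measurableSet_Ioo
  have : y ≠ 0 := hy.1.ne'
  simp
  field_simp

lemma integral_inv_norm_sq_ball {r : ℝ} (hr : 0 ≤ r) :
    ∫ x in ball (0 : Eu 4) r, (‖x‖ ^ 2)⁻¹ = Real.pi ^ 2 * r ^ 2 := by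
  have h1 : ∫ x in ball (0 : Eu 4) r, (‖x‖ ^ 2)⁻¹ =
      ∫ x : Eu 4, (Iio r).indicator (fun y => (y ^ 2)⁻¹) ‖x‖ := by
    rw [← integral_indicator measurableSet_ball]
    refine integral_congr_ae (Eventually.of_forall fun x => ?_)
    simp [indicator]
  rw [h1, integral_radial]
  have h2 : ∫ y in Ioi (0 : ℝ), y ^ 3 * (Iio r).indicator (fun y => (y ^ 2)⁻¹) y =
      ∫ y in Ioo (0 : ℝ) r, y := by
    rw [← Ioi_inter_Iio, ← setIntegral_indicator measurableSet_Iio]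
    refine setIntegral_congr_fun measurableSet_Ioi fun y hy => ?_
    have : y ≠ 0 := (mem_Ioi.mp hy).ne'
    by_cases h : y < r
    · simp [h]; field_simp
    · simp [h]
  rw [h2, ← integral_Ioc_eq_integral_Ioo, ← intervalIntegral.integral_of_le hr, integral_id]
  ring

lemma integrableOn_inv_dist_sq (p : Eu 4) (r : ℝ) :
    IntegrableOn (fun y : Eu 4 => (‖p - y‖ ^ 2)⁻¹) (ball p r) := by
  have h := (Measure.measurePreserving_sub_left (volume : Measure (Eu 4)) p).integrableOn_comp_preimage
    (Homeomorph.subLeft p).measurableEmbedding (s := ball (0 : Eu 4) r)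
    (f := fun x : Eu 4 => (‖x‖ ^ 2)⁻¹)
  have h2 : (fun y => p - y) ⁻¹' ball (0 : Eu 4) r = ball p r := by
    ext y
    simp [dist_eq_norm, norm_sub_rev]
  have h3 := h.2 (integrableOn_inv_norm_sq r)
  simpa [h2, Function.comp_def] using h3

lemma integral_inv_dist_sq_ball (p : Eu 4) {r : ℝ} (hr : 0 ≤ r) :
    ∫ y in ball p r, (‖p - y‖ ^ 2)⁻¹ = Real.pi ^ 2 * r ^ 2 := by
  have h := (Measure.measurePreserving_sub_left (volume : Measure (Eu 4)) p).setIntegral_preimage_emb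
    (Homeomorph.subLeft p).measurableEmbedding (fun x : Eu 4 => (‖x‖ ^ 2)⁻¹) (ball (0 : Eu 4) r)
  have h2 : (fun y => p - y) ⁻¹' ball (0 : Eu 4) r = ball p r := by
    ext y
    simp [dist_eq_norm, norm_sub_rev]
  rw [h2] at h
  rw [h, integral_inv_norm_sq_ball hr]

lemma integrable_inv_dist_sq_mul {f : Eu 4 → ℝ} (hf : Continuous f) (hfi : Integrable f)
    (p : Eu 4) : Integrable fun y => (‖p - y‖ ^ 2)⁻¹ * f y := by
  rw [← integrableOn_univ, ← union_compl_self (ball p 1)]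
  refine IntegrableOn.union ?_ ?_
  · obtain ⟨C, hC⟩ := (isCompact_closedBall p 1).exists_bound_of_continuousOn hf.continuousOn
    refine Integrable.mul_bdd (c := C) (integrableOn_inv_dist_sq p 1)
      hf.aestronglyMeasurable ?_
    exact (ae_restrict_iff' measurableSet_ball).2
      (Eventually.of_forall fun y hy => hC y (ball_subset_closedBall hy))
  · refine Integrable.bdd_mul (c := 1) hfi.integrableOn ?_ ?_
    · exact (by fun_prop : Measurable fun y : Eu 4 => (‖p - y‖ ^ 2)⁻¹).aestronglyMeasurable
    · refine (ae_restrict_iff' measurableSet_ball.compl).2 (Eventually.of_forall fun y hy => ?_)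
      have h1 : 1 ≤ ‖p - y‖ := by
        simpa [dist_eq_norm, norm_sub_rev] using hy
      rw [Real.norm_of_nonneg (by positivity)]
      exact inv_le_one_of_one_le₀ (by nlinarith)

lemma integrable_inv_dist_mul {f : Eu 4 → ℝ} (hf : Continuous f) (hfi : Integrable f)
    (p : Eu 4) : Integrable fun y => ‖p - y‖⁻¹ * f y := by
  refine ((integrable_inv_dist_sq_mul hf hfi p).norm.add hfi.norm).mono'
    ((by fun_prop : Measurable fun y : Eu 4 => ‖p - y‖⁻¹).mul
      hf.measurable).aestronglyMeasurable (Eventually.of_forall fun y => ?_)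
  simp only [norm_mul, norm_inv, norm_norm, norm_pow, Pi.add_apply]
  rw [← inv_pow]
  nlinarith [norm_nonneg (f y), sq_nonneg (‖p - y‖⁻¹ - 1 / 2), mul_nonneg (norm_nonneg (f y))
    (sq_nonneg (‖p - y‖⁻¹ - 1 / 2))]

/-- Uniform bound of the weight `|x - y|⁻²` on balls. -/
lemma integrableOn_ball_inv_dist_sq (p q : Eu 4) (r : ℝ) :
    IntegrableOn (fun y : Eu 4 => (‖p - y‖ ^ 2)⁻¹) (ball q r) :=
  (integrableOn_inv_dist_sq p (dist q p + r)).mono_set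
    (ball_subset_ball' (by rw [add_comm]))

lemma setIntegral_inv_dist_sq_le (p q : Eu 4) {r : ℝ} (hr : 0 < r) :
    ∫ y in ball q r, (‖p - y‖ ^ 2)⁻¹ ≤ 2 * Real.pi ^ 2 * r ^ 2 := by
  have hi := integrableOn_ball_inv_dist_sq p q r
  have h0 : ∀ y : Eu 4, 0 ≤ (‖p - y‖ ^ 2)⁻¹ := fun y => by positivity
  rw [← integral_inter_add_sdiff (t := ball p r) measurableSet_ball hi]
  have h1 : ∫ y in ball q r ∩ ball p r, (‖p - y‖ ^ 2)⁻¹ ≤ Real.pi ^ 2 * r ^ 2 := by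
    rw [← integral_inv_dist_sq_ball p hr.le]
    exact setIntegral_mono_set (integrableOn_inv_dist_sq p r) (Eventually.of_forall h0)
      inter_subset_right.eventuallyLE
  have h2 : ∫ y in ball q r \ ball p r, (‖p - y‖ ^ 2)⁻¹ ≤
      ∫ y in ball q r, (r ^ 2)⁻¹ := by
    refine (setIntegral_mono_on (hi.mono_set sdiff_subset) (integrableOn_const
      ((measure_mono sdiff_subset).trans_lt measure_ball_lt_top).ne)
      (measurableSet_ball.diff measurableSet_ball) fun y hy => ?_).trans
      (setIntegral_mono_set (integrableOn_const measure_ball_lt_top.ne)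
        (Eventually.of_forall fun _ => by positivity) sdiff_subset.eventuallyLE)
    have : r ≤ ‖p - y‖ := by
      simpa [dist_eq_norm, norm_sub_rev] using hy.2
    gcongr
  rw [setIntegral_const, volume_real_ball q hr.le, smul_eq_mul] at h2
  have h3 : r ^ 4 * (Real.pi ^ 2 / 2) * (r ^ 2)⁻¹ = Real.pi ^ 2 * r ^ 2 / 2 := by
    field_simp
  nlinarith [sq_nonneg (Real.pi * r)]

/-- Quadratic growth of the Dirichlet energy of `u` on balls. -/
def EnergyGrowth (u : Eu 4 → ℝ) (C : ℝ) : Prop :=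
  0 ≤ C ∧ ∀ p r, 0 < r → ∫ y in ball p r, gradSq u y ≤ C * r ^ 2

lemma pd_sq_le_gradSq (u : Eu 4 → ℝ) (i : Fin 4) (x : Eu 4) : pd i u x ^ 2 ≤ gradSq u x :=
  Finset.single_le_sum (f := fun i => pd i u x ^ 2) (fun _ _ => sq_nonneg _) (Finset.mem_univ i)

lemma setIntegral_abs_pd_le {u : Eu 4 → ℝ} (hu : ContDiff ℝ ∞ u) {C : ℝ} (hC : EnergyGrowth u C)
    (i : Fin 4) (p : Eu 4) {r : ℝ} (hr : 0 < r) :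
    ∫ y in ball p r, |pd i u y| ≤ (Real.pi ^ 2 + C) * r ^ 3 := by
  have hg := integrableOn_ball (contDiff_gradSq hu).continuous p r
  have hc : IntegrableOn (fun _ : Eu 4 => 1 / 2 * r⁻¹) (ball p r) :=
    integrableOn_const measure_ball_lt_top.ne
  have h1 : ∫ y in ball p r, |pd i u y| ≤
      ∫ y in ball p r, (1 / 2 * r⁻¹ + 1 / 2 * r * gradSq u y) := by
    refine setIntegral_mono_on (integrableOn_ball (contDiff_pd hu i).continuous.abs p r)
      (hc.add (hg.const_mul _)) measurableSet_ball fun y _ => ?_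
    have h2 := pd_sq_le_gradSq u i y
    have h3 : r * r⁻¹ = 1 := mul_inv_cancel₀ hr.ne'
    have h4 : 0 < r⁻¹ := inv_pos.mpr hr
    have h5 : |pd i u y| ≤ 1 / 2 * r⁻¹ + 1 / 2 * r * |pd i u y| ^ 2 := by
      have : 0 ≤ r * (|pd i u y| - r⁻¹) ^ 2 := by positivity
      have h6 : r * (|pd i u y| - r⁻¹) ^ 2 = r * |pd i u y| ^ 2 - 2 * |pd i u y| * (r * r⁻¹)
        + r⁻¹ * (r * r⁻¹) := by ring
      rw [h6, h3] at this
      linarith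
    rw [sq_abs] at h5
    nlinarith
  rw [integral_add hc (hg.const_mul _), setIntegral_const,
    volume_real_ball p hr.le, smul_eq_mul, integral_const_mul] at h1
  have h2 := mul_le_mul_of_nonneg_left (hC.2 p r hr) (by positivity : 0 ≤ 1 / 2 * r)
  have h3 : r ^ 4 * (Real.pi ^ 2 / 2) * (1 / 2 * r⁻¹) = Real.pi ^ 2 * r ^ 3 / 4 := by
    field_simp
    norm_num
  have h4 : 0 ≤ Real.pi ^ 2 * r ^ 3 := by positivity
  have h5 : 0 ≤ C * r ^ 3 := mul_nonneg hC.1 (by positivity)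
  nlinarith

lemma tendsto_mollify_atTop {u φ : Eu 4 → ℝ} (hu : ContDiff ℝ ∞ u) {C : ℝ}
    (hC : EnergyGrowth u C) (hφ : IsTest φ) (i : Fin 4) (x : Eu 4) :
    Tendsto (fun r => mollify φ (pd i u) x r) atTop (𝓝 0) := by
  obtain ⟨B, hB0, hB⟩ := hφ.exists_bound
  obtain ⟨K, hK0, hK⟩ := hφ.exists_radius
  have hlim : Tendsto (fun r : ℝ => B * ((Real.pi ^ 2 + C) * (K + 1) ^ 3) * r⁻¹) atTop (𝓝 0) := by
    have h := (tendsto_inv_atTop_zero (𝕜 := ℝ)).const_mul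
      (B * ((Real.pi ^ 2 + C) * (K + 1) ^ 3))
    rwa [mul_zero] at h
  refine squeeze_zero_norm' ?_ hlim
  filter_upwards [eventually_gt_atTop 0] with r hr
  have h1 := abs_integral_rescale_mul_le hB (K := K + 1)
    (fun z hz => hK z (by linarith)) (contDiff_pd hu i).continuous x hr
  have h2 := setIntegral_abs_pd_le hu hC i x (mul_pos (by linarith : 0 < K + 1) hr)
  rw [integral_rescale_mul _ _ _ hr, abs_mul, abs_of_pos (by positivity)] at h1
  have h3 := h1.trans (mul_le_mul_of_nonneg_left h2 hB0)
  rw [Real.norm_eq_abs, ← div_eq_mul_inv, le_div_iff₀ hr]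
  have h4 : r ^ 3 * (|mollify φ (pd i u) x r| * r) ≤
      r ^ 3 * (B * ((Real.pi ^ 2 + C) * (K + 1) ^ 3)) := by
    calc _ = r ^ 4 * |mollify φ (pd i u) x r| := by ring
      _ ≤ _ := h3
      _ = _ := by ring
  exact le_of_mul_le_mul_left h4 (by positivity)

lemma isTest_logKernel_sub (x : Eu 4) {r R : ℝ} (hr : 0 < r) (hrR : r ≤ R) :
    IsTest fun y => (rescale logKernel x r y + Real.log r) -
      (rescale logKernel x R y + Real.log R) := by
  have hR : 0 < R := hr.trans_le hrR
  have key : ∀ s, 0 < s → ∀ y, s ≤ ‖x - y‖ →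
      rescale logKernel x s y + Real.log s = Real.log ‖x - y‖ := by
    intro s hs y hy
    have hpos : 0 < ‖x - y‖ := hs.trans_le hy
    have hn : ‖s⁻¹ • (x - y)‖ = s⁻¹ * ‖x - y‖ := by
      rw [norm_smul, norm_inv, Real.norm_of_nonneg hs.le]
    rw [rescale, logKernel_of_ge, hn, Real.log_mul (inv_ne_zero hs.ne') hpos.ne', Real.log_inv]
    · ring
    · rw [hn, le_inv_mul_iff₀ hs]
      linarith
  refine isTest_of_support (((contDiff_rescale contDiff_logKernel x r).add contDiff_const).sub
    ((contDiff_rescale contDiff_logKernel x R).add contDiff_const)) (K := ‖x‖ + R) fun y hy => ?_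
  have h1 : R ≤ ‖x - y‖ := by
    have := norm_sub_norm_le y x
    rw [norm_sub_rev] at this
    linarith
  rw [key r hr y (hrR.trans h1), key R hR y h1, sub_self]

lemma pd_add_const {g : Eu 4 → ℝ} (c : ℝ) (i : Fin 4) : pd i (fun y => g y + c) = pd i g := by
  ext x
  simp [pd, fderiv_add_const]

lemma lap_sub {g h : Eu 4 → ℝ} (hg : ContDiff ℝ ∞ g) (hh : ContDiff ℝ ∞ h) :
    lap (fun x => g x - h x) = fun x => lap g x - lap h x := by
  rw [lap_eq hg, lap_eq hh, lap_eq (hg.sub hh)]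
  ext x
  simp only [pd_sub hg hh, pd_sub (contDiff_pd hg _) (contDiff_pd hh _), Finset.sum_sub_distrib]

lemma lap_add_const {g : Eu 4 → ℝ} (hg : ContDiff ℝ ∞ g) (c : ℝ) :
    lap (fun x => g x + c) = lap g := by
  rw [lap_eq hg, lap_eq (hg.add contDiff_const)]
  simp only [pd_add_const]

lemma lap_const_mul {g : Eu 4 → ℝ} (hg : ContDiff ℝ ∞ g) (c : ℝ) :
    lap (fun x => c * g x) = fun x => c * lap g x := by
  rw [lap_eq hg, lap_eq (contDiff_const.mul hg)]
  ext x
  simp only [pd_const_mul hg, pd_const_mul (contDiff_pd hg _), Finset.mul_sum]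

lemma lap_lap_rescale_logKernel (x : Eu 4) (r : ℝ) :
    lap (lap (fun y => rescale logKernel x r y + Real.log r)) =
      fun y => r⁻¹ ^ 4 * rescale biKernel x r y := by
  rw [lap_add_const (contDiff_rescale contDiff_logKernel x r), lap_rescale contDiff_logKernel,
    lap_const_mul (contDiff_rescale (contDiff_lap contDiff_logKernel) x r),
    lap_rescale (contDiff_lap contDiff_logKernel)]
  ext y
  rw [biKernel]
  ring

/-- The gradient of the truncated kernel applied to `f`. -/
def gradPotential (f : Eu 4 → ℝ) (i : Fin 4) (x : Eu 4) (r : ℝ) : ℝ :=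
  ∫ y, r⁻¹ * rescale (pd i logKernel) x r y * f y

lemma integrable_gradPotential {f : Eu 4 → ℝ} (hfi : Integrable f) (i : Fin 4) (x : Eu 4) (r : ℝ) :
    Integrable fun y => r⁻¹ * rescale (pd i logKernel) x r y * f y := by
  obtain ⟨C, -, hC⟩ := exists_pd_logKernel_bound i
  refine hfi.bdd_mul (c := |r⁻¹| * C) ?_ (Eventually.of_forall fun y => ?_)
  · exact (continuous_const.mul
      (contDiff_rescale (contDiff_pd contDiff_logKernel i) x r).continuous).aestronglyMeasurable
  · rw [norm_mul]
    exact mul_le_mul_of_nonneg_left (hC _).1 (abs_nonneg _)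

/-- Green's formula between the scales `r` and `R`. -/
lemma mollify_sub_mollify {u : Eu 4 → ℝ} (hu : ContDiff ℝ ∞ u)
    (hf : Integrable (lap (lap u))) (i : Fin 4) (x : Eu 4) {r R : ℝ} (hr : 0 < r) (hrR : r ≤ R) :
    mollify biKernel (pd i u) x r - mollify biKernel (pd i u) x R =
      gradPotential (lap (lap u)) i x r - gradPotential (lap (lap u)) i x R := by
  have hR : 0 < R := hr.trans_le hrR
  have hT := isTest_logKernel_sub x hr hrR
  have hs : ∀ s, ContDiff ℝ ∞ fun y => rescale logKernel x s y + Real.log s := fun s =>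
    (contDiff_rescale contDiff_logKernel x s).add contDiff_const
  have hb := contDiff_pd hu i
  have hff := contDiff_lap (contDiff_lap hu)
  have h1 := integral_mul_lap_comm hT (contDiff_lap hb)
  have h2 := integral_mul_lap_comm hT.lap hb
  have h3 := integral_mul_pd hT hff i
  have h4 : lap (lap (pd i u)) = pd i (lap (lap u)) := by
    rw [lap_pd hu, lap_pd (contDiff_lap hu)]
  rw [h4] at h1
  rw [lap_sub (hs r) (hs R)] at h1 h2
  rw [lap_sub (contDiff_lap (hs r)) (contDiff_lap (hs R)), lap_lap_rescale_logKernel,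
    lap_lap_rescale_logKernel] at h2
  rw [pd_sub (hs r) (hs R), pd_add_const, pd_add_const,
    pd_rescale contDiff_logKernel, pd_rescale contDiff_logKernel] at h3
  have h5 : ∀ s, 0 < s → mollify biKernel (pd i u) x s =
      ∫ y, s⁻¹ ^ 4 * rescale biKernel x s y * pd i u y := by
    intro s hs
    simp only [mul_assoc]
    rw [integral_const_mul, integral_rescale_mul _ _ _ hs]
    field_simp
  have hint : ∀ s, 0 < s → Integrable fun y => s⁻¹ ^ 4 * rescale biKernel x s y * pd i u y := by
    intro s hs
    simp only [mul_assoc]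
    exact ((isTest_biKernel.rescale x hs).integrable_mul hb.continuous).const_mul _
  rw [h5 r hr, h5 R hR, ← integral_sub (hint r hr) (hint R hR), gradPotential, gradPotential,
    ← integral_sub (integrable_gradPotential hf i x r) (integrable_gradPotential hf i x R)]
  simp only [← sub_mul] at h2 ⊢
  rw [← h2, ← h1, h3, ← integral_neg]
  refine integral_congr_ae (Eventually.of_forall fun y => ?_)
  simp only
  ring

/-- The gradient of `u` is the gradient of the logarithmic potential of `Δ²u`. -/
lemma pd_eq_integral {u : Eu 4 → ℝ} (hu : ContDiff ℝ ∞ u) (hf : Integrable (lap (lap u))) {C : ℝ}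
    (hC : EnergyGrowth u C) (i : Fin 4) (x : Eu 4) :
    -(8 * Real.pi ^ 2) * pd i u x =
      ∫ y, (x - y) i / ‖x - y‖ ^ 2 * lap (lap u) y := by
  have hfc := (contDiff_lap (contDiff_lap hu)).continuous
  set f := lap (lap u) with hfdef
  obtain ⟨B, hB0, hB⟩ := exists_pd_logKernel_bound i
  have hsmall : Tendsto (fun r => gradPotential f i x r) (𝓝[>] 0)
      (𝓝 (∫ y, (x - y) i / ‖x - y‖ ^ 2 * f y)) := by
    refine tendsto_integral_filter_of_dominated_convergence
      (fun y => B * ‖‖x - y‖⁻¹ * f y‖) ?_ ?_ ?_ ?_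
    · exact Eventually.of_forall fun r => (integrable_gradPotential hf i x r).aestronglyMeasurable
    · filter_upwards [self_mem_nhdsWithin] with r hr
      have hr0 : 0 < r := hr
      refine Eventually.of_forall fun y => ?_
      rw [norm_mul, norm_mul (‖x - y‖⁻¹), ← mul_assoc]
      refine mul_le_mul_of_nonneg_right ?_ (norm_nonneg _)
      have h1 := (hB (r⁻¹ • (x - y))).2
      rw [norm_smul, norm_inv, mul_inv, inv_inv, Real.norm_of_nonneg hr0.le] at h1
      rw [norm_mul, norm_inv, Real.norm_of_nonneg hr0.le, inv_mul_le_iff₀ hr0, norm_inv, norm_norm]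
      calc ‖rescale (pd i logKernel) x r y‖ ≤ B * (r * ‖x - y‖⁻¹) := h1
        _ = _ := by ring
    · exact (integrable_inv_dist_mul hfc hf x).norm.const_mul B
    · have hae : ∀ᵐ y : Eu 4, y ≠ x := by
        simp [ae_iff, measure_singleton]
      filter_upwards [hae] with y hy
      have hpos : 0 < ‖x - y‖ := norm_pos_iff.mpr (sub_ne_zero.mpr hy.symm)
      refine tendsto_const_nhds.congr' ?_
      filter_upwards [Ioo_mem_nhdsGT hpos] with r hr
      have hr0 : 0 < r := hr.1
      have hn : ‖r⁻¹ • (x - y)‖ = r⁻¹ * ‖x - y‖ := by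
        rw [norm_smul, norm_inv, Real.norm_of_nonneg hr0.le]
      rw [rescale, pd_logKernel, hn]
      · simp only [PiLp.smul_apply, smul_eq_mul]
        field_simp
      · rw [hn, lt_inv_mul_iff₀ hr0]
        linarith [hr.2]
  have hsmall2 : Tendsto (fun r => mollify biKernel (pd i u) x r) (𝓝[>] 0)
      (𝓝 (-(8 * Real.pi ^ 2) * pd i u x)) := by
    have h1 : Continuous fun r : ℝ => mollify biKernel (pd i u) x r :=
      (continuous_mollify isTest_biKernel (contDiff_pd hu i).continuous).comp
        (by fun_prop : Continuous fun r : ℝ => (x, r))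
    have h2 := h1.tendsto 0
    rw [mollify_zero, integral_biKernel] at h2
    exact h2.mono_left nhdsWithin_le_nhds
  have hlarge : Tendsto (fun r => gradPotential f i x r) atTop (𝓝 0) := by
    have hlim : Tendsto (fun r : ℝ => (B * ∫ y, ‖f y‖) * r⁻¹) atTop (𝓝 0) := by
      simpa using tendsto_inv_atTop_zero.const_mul (B * ∫ y, ‖f y‖)
    refine squeeze_zero_norm' ?_ hlim
    filter_upwards [eventually_gt_atTop 0] with r hr
    rw [gradPotential, mul_comm _ r⁻¹, ← integral_const_mul, ← integral_const_mul]
    refine norm_integral_le_of_norm_le ((hf.norm.const_mul _).const_mul _)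
      (Eventually.of_forall fun y => ?_)
    rw [norm_mul, norm_mul, norm_inv, Real.norm_of_nonneg hr.le, mul_assoc]
    gcongr
    exact (hB _).1
  have hR : ∀ R, 0 < R → -(8 * Real.pi ^ 2) * pd i u x - mollify biKernel (pd i u) x R =
      (∫ y, (x - y) i / ‖x - y‖ ^ 2 * f y) - gradPotential f i x R := by
    intro R hR
    refine tendsto_nhds_unique (hsmall2.sub_const _) ((hsmall.sub_const _).congr' ?_)
    filter_upwards [Ioo_mem_nhdsGT hR] with r hr
    exact (mollify_sub_mollify hu hf i x hr.1 hr.2.le).symm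
  have h1 := (tendsto_mollify_atTop hu hC isTest_biKernel i x).const_sub
    (-(8 * Real.pi ^ 2) * pd i u x)
  have h2 := hlarge.const_sub (∫ y, (x - y) i / ‖x - y‖ ^ 2 * f y)
  rw [sub_zero] at h1 h2
  refine tendsto_nhds_unique h1 (h2.congr' ?_)
  filter_upwards [eventually_gt_atTop 0] with R hR0
  exact (hR R hR0).symm

/-- The Cauchy–Schwarz inequality with a nonnegative weight. -/
lemma sq_integral_mul_le {α : Type*} [MeasurableSpace α] {μ : Measure α} {g h : α → ℝ}
    (hg0 : ∀ x, 0 ≤ g x) (hg : Integrable g μ) (hgh : Integrable (fun x => g x * h x) μ)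
    (hgh2 : Integrable (fun x => g x * h x ^ 2) μ) :
    (∫ x, g x * h x ∂μ) ^ 2 ≤ (∫ x, g x ∂μ) * ∫ x, g x * h x ^ 2 ∂μ := by
  have key : ∀ t : ℝ, 0 ≤ (∫ x, g x ∂μ) * (t * t) + (-2 * ∫ x, g x * h x ∂μ) * t +
      ∫ x, g x * h x ^ 2 ∂μ := by
    intro t
    have h1 : 0 ≤ ∫ x, (g x * (t * t) + -2 * t * (g x * h x) + g x * h x ^ 2) ∂μ := by
      refine integral_nonneg fun x => ?_
      have : g x * (t * t) + -2 * t * (g x * h x) + g x * h x ^ 2 = g x * (h x - t) ^ 2 := by ring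
      simp only [this]
      exact mul_nonneg (hg0 x) (sq_nonneg _)
    have hsum : Integrable (fun x => g x * (t * t) + -2 * t * (g x * h x)) μ :=
      (hg.mul_const _).add (hgh.const_mul _)
    rw [integral_add hsum hgh2,
      integral_add (hg.mul_const _) (hgh.const_mul _), integral_mul_const, integral_const_mul] at h1
    linarith
  have := discrim_le_zero key
  rw [discrim] at this
  nlinarith

/-- The components of `z/|z|²`. -/
def newt (i : Fin 4) (z : Eu 4) : ℝ := z i / ‖z‖ ^ 2

lemma measurable_newt (i : Fin 4) : Measurable (newt i) := by
  unfold newt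
  exact (contDiff_coord i).continuous.measurable.div (by fun_prop)

lemma abs_newt_le (i : Fin 4) (z : Eu 4) : |newt i z| ≤ ‖z‖⁻¹ := by
  rcases eq_or_ne z 0 with rfl | hz
  · simp [newt]
  · have hpos := norm_pos_iff.mpr hz
    rw [newt, abs_div, abs_of_pos (by positivity : 0 < ‖z‖ ^ 2), div_le_iff₀ (by positivity),
      pow_two, inv_mul_cancel_left₀ hpos.ne']
    exact abs_coord_le z i

/-- The weight `min(1, |y|/R)`. -/
def farWeight (R : ℝ) (y : Eu 4) : ℝ := min 1 (‖y‖ / R)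

lemma farWeight_nonneg {R : ℝ} (hR : 0 < R) (y : Eu 4) : 0 ≤ farWeight R y :=
  le_min zero_le_one (by positivity)

lemma continuous_farWeight (R : ℝ) : Continuous (farWeight R) := by
  unfold farWeight
  fun_prop

lemma abs_newt_sub_le (i : Fin 4) {R : ℝ} (hR : 0 < R) {x : Eu 4} (hx : R ≤ ‖x‖) (y : Eu 4) :
    |newt i (x - y) - newt i x| ≤ farWeight R y * (‖x‖⁻¹ + ‖x - y‖⁻¹) := by
  have hx0 : 0 < ‖x‖ := hR.trans_le hx
  rcases eq_or_ne y x with rfl | hne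
  · have hw : farWeight R y = 1 := min_eq_left ((one_le_div hR).2 hx)
    have h0 : newt i 0 = 0 := by simp [newt]
    rw [hw, sub_self, h0, zero_sub, abs_neg, norm_zero, inv_zero, add_zero, one_mul]
    exact abs_newt_le i y
  · have hxy : x - y ≠ 0 := sub_ne_zero.mpr hne.symm
    have hxy0 : 0 < ‖x - y‖ := norm_pos_iff.mpr hxy
    have h1 := dist_div_norm_sq_smul hxy (norm_pos_iff.mp hx0) 1
    have h2 : |newt i (x - y) - newt i x| ≤ 1 ^ 2 / (‖x - y‖ * ‖x‖) * dist (x - y) x := by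
      rw [← h1, dist_eq_norm]
      refine le_trans (le_of_eq ?_) (abs_coord_le _ i)
      simp only [newt, PiLp.sub_apply, PiLp.smul_apply, smul_eq_mul]
      congr 1
      field_simp
    have h3 : dist (x - y) x = ‖y‖ := by simp
    rw [h3, one_pow] at h2
    refine h2.trans ?_
    have e : 1 / (‖x - y‖ * ‖x‖) * ‖y‖ = ‖y‖ * ‖x‖⁻¹ * ‖x - y‖⁻¹ := by field_simp
    rw [e]
    rcases le_total ‖y‖ R with hy | hy
    · have hw : farWeight R y = ‖y‖ / R := min_eq_right ((div_le_one hR).2 hy)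
      rw [hw, div_eq_mul_inv]
      have h4 : ‖x‖⁻¹ ≤ R⁻¹ := inv_anti₀ hR hx
      calc ‖y‖ * ‖x‖⁻¹ * ‖x - y‖⁻¹ ≤ ‖y‖ * R⁻¹ * ‖x - y‖⁻¹ := by gcongr
        _ ≤ _ := by
          refine mul_le_mul_of_nonneg_left ?_ (by positivity)
          have : 0 < ‖x‖⁻¹ := by positivity
          linarith
    · have hw : farWeight R y = 1 := min_eq_left ((one_le_div hR).2 hy)
      rw [hw, one_mul]
      have h4 : ‖y‖ ≤ ‖x‖ + ‖x - y‖ := by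
        have := norm_sub_le x (x - y)
        simpa using this
      calc ‖y‖ * ‖x‖⁻¹ * ‖x - y‖⁻¹ ≤ (‖x‖ + ‖x - y‖) * ‖x‖⁻¹ * ‖x - y‖⁻¹ := by gcongr
        _ = _ := by field_simp; ring

/-- The mass of `f` weighted by `farWeight`. -/
def farMass (f : Eu 4 → ℝ) (R : ℝ) : ℝ := ∫ y, |f y| * farWeight R y

lemma integrable_farMass {f : Eu 4 → ℝ} (hfi : Integrable f) {R : ℝ} (hR : 0 < R) :
    Integrable fun y => |f y| * farWeight R y :=
  hfi.abs.mul_bdd (c := 1) (continuous_farWeight R).aestronglyMeasurable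
    (Eventually.of_forall fun y => by
      rw [Real.norm_of_nonneg (farWeight_nonneg hR y)]; exact min_le_left _ _)

lemma farMass_nonneg (f : Eu 4 → ℝ) {R : ℝ} (hR : 0 < R) : 0 ≤ farMass f R :=
  integral_nonneg fun y => mul_nonneg (abs_nonneg _) (farWeight_nonneg hR y)

lemma tendsto_farMass {f : Eu 4 → ℝ} (hfi : Integrable f) :
    Tendsto (farMass f) atTop (𝓝 0) := by
  have h0 : (0 : ℝ) = ∫ _y : Eu 4, (0 : ℝ) := by simp
  rw [h0]
  refine tendsto_integral_filter_of_dominated_convergence (fun y => |f y|) ?_ ?_ hfi.abs ?_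
  · filter_upwards [eventually_gt_atTop 0] with R hR
    exact (integrable_farMass hfi hR).aestronglyMeasurable
  · filter_upwards [eventually_gt_atTop 0] with R hR
    refine Eventually.of_forall fun y => ?_
    rw [Real.norm_of_nonneg (mul_nonneg (abs_nonneg _) (farWeight_nonneg hR y))]
    exact mul_le_of_le_one_right (abs_nonneg _) (min_le_left _ _)
  · refine Eventually.of_forall fun y => ?_
    have h1 : Tendsto (fun R : ℝ => ‖y‖ / R) atTop (𝓝 0) := tendsto_const_nhds.div_atTop tendsto_id
    have h2 : Tendsto (fun R : ℝ => farWeight R y) atTop (𝓝 0) := by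
      refine squeeze_zero' ?_ (Eventually.of_forall fun R => min_le_right _ _) h1
      filter_upwards [eventually_gt_atTop 0] with R hR using farWeight_nonneg hR y
    simpa using h2.const_mul |f y|

/-- Fubini's theorem for the kernel `|x - y|⁻²`. -/
lemma integrable_weight_mul_potential {k g : Eu 4 → ℝ} (hk : Measurable k) (hk0 : ∀ x, 0 ≤ k x)
    (hg : Measurable g) (hg0 : ∀ x, 0 ≤ g x) (hgi : Integrable g) {A : ℝ}
    (hA : ∀ y, Integrable (fun x => k x * (‖x - y‖ ^ 2)⁻¹) ∧
      ∫ x, k x * (‖x - y‖ ^ 2)⁻¹ ≤ A) :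
    Integrable (fun x => k x * ∫ y, (‖x - y‖ ^ 2)⁻¹ * g y) ∧
      ∫ x, k x * (∫ y, (‖x - y‖ ^ 2)⁻¹ * g y) ≤ A * ∫ y, g y := by
  set F : Eu 4 × Eu 4 → ℝ := fun z => k z.1 * ((‖z.1 - z.2‖ ^ 2)⁻¹ * g z.2) with hF
  have hFm : Measurable F :=
    (hk.comp measurable_fst).mul ((by fun_prop : Measurable fun z : Eu 4 × Eu 4 =>
      (‖z.1 - z.2‖ ^ 2)⁻¹).mul (hg.comp measurable_snd))
  have hF0 : ∀ z, 0 ≤ F z := fun z => mul_nonneg (hk0 _) (mul_nonneg (by positivity) (hg0 _))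
  have hFy : ∀ y, (fun x => F (x, y)) = fun x => k x * (‖x - y‖ ^ 2)⁻¹ * g y := by
    intro y; ext x; simp only [hF]; ring
  have hFi : Integrable F (volume.prod volume) := by
    rw [integrable_prod_iff' hFm.aestronglyMeasurable]
    refine ⟨Eventually.of_forall fun y => ?_, ?_⟩
    · rw [hFy]
      exact (hA y).1.mul_const _
    · refine (hgi.const_mul A).mono' ?_ (Eventually.of_forall fun y => ?_)
      · exact hFm.norm.stronglyMeasurable.integral_prod_left'.aestronglyMeasurable
      · rw [Real.norm_of_nonneg (integral_nonneg fun _ => norm_nonneg _)]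
        have : (fun x => ‖F (x, y)‖) = fun x => k x * (‖x - y‖ ^ 2)⁻¹ * g y := by
          rw [← hFy]; ext x; exact Real.norm_of_nonneg (hF0 _)
        rw [this, integral_mul_const]
        exact mul_le_mul_of_nonneg_right (hA y).2 (hg0 y)
  have h1 : (fun x => k x * ∫ y, (‖x - y‖ ^ 2)⁻¹ * g y) = fun x => ∫ y, F (x, y) := by
    ext x
    rw [← integral_const_mul]
  rw [h1]
  refine ⟨hFi.integral_prod_left, ?_⟩
  rw [integral_integral_swap (f := fun x y => F (x, y)) hFi, ← integral_const_mul]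
  refine integral_mono hFi.integral_prod_right (hgi.const_mul A) fun y => ?_
  simp only
  rw [hFy, integral_mul_const]
  exact mul_le_mul_of_nonneg_right (hA y).2 (hg0 y)

/-- Weighted `L²` bound for the remainder of the gradient potential far from the origin. -/
lemma integral_weight_mul_sq_le {f : Eu 4 → ℝ} (hf : Continuous f) (hfi : Integrable f) {R : ℝ}
    (hR : 0 < R) {k : Eu 4 → ℝ} (hk : Measurable k) (hk0 : ∀ x, 0 ≤ k x)
    (hkR : ∀ x, ‖x‖ < R → k x = 0) {A : ℝ}
    (hA : ∀ y, Integrable (fun x => k x * (‖x - y‖ ^ 2)⁻¹) ∧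
      ∫ x, k x * (‖x - y‖ ^ 2)⁻¹ ≤ A) (i : Fin 4) {ρ : Eu 4 → ℝ} (hρm : Measurable ρ)
    (hρ : ∀ x, R ≤ ‖x‖ → ρ x = ∫ y, (newt i (x - y) - newt i x) * f y) :
    Integrable (fun x => k x * ρ x ^ 2) ∧ ∫ x, k x * ρ x ^ 2 ≤ 4 * farMass f R ^ 2 * A := by
  set g : Eu 4 → ℝ := fun y => |f y| * farWeight R y with hg
  have hgc : Continuous g := hf.abs.mul (continuous_farWeight R)
  have hg0 : ∀ y, 0 ≤ g y := fun y => mul_nonneg (abs_nonneg _) (farWeight_nonneg hR y)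
  have hgi : Integrable g := integrable_farMass hfi hR
  set ε := farMass f R with hε
  have hε0 : 0 ≤ ε := farMass_nonneg f hR
  obtain ⟨hP1, hP2⟩ := integrable_weight_mul_potential hk hk0 hgc.measurable hg0 hgi hA
  have hN := integrable_inv_dist_sq_mul hgc hgi
  have hpt : ∀ x, k x * ρ x ^ 2 ≤ 2 * ε * (ε * (k x * (‖x - 0‖ ^ 2)⁻¹) +
      k x * ∫ y, (‖x - y‖ ^ 2)⁻¹ * g y) := by
    intro x
    rcases lt_or_ge ‖x‖ R with hx | hx
    · simp [hkR x hx]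
    set h : Eu 4 → ℝ := fun y => ‖x‖⁻¹ + ‖x - y‖⁻¹ with hh
    have hgh : Integrable fun y => g y * h y := by
      have := (hgi.mul_const ‖x‖⁻¹).add (integrable_inv_dist_mul hgc hgi x)
      refine this.congr (Eventually.of_forall fun y => ?_)
      simp only [hh, Pi.add_apply]; ring
    have hgN : Integrable fun y => 2 * (g y * (‖x‖ ^ 2)⁻¹ + (‖x - y‖ ^ 2)⁻¹ * g y) :=
      ((hgi.mul_const _).add (hN x)).const_mul 2
    have hle : ∀ y, g y * h y ^ 2 ≤ 2 * (g y * (‖x‖ ^ 2)⁻¹ + (‖x - y‖ ^ 2)⁻¹ * g y) := by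
      intro y
      have : h y ^ 2 ≤ 2 * ((‖x‖ ^ 2)⁻¹ + (‖x - y‖ ^ 2)⁻¹) := by
        rw [← inv_pow, ← inv_pow]
        nlinarith [sq_nonneg (‖x‖⁻¹ - ‖x - y‖⁻¹)]
      nlinarith [hg0 y]
    have hhm : Measurable h := by simp only [hh]; fun_prop
    have hgh2 : Integrable fun y => g y * h y ^ 2 :=
      hgN.mono' (hgc.measurable.mul (hhm.pow_const 2)).aestronglyMeasurable
        (Eventually.of_forall fun y => by
          rw [Real.norm_of_nonneg (mul_nonneg (hg0 y) (sq_nonneg _))]; exact hle y)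
    have h1 : |ρ x| ≤ ∫ y, g y * h y := by
      rw [hρ x hx, ← Real.norm_eq_abs]
      refine norm_integral_le_of_norm_le hgh (Eventually.of_forall fun y => ?_)
      rw [norm_mul, Real.norm_eq_abs, Real.norm_eq_abs]
      calc _ ≤ farWeight R y * (‖x‖⁻¹ + ‖x - y‖⁻¹) * |f y| :=
            mul_le_mul_of_nonneg_right (abs_newt_sub_le i hR hx y) (abs_nonneg _)
        _ = _ := by simp only [hg, hh]; ring
    have h2 := sq_integral_mul_le hg0 hgi hgh hgh2
    have h3 : ∫ y, g y * h y ^ 2 ≤ 2 * (ε * (‖x‖ ^ 2)⁻¹ + ∫ y, (‖x - y‖ ^ 2)⁻¹ * g y) := by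
      refine (integral_mono hgh2 hgN hle).trans (le_of_eq ?_)
      rw [integral_const_mul, integral_add (hgi.mul_const _) (hN x), integral_mul_const]
      rfl
    have h4 : ρ x ^ 2 ≤ ε * (2 * (ε * (‖x‖ ^ 2)⁻¹ + ∫ y, (‖x - y‖ ^ 2)⁻¹ * g y)) := by
      rw [← sq_abs]
      calc |ρ x| ^ 2 ≤ (∫ y, g y * h y) ^ 2 := by gcongr
        _ ≤ _ := h2
        _ ≤ _ := mul_le_mul_of_nonneg_left h3 hε0
    rw [sub_zero]
    calc k x * ρ x ^ 2 ≤ k x * (ε * (2 * (ε * (‖x‖ ^ 2)⁻¹ + ∫ y, (‖x - y‖ ^ 2)⁻¹ * g y))) :=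
          mul_le_mul_of_nonneg_left h4 (hk0 x)
      _ = _ := by ring
  have hmaj : Integrable fun x => 2 * ε * (ε * (k x * (‖x - 0‖ ^ 2)⁻¹) +
      k x * ∫ y, (‖x - y‖ ^ 2)⁻¹ * g y) := (((hA 0).1.const_mul _).add hP1).const_mul _
  have hint : Integrable fun x => k x * ρ x ^ 2 :=
    hmaj.mono' (hk.mul (hρm.pow_const 2)).aestronglyMeasurable (Eventually.of_forall fun x => by
      rw [Real.norm_of_nonneg (mul_nonneg (hk0 x) (sq_nonneg _))]; exact hpt x)
  refine ⟨hint, (integral_mono hint hmaj hpt).trans ?_⟩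
  rw [integral_const_mul, integral_add ((hA 0).1.const_mul _) hP1, integral_const_mul]
  have h5 := mul_le_mul_of_nonneg_left (hA 0).2 hε0
  have h6 : A * ∫ y, g y = A * ε := rfl
  rw [h6] at hP2
  calc _ ≤ 2 * ε * (ε * A + A * ε) := by gcongr
    _ = _ := by ring

/-- The function `Δu + |∇u|²`. -/
def confLap (u : Eu 4 → ℝ) (x : Eu 4) : ℝ := lap u x + gradSq u x

lemma contDiff_confLap {u : Eu 4 → ℝ} (hu : ContDiff ℝ ∞ u) : ContDiff ℝ ∞ (confLap u) :=
  (contDiff_lap hu).add (contDiff_gradSq hu)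

/-- Algebraic expansion of `σ₂` of a matrix of Schouten type. -/
lemma sigma2_schouten_expand (H : Fin 4 → Fin 4 → ℝ) (hH : ∀ i j, H i j = H j i) (b : Fin 4 → ℝ) :
    sigma2 (Matrix.of fun i j => -H i j + b i * b j - (1 / 2) * (∑ k, b k ^ 2) * (if i = j then 1 else 0)) =
      1 / 2 * ((∑ i, H i i) ^ 2 - (∑ i, ∑ j, H i j ^ 2) + (∑ i, H i i) * (∑ k, b k ^ 2) +
        2 * ∑ i, ∑ j, H i j * b i * b j) := by
  simp only [sigma2, Matrix.trace, Matrix.diag, Matrix.mul_apply, Matrix.of_apply, Fin.sum_univ_four]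
  rw [hH 1 0, hH 2 0, hH 3 0, hH 2 1, hH 3 1, hH 3 2]
  simp only [Fin.isValue, if_true, Fin.reduceEq, if_false]
  ring

lemma pd_gradSq {u : Eu 4 → ℝ} (hu : ContDiff ℝ ∞ u) (i : Fin 4) :
    pd i (gradSq u) = fun x => ∑ j, 2 * pd j u x * pd i (pd j u) x := by
  have := pd_sum (g := fun j x => pd j u x ^ 2) (fun j => (contDiff_pd hu j).pow 2) i
  refine this.trans ?_
  ext x
  exact Finset.sum_congr rfl fun j _ => by rw [pd_sq (contDiff_pd hu j)]

lemma lap_gradSq {u : Eu 4 → ℝ} (hu : ContDiff ℝ ∞ u) (x : Eu 4) :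
    lap (gradSq u) x = ∑ j, (2 * (∑ i, pd i (pd j u) x ^ 2) + 2 * pd j u x * lap (pd j u) x) := by
  have h2 : ∀ i j, pd i (fun x => 2 * pd j u x * pd i (pd j u) x) x =
      2 * pd i (pd j u) x ^ 2 + 2 * pd j u x * pd i (pd i (pd j u)) x := by
    intro i j
    rw [pd_mul (contDiff_const.mul (contDiff_pd hu j)) (contDiff_pd (contDiff_pd hu j) i),
      pd_const_mul (contDiff_pd hu j)]
    ring
  have h1 : ∀ i, pd i (pd i (gradSq u)) x =
      ∑ j, (2 * pd i (pd j u) x ^ 2 + 2 * pd j u x * pd i (pd i (pd j u)) x) := by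
    intro i
    rw [pd_gradSq hu, pd_sum (fun j => (contDiff_const.mul (contDiff_pd hu j)).mul
      (contDiff_pd (contDiff_pd hu j) i))]
    exact Finset.sum_congr rfl fun j _ => h2 i j
  rw [lap_eq (contDiff_gradSq hu)]
  simp only [h1]
  rw [Finset.sum_comm]
  refine Finset.sum_congr rfl fun j _ => ?_
  rw [lap_eq (contDiff_pd hu j), Finset.sum_add_distrib, Finset.mul_sum, Finset.mul_sum]

/-- `σ₂` of the Schouten tensor in divergence form. -/
lemma sigma2_eq_div {u : Eu 4 → ℝ} (hu : ContDiff ℝ ∞ u) (x : Eu 4) :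
    sigma2 (schoutenMatrix u x) =
      1 / 2 * ∑ i, pd i (fun y => confLap u y * pd i u y) x - 1 / 4 * lap (gradSq u) x := by
  have hM : schoutenMatrix u x = Matrix.of fun i j => -pd i (pd j u) x + pd i u x * pd j u x -
      (1 / 2) * (∑ k, pd k u x ^ 2) * (if i = j then 1 else 0) := by
    ext i j
    simp only [schoutenMatrix, Matrix.of_apply, iteratedFDeriv_two_eq_pd hu, gradient_apply_eq_pd,
      norm_gradient_sq]
  rw [hM, sigma2_schouten_expand (fun i j => pd i (pd j u) x)
    (fun i j => congrFun (pd_comm hu i j) x) (fun i => pd i u x), lap_gradSq hu]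
  have h1 : ∀ i, pd i (fun y => confLap u y * pd i u y) x =
      (lap (pd i u) x + ∑ j, 2 * pd j u x * pd i (pd j u) x) * pd i u x +
        confLap u x * pd i (pd i u) x := by
    intro i
    rw [pd_mul (contDiff_confLap hu) (contDiff_pd hu i)]
    have : pd i (confLap u) = fun x => pd i (lap u) x + pd i (gradSq u) x :=
      pd_add (contDiff_lap hu) (contDiff_gradSq hu) i
    rw [this, ← lap_pd hu, pd_gradSq hu]
  have h2 : confLap u x = (∑ i, pd i (pd i u) x) + ∑ k, pd k u x ^ 2 := by
    rw [confLap, lap_eq hu, gradSq]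
  simp only [h1, h2, Fin.sum_univ_four]
  ring

/-- Integrated form of the divergence identity for `σ₂`. -/
lemma integral_mul_sigma2 {u η : Eu 4 → ℝ} (hu : ContDiff ℝ ∞ u) (hη : IsTest η) :
    ∫ x, η x * sigma2 (schoutenMatrix u x) =
      -(1 / 2) * (∑ i, ∫ x, pd i η x * (confLap u x * pd i u x)) -
        1 / 4 * ∫ x, lap η x * gradSq u x := by
  have hg : ∀ i, ContDiff ℝ ∞ fun y => confLap u y * pd i u y :=
    fun i => (contDiff_confLap hu).mul (contDiff_pd hu i)
  have h1 : ∀ x, η x * sigma2 (schoutenMatrix u x) =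
      (∑ i, 1 / 2 * (η x * pd i (fun y => confLap u y * pd i u y) x)) -
        1 / 4 * (η x * lap (gradSq u) x) := by
    intro x
    rw [sigma2_eq_div hu, ← Finset.mul_sum, ← Finset.mul_sum]
    ring
  have hi : ∀ i, Integrable fun x => 1 / 2 * (η x * pd i (fun y => confLap u y * pd i u y) x) :=
    fun i => (hη.integrable_mul (contDiff_pd (hg i) i).continuous).const_mul _
  have hl := hη.integrable_mul (contDiff_lap (contDiff_gradSq hu)).continuous
  simp only [h1]
  rw [integral_sub (integrable_finsetSum _ fun i _ => hi i) (hl.const_mul _),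
    integral_finsetSum _ fun i _ => hi i, integral_const_mul,
    integral_mul_lap_comm hη (contDiff_gradSq hu)]
  congr 1
  rw [Finset.mul_sum]
  refine Finset.sum_congr rfl fun i _ => ?_
  rw [integral_const_mul, integral_mul_pd hη (hg i)]
  ring

/-- Integrated form of the definition of `confLap`. -/
lemma integral_mul_confLap {u χ : Eu 4 → ℝ} (hu : ContDiff ℝ ∞ u) (hχ : IsTest χ) :
    ∫ x, χ x * confLap u x =
      (∑ i, ∫ x, χ x * pd i u x ^ 2) - ∑ i, ∫ x, pd i χ x * pd i u x := by
  have h1 : ∀ x, χ x * confLap u x = χ x * lap u x + ∑ i, χ x * pd i u x ^ 2 := by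
    intro x
    rw [confLap, gradSq, ← Finset.mul_sum]
    ring
  have hi : ∀ i, Integrable fun x => χ x * pd i u x ^ 2 :=
    fun i => hχ.integrable_mul ((contDiff_pd hu i).pow 2).continuous
  simp only [h1]
  rw [integral_add (hχ.integrable_mul (contDiff_lap hu).continuous)
    (integrable_finsetSum _ fun i _ => hi i), integral_finsetSum _ fun i _ => hi i,
    integral_mul_lap hχ hu]
  ring

/-- The dilate `z ↦ u(Rz)`. -/
def dil (R : ℝ) (u : Eu 4 → ℝ) (z : Eu 4) : ℝ := u (R • z)

lemma contDiff_dil {u : Eu 4 → ℝ} (hu : ContDiff ℝ ∞ u) (R : ℝ) : ContDiff ℝ ∞ (dil R u) :=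
  hu.comp (contDiff_const_smul R)

lemma pd_dil {u : Eu 4 → ℝ} (hu : ContDiff ℝ ∞ u) (R : ℝ) (i : Fin 4) :
    pd i (dil R u) = fun z => R * dil R (pd i u) z := pd_comp_smul hu i R

lemma pd_pd_dil {u : Eu 4 → ℝ} (hu : ContDiff ℝ ∞ u) (R : ℝ) (i j : Fin 4) :
    pd i (pd j (dil R u)) = fun z => R ^ 2 * dil R (pd i (pd j u)) z := by
  rw [pd_dil hu, pd_const_mul (contDiff_dil (contDiff_pd hu j) R), pd_dil (contDiff_pd hu j)]
  ext z; ring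

lemma confLap_dil {u : Eu 4 → ℝ} (hu : ContDiff ℝ ∞ u) (R : ℝ) (z : Eu 4) :
    confLap (dil R u) z = R ^ 2 * confLap u (R • z) := by
  simp only [confLap, gradSq, lap_eq (contDiff_dil hu R), lap_eq hu, pd_pd_dil hu]
  simp only [pd_dil hu, dil, mul_pow, ← Finset.mul_sum]
  ring

lemma sigma2_dil {u : Eu 4 → ℝ} (hu : ContDiff ℝ ∞ u) (R : ℝ) (z : Eu 4) :
    sigma2 (schoutenMatrix (dil R u) z) = R ^ 4 * sigma2 (schoutenMatrix u (R • z)) := by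
  have hM : schoutenMatrix (dil R u) z = R ^ 2 • schoutenMatrix u (R • z) := by
    ext i j
    simp only [schoutenMatrix, iteratedFDeriv_two_eq_pd (contDiff_dil hu R),
      iteratedFDeriv_two_eq_pd hu, gradient_apply_eq_pd, norm_gradient_sq, Matrix.smul_apply,
      smul_eq_mul, pd_pd_dil hu]
    simp only [pd_dil hu, dil, mul_pow, ← Finset.mul_sum]
    ring
  rw [hM]
  simp only [sigma2, Matrix.trace_smul, Matrix.smul_mul, Matrix.mul_smul, smul_eq_mul]
  ring

lemma integral_dil (h : Eu 4 → ℝ) {R : ℝ} (hR : 0 < R) :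
    ∫ z, dil R h z = R⁻¹ ^ 4 * ∫ x, h x := by
  have := Measure.integral_comp_smul (volume : Measure (Eu 4)) h R
  rw [finrank_euclideanSpace_fin, abs_of_pos (by positivity), smul_eq_mul, ← inv_pow] at this
  exact this

lemma integrableOn_of_subset_ball {g : Eu 4 → ℝ} (hg : Continuous g) {A : Set (Eu 4)} {r : ℝ}
    (hA : A ⊆ ball 0 r) : IntegrableOn g A := (integrableOn_ball hg 0 r).mono_set hA

lemma tendsto_setIntegral_abs {A : Set (Eu 4)} {r : ℝ} (hA : A ⊆ ball 0 r)
    {d : ℝ → Eu 4 → ℝ} (hd : ∀ R, Continuous (d R))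
    (h : Tendsto (fun R => ∫ x in A, d R x ^ 2) atTop (𝓝 0)) :
    Tendsto (fun R => ∫ x in A, |d R x|) atTop (𝓝 0) := by
  have h1 : Tendsto (fun R => √((∫ _x in A, (1 : ℝ)) * ∫ x in A, d R x ^ 2)) atTop (𝓝 0) := by
    have := (h.const_mul (∫ _x in A, (1 : ℝ))).sqrt
    rwa [mul_zero, Real.sqrt_zero] at this
  refine squeeze_zero (fun R => integral_nonneg fun x => abs_nonneg _) (fun R => ?_) h1
  refine Real.le_sqrt_of_sq_le ?_
  have := sq_integral_mul_le (μ := volume.restrict A) (g := fun _ => 1) (h := fun x => |d R x|)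
    (fun _ => zero_le_one) (integrableOn_of_subset_ball continuous_const hA)
    (integrableOn_of_subset_ball (continuous_const.mul (hd R).abs) hA)
    (integrableOn_of_subset_ball (continuous_const.mul ((hd R).abs.pow 2)) hA)
  simpa using this

/-- Products of `L²`-convergent families converge weakly. -/
lemma tendsto_integral_mul_mul {A : Set (Eu 4)} (hAm : MeasurableSet A) {r : ℝ}
    (hA : A ⊆ ball 0 r) {θ : Eu 4 → ℝ} (hθ : IsTest θ) (hθA : ∀ x, x ∉ A → θ x = 0)
    {p q : ℝ → Eu 4 → ℝ} {p₀ q₀ : Eu 4 → ℝ} (hp : ∀ R, Continuous (p R))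
    (hq : ∀ R, Continuous (q R)) (hp₀ : Continuous p₀) (hq₀ : Continuous q₀)
    (hpl : Tendsto (fun R => ∫ x in A, (p R x - p₀ x) ^ 2) atTop (𝓝 0))
    (hql : Tendsto (fun R => ∫ x in A, (q R x - q₀ x) ^ 2) atTop (𝓝 0)) :
    Tendsto (fun R => ∫ x, θ x * (p R x * q R x)) atTop (𝓝 (∫ x, θ x * (p₀ x * q₀ x))) := by
  obtain ⟨C, hC0, hC⟩ := hθ.exists_bound
  obtain ⟨B₁, hB₁⟩ := (isCompact_closedBall (0 : Eu 4) r).exists_bound_of_continuousOn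
    hp₀.continuousOn
  obtain ⟨B₂, hB₂⟩ := (isCompact_closedBall (0 : Eu 4) r).exists_bound_of_continuousOn
    hq₀.continuousOn
  set B := max B₁ B₂ with hB
  have hpd : ∀ R, Continuous fun x => p R x - p₀ x := fun R => (hp R).sub hp₀
  have hqd : ∀ R, Continuous fun x => q R x - q₀ x := fun R => (hq R).sub hq₀
  have hlim : Tendsto (fun R => C * ((∫ x in A, (p R x - p₀ x) ^ 2) +
      (∫ x in A, (q R x - q₀ x) ^ 2) + B * (∫ x in A, |p R x - p₀ x|) +
        B * ∫ x in A, |q R x - q₀ x|)) atTop (𝓝 0) := by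
    have := ((((hpl.add hql).add ((tendsto_setIntegral_abs hA hpd hpl).const_mul B)).add
      ((tendsto_setIntegral_abs hA hqd hql).const_mul B))).const_mul C
    simpa using this
  rw [tendsto_iff_dist_tendsto_zero]
  refine squeeze_zero (fun R => dist_nonneg) (fun R => ?_) hlim
  have hpq : ∀ R, Continuous fun x => p R x * q R x := fun R => (hp R).mul (hq R)
  have hpq₀ : Continuous fun x => p₀ x * q₀ x := hp₀.mul hq₀
  have e1 : (∫ x, θ x * (p R x * q R x)) - ∫ x, θ x * (p₀ x * q₀ x) =
      ∫ x in A, θ x * (p R x * q R x - p₀ x * q₀ x) := by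
    rw [setIntegral_eq_integral_of_forall_compl_eq_zero fun x hx => by rw [hθA x hx, zero_mul],
      ← integral_sub (hθ.integrable_mul (hpq R)) (hθ.integrable_mul hpq₀)]
    simp only [mul_sub]
  have i1 : IntegrableOn (fun x => (p R x - p₀ x) ^ 2) A :=
    integrableOn_of_subset_ball ((hpd R).pow 2) hA
  have i2 : IntegrableOn (fun x => (q R x - q₀ x) ^ 2) A :=
    integrableOn_of_subset_ball ((hqd R).pow 2) hA
  have i3 : IntegrableOn (fun x => B * |p R x - p₀ x|) A :=
    integrableOn_of_subset_ball (continuous_const.mul (hpd R).abs) hA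
  have i4 : IntegrableOn (fun x => B * |q R x - q₀ x|) A :=
    integrableOn_of_subset_ball (continuous_const.mul (hqd R).abs) hA
  have i12 : IntegrableOn (fun x => (p R x - p₀ x) ^ 2 + (q R x - q₀ x) ^ 2) A := i1.add i2
  have i123 : IntegrableOn (fun x => (p R x - p₀ x) ^ 2 + (q R x - q₀ x) ^ 2 +
    B * |p R x - p₀ x|) A := i12.add i3
  rw [Real.dist_eq, e1, ← Real.norm_eq_abs]
  have hbd : ‖∫ x in A, θ x * (p R x * q R x - p₀ x * q₀ x)‖ ≤
      ∫ x in A, C * ((p R x - p₀ x) ^ 2 + (q R x - q₀ x) ^ 2 + B * |p R x - p₀ x| +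
        B * |q R x - q₀ x|) := by
    refine norm_integral_le_of_norm_le ((i123.add i4).const_mul C) ?_
    refine (ae_restrict_mem hAm).mono fun x hx => ?_
    have hxb : x ∈ closedBall (0 : Eu 4) r := ball_subset_closedBall (hA hx)
    have b1 : |p₀ x| ≤ B := (hB₁ x hxb).trans (le_max_left _ _)
    have b2 : |q₀ x| ≤ B := (hB₂ x hxb).trans (le_max_right _ _)
    rw [norm_mul, Real.norm_eq_abs, Real.norm_eq_abs]
    refine mul_le_mul (hC x) ?_ (abs_nonneg _) hC0
    have e2 : p R x * q R x - p₀ x * q₀ x = (p R x - p₀ x) * (q R x - q₀ x) +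
        p₀ x * (q R x - q₀ x) + q₀ x * (p R x - p₀ x) := by ring
    rw [e2]
    have t1 := abs_add_three ((p R x - p₀ x) * (q R x - q₀ x)) (p₀ x * (q R x - q₀ x))
      (q₀ x * (p R x - p₀ x))
    rw [abs_mul, abs_mul, abs_mul] at t1
    have t2 : |p R x - p₀ x| * |q R x - q₀ x| ≤ (p R x - p₀ x) ^ 2 + (q R x - q₀ x) ^ 2 := by
      rw [← sq_abs (p R x - p₀ x), ← sq_abs (q R x - q₀ x)]
      nlinarith [sq_nonneg (|p R x - p₀ x| - |q R x - q₀ x|), sq_nonneg |p R x - p₀ x|,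
        sq_nonneg |q R x - q₀ x|]
    have t3 := mul_le_mul_of_nonneg_right b1 (abs_nonneg (q R x - q₀ x))
    have t4 := mul_le_mul_of_nonneg_right b2 (abs_nonneg (p R x - p₀ x))
    linarith
  refine hbd.trans (le_of_eq ?_)
  rw [integral_const_mul, integral_add i123 i4, integral_add i12 i3, integral_add i1 i2,
    integral_const_mul, integral_const_mul]

/-- The annulus `1 < |z| < 9`. -/
def ann : Set (Eu 4) := ball 0 9 \ closedBall 0 1

lemma measurableSet_ann : MeasurableSet ann := measurableSet_ball.diff measurableSet_closedBall

lemma ann_subset : ann ⊆ ball 0 9 := sdiff_subset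

lemma mem_ann {z : Eu 4} : z ∈ ann ↔ ‖z‖ < 9 ∧ 1 < ‖z‖ := by
  simp [ann, not_le]

lemma pd_eq_zero_of_eq_const {φ : Eu 4 → ℝ} {U : Set (Eu 4)} (hU : IsOpen U) {c : ℝ}
    (h : ∀ x ∈ U, φ x = c) (i : Fin 4) {x : Eu 4} (hx : x ∈ U) : pd i φ x = 0 := by
  have : φ =ᶠ[𝓝 x] fun _ => c := eventually_of_mem (hU.mem_nhds hx) h
  simp [pd, this.fderiv_eq]

lemma lap_eq_zero_of_eq_const {φ : Eu 4 → ℝ} (hφ : ContDiff ℝ ∞ φ) {U : Set (Eu 4)}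
    (hU : IsOpen U) {c : ℝ} (h : ∀ x ∈ U, φ x = c) {x : Eu 4} (hx : x ∈ U) : lap φ x = 0 := by
  rw [lap_eq hφ]
  exact Finset.sum_eq_zero fun i _ =>
    pd_eq_zero_of_eq_const hU (fun y hy => pd_eq_zero_of_eq_const hU h i hy) i hx

/-- The cutoff `cutoff (z/2)`. -/
def cutTwo (z : Eu 4) : ℝ := cutoff ((1 / 2 : ℝ) • z)

lemma isTest_cutTwo : IsTest cutTwo := isTest_cutoff.comp_smul (by norm_num)

lemma cutTwo_eq_one {z : Eu 4} (hz : ‖z‖ ≤ 2) : cutTwo z = 1 :=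
  cutoff_eq_one (by rw [norm_smul, Real.norm_of_nonneg (by norm_num)]; linarith)

lemma cutTwo_eq_zero {z : Eu 4} (hz : 4 ≤ ‖z‖) : cutTwo z = 0 :=
  cutoff_eq_zero (by rw [norm_smul, Real.norm_of_nonneg (by norm_num)]; linarith)

lemma pd_cutTwo_eq_zero (i : Fin 4) {z : Eu 4} (hz : z ∉ ann) : pd i cutTwo z = 0 := by
  rw [mem_ann, not_and_or, not_lt, not_lt] at hz
  rcases hz with hz | hz
  · exact pd_eq_zero_of_eq_const (U := {z | 4 < ‖z‖}) (isOpen_lt continuous_const continuous_norm)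
      (fun x hx => cutTwo_eq_zero (le_of_lt hx)) i (show 4 < ‖z‖ by linarith)
  · exact pd_eq_zero_of_eq_const (U := {z | ‖z‖ < 2}) (isOpen_lt continuous_norm continuous_const)
      (fun x hx => cutTwo_eq_one (le_of_lt hx)) i (show ‖z‖ < 2 by linarith)

lemma lap_cutTwo_eq_zero {z : Eu 4} (hz : z ∉ ann) : lap cutTwo z = 0 := by
  rw [mem_ann, not_and_or, not_lt, not_lt] at hz
  rcases hz with hz | hz
  · exact lap_eq_zero_of_eq_const isTest_cutTwo.smooth (U := {z | 4 < ‖z‖})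
      (isOpen_lt continuous_const continuous_norm)
      (fun x hx => cutTwo_eq_zero (le_of_lt hx)) (show 4 < ‖z‖ by linarith)
  · exact lap_eq_zero_of_eq_const isTest_cutTwo.smooth (U := {z | ‖z‖ < 2})
      (isOpen_lt continuous_norm continuous_const)
      (fun x hx => cutTwo_eq_one (le_of_lt hx)) (show ‖z‖ < 2 by linarith)

/-- A nonnegative bump supported in an annulus. -/
def annBump (z : Eu 4) : ℝ := (1 - cutTwo z) * cutoff ((1 / 4 : ℝ) • z)

lemma isTest_annBump : IsTest annBump :=
  (isTest_cutoff.comp_smul (c := 1 / 4) (by norm_num)).mul_left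
    (contDiff_const.sub isTest_cutTwo.smooth)

lemma annBump_nonneg (z : Eu 4) : 0 ≤ annBump z :=
  mul_nonneg (sub_nonneg.2 (cutoff_le_one _)) (cutoff_nonneg _)

lemma annBump_eq_zero_of_le {z : Eu 4} (hz : ‖z‖ ≤ 2) : annBump z = 0 := by
  rw [annBump, cutTwo_eq_one hz, sub_self, zero_mul]

lemma annBump_eq_zero_of_ge {z : Eu 4} (hz : 8 ≤ ‖z‖) : annBump z = 0 := by
  rw [annBump, cutoff_eq_zero (by rw [norm_smul, Real.norm_of_nonneg (by norm_num)]; linarith),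
    mul_zero]

lemma annBump_eq_zero {z : Eu 4} (hz : z ∉ ann) : annBump z = 0 := by
  rw [mem_ann, not_and_or, not_lt, not_lt] at hz
  rcases hz with hz | hz
  · exact annBump_eq_zero_of_ge (by linarith)
  · exact annBump_eq_zero_of_le (by linarith)

lemma pd_annBump_eq_zero (i : Fin 4) {z : Eu 4} (hz : z ∉ ann) : pd i annBump z = 0 := by
  rw [mem_ann, not_and_or, not_lt, not_lt] at hz
  rcases hz with hz | hz
  · exact pd_eq_zero_of_eq_const (U := {z | 8 < ‖z‖}) (isOpen_lt continuous_const continuous_norm)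
      (fun x hx => annBump_eq_zero_of_ge (le_of_lt hx)) i (show 8 < ‖z‖ by linarith)
  · exact pd_eq_zero_of_eq_const (U := {z | ‖z‖ < 2}) (isOpen_lt continuous_norm continuous_const)
      (fun x hx => annBump_eq_zero_of_le (le_of_lt hx)) i (show ‖z‖ < 2 by linarith)

lemma lap_logKernel {z : Eu 4} (hz : 1 < ‖z‖) : lap logKernel z = 2 * (‖z‖ ^ 2)⁻¹ := by
  have := congrFun (lap_radial contDiff_logProfile) z
  exact this.trans (radLap_logProfile (one_lt_pow₀ hz two_ne_zero))

lemma gradSq_logKernel {z : Eu 4} (hz : 1 < ‖z‖) : gradSq logKernel z = (‖z‖ ^ 2)⁻¹ := by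
  have h0 : 0 < ‖z‖ := by linarith
  simp only [gradSq, pd_logKernel hz, div_pow, ← Finset.sum_div]
  rw [← EuclideanSpace.real_norm_sq_eq]
  field_simp

lemma integral_annBump_mul_lap_pos : 0 < ∫ z, annBump z * lap logKernel z := by
  have hc : Continuous fun z => annBump z * lap logKernel z :=
    isTest_annBump.continuous.mul (contDiff_lap contDiff_logKernel).continuous
  refine hc.integral_pos_of_hasCompactSupport_nonneg_nonzero
    (isTest_annBump.mul_right (contDiff_lap contDiff_logKernel)).compact (fun z => ?_)
    (x := EuclideanSpace.single 0 4) ?_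
  · by_cases hz : z ∈ ann
    · rw [lap_logKernel (mem_ann.1 hz).2]
      exact mul_nonneg (annBump_nonneg z) (by positivity)
    · simp [annBump_eq_zero hz]
  · have hn : ‖(EuclideanSpace.single 0 4 : Eu 4)‖ = 4 := by simp
    rw [lap_logKernel (by rw [hn]; norm_num), annBump, cutTwo_eq_zero hn.ge, cutoff_eq_one
      (by rw [norm_smul, hn, Real.norm_of_nonneg (by norm_num)]; norm_num), hn]
    norm_num

lemma integral_lap_cutTwo_mul_gradSq :
    ∫ z, lap cutTwo z * gradSq logKernel z = -(4 * Real.pi ^ 2) := by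
  have h1 : ∀ z, lap cutTwo z * gradSq logKernel z = 1 / 2 * (lap cutTwo z * lap logKernel z) := by
    intro z
    by_cases hz : z ∈ ann
    · rw [lap_logKernel (mem_ann.1 hz).2, gradSq_logKernel (mem_ann.1 hz).2]; ring
    · simp [lap_cutTwo_eq_zero hz]
  simp only [h1]
  rw [integral_const_mul, ← integral_mul_lap_comm isTest_cutTwo (contDiff_lap contDiff_logKernel)]
  have h2 : (fun z => cutTwo z * lap (lap logKernel) z) = biKernel := by
    ext z
    change cutTwo z * biKernel z = biKernel z
    rcases le_or_gt ‖z‖ 2 with hz | hz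
    · rw [cutTwo_eq_one hz, one_mul]
    · rw [biKernel_eq_zero (by linarith), mul_zero]
  rw [h2, integral_biKernel]
  ring

/-- The indicator function of the dilated annulus. -/
def annInd (R : ℝ) (x : Eu 4) : ℝ := ann.indicator 1 (R⁻¹ • x)

lemma annInd_nonneg (R : ℝ) (x : Eu 4) : 0 ≤ annInd R x :=
  indicator_nonneg (fun _ _ => zero_le_one) _

lemma measurable_annInd (R : ℝ) : Measurable (annInd R) :=
  (measurable_one.indicator measurableSet_ann).comp (measurable_const_smul R⁻¹)

lemma annInd_le {R : ℝ} (hR : 0 < R) (x : Eu 4) :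
    annInd R x ≤ (ball (0 : Eu 4) (9 * R)).indicator 1 x := by
  by_cases h : R⁻¹ • x ∈ ann
  · have h1 := (mem_ann.1 h).1
    rw [norm_smul, norm_inv, Real.norm_of_nonneg hR.le, inv_mul_lt_iff₀ hR] at h1
    rw [annInd, indicator_of_mem h, indicator_of_mem (by simpa [mul_comm] using h1)]
    rfl
  · rw [annInd, indicator_of_notMem h]
    exact indicator_nonneg (fun _ _ => zero_le_one) _

lemma annInd_eq_zero {R : ℝ} (hR : 0 < R) {x : Eu 4} (hx : ‖x‖ ≤ R) : annInd R x = 0 := by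
  refine indicator_of_notMem (fun h => ?_) _
  have h1 := (mem_ann.1 h).2
  rw [norm_smul, norm_inv, Real.norm_of_nonneg hR.le, lt_inv_mul_iff₀ hR, mul_one] at h1
  linarith

lemma annInd_potential {R : ℝ} (hR : 0 < R) (y : Eu 4) :
    Integrable (fun x => annInd R x * (‖x - y‖ ^ 2)⁻¹) ∧
      ∫ x, annInd R x * (‖x - y‖ ^ 2)⁻¹ ≤ 2 * Real.pi ^ 2 * (9 * R) ^ 2 := by
  have hI := (integrableOn_ball_inv_dist_sq y 0 (9 * R)).integrable_indicator measurableSet_ball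
  have hle : ∀ x, annInd R x * (‖x - y‖ ^ 2)⁻¹ ≤
      (ball (0 : Eu 4) (9 * R)).indicator (fun x => (‖y - x‖ ^ 2)⁻¹) x := by
    intro x
    rw [norm_sub_rev x y]
    refine (mul_le_mul_of_nonneg_right (annInd_le hR x) (by positivity)).trans (le_of_eq ?_)
    by_cases h : x ∈ ball (0 : Eu 4) (9 * R) <;> simp [h]
  have h1 : Integrable (fun x => annInd R x * (‖x - y‖ ^ 2)⁻¹) :=
    hI.mono' ((measurable_annInd R).mul (by fun_prop)).aestronglyMeasurable
      (Eventually.of_forall fun x => by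
        rw [Real.norm_of_nonneg (mul_nonneg (annInd_nonneg R x) (by positivity))]; exact hle x)
  refine ⟨h1, (integral_mono h1 hI hle).trans ?_⟩
  rw [integral_indicator measurableSet_ball]
  exact setIntegral_inv_dist_sq_le y 0 (by positivity)

lemma setIntegral_ann_dil (h : Eu 4 → ℝ) {R : ℝ} (hR : 0 < R) :
    ∫ z in ann, h (R • z) = R⁻¹ ^ 4 * ∫ x, annInd R x * h x := by
  rw [← integral_dil _ hR, ← integral_indicator measurableSet_ann]
  congr 1
  ext z
  by_cases hz : z ∈ ann <;> simp [dil, annInd, hz, smul_smul, hR.ne']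

lemma tendsto_setIntegral_confLap_dil {u : Eu 4 → ℝ} (hu : ContDiff ℝ ∞ u)
    (hE : Integrable fun x => confLap u x ^ 2) :
    Tendsto (fun R => ∫ x in ann, (confLap (dil R u) x - 0) ^ 2) atTop (𝓝 0) := by
  have h1 : Tendsto (fun R => ∫ x, annInd R x * confLap u x ^ 2) atTop (𝓝 0) := by
    have h0 : (0 : ℝ) = ∫ _x : Eu 4, (0 : ℝ) := by simp
    rw [h0]
    refine tendsto_integral_filter_of_dominated_convergence (fun x => confLap u x ^ 2)
      (Eventually.of_forall fun R => ((measurable_annInd R).mul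
        ((contDiff_confLap hu).continuous.pow 2).measurable).aestronglyMeasurable) ?_ hE ?_
    · filter_upwards [eventually_gt_atTop 0] with R hR
      refine Eventually.of_forall fun x => ?_
      rw [Real.norm_of_nonneg (mul_nonneg (annInd_nonneg R x) (sq_nonneg _))]
      exact mul_le_of_le_one_left (sq_nonneg _)
        ((annInd_le hR x).trans (indicator_apply_le' (fun _ => le_rfl) fun _ => zero_le_one))
    · refine Eventually.of_forall fun x => tendsto_const_nhds.congr' ?_
      filter_upwards [eventually_ge_atTop ‖x‖, eventually_gt_atTop 0] with R hR hR0
      rw [annInd_eq_zero hR0 hR, zero_mul]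
  refine h1.congr' ?_
  filter_upwards [eventually_gt_atTop 0] with R hR
  simp only [sub_zero, confLap_dil hu, mul_pow]
  rw [integral_const_mul, setIntegral_ann_dil (fun x => confLap u x ^ 2) hR]
  field_simp

/-- Far away the gradient is the Newtonian field of a point mass, in the `L²` sense. -/
lemma tendsto_setIntegral_pd_dil {u f : Eu 4 → ℝ} (hu : ContDiff ℝ ∞ u) (hf : Continuous f)
    (hfi : Integrable f) (hb : ∀ i x, pd i u x = ∫ y, newt i (x - y) * f y) (i : Fin 4) :
    Tendsto (fun R => ∫ x in ann, (pd i (dil R u) x - (∫ y, f y) * pd i logKernel x) ^ 2)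
      atTop (𝓝 0) := by
  set m := ∫ y, f y with hm
  set ρ : Eu 4 → ℝ := fun x => pd i u x - m * newt i x with hρd
  have hρm : Measurable ρ :=
    (contDiff_pd hu i).continuous.measurable.sub ((measurable_newt i).const_mul m)
  have hNi : ∀ x, Integrable fun y => newt i (x - y) * f y := by
    intro x
    refine (integrable_inv_dist_mul hf hfi x).norm.mono'
      (((measurable_newt i).comp (measurable_const.sub measurable_id)).mul
        hf.measurable).aestronglyMeasurable (Eventually.of_forall fun y => ?_)
    rw [norm_mul, norm_mul, Real.norm_eq_abs, norm_inv, norm_norm]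
    exact mul_le_mul_of_nonneg_right (abs_newt_le i _) (norm_nonneg _)
  have hρ : ∀ x, ρ x = ∫ y, (newt i (x - y) - newt i x) * f y := by
    intro x
    simp only [sub_mul]
    rw [integral_sub (hNi x) (hfi.const_mul _), integral_const_mul, ← hb, hρd]
    ring
  have hlim : Tendsto (fun R => 4 * farMass f R ^ 2 * (2 * Real.pi ^ 2 * 81)) atTop (𝓝 0) := by
    have := (((tendsto_farMass hfi).pow 2).const_mul 4).mul_const (2 * Real.pi ^ 2 * 81)
    simpa using this
  refine squeeze_zero' (Eventually.of_forall fun R => integral_nonneg fun _ => sq_nonneg _) ?_ hlim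
  filter_upwards [eventually_gt_atTop 0] with R hR
  have h1 := (integral_weight_mul_sq_le hf hfi hR (measurable_annInd R) (annInd_nonneg R)
    (fun x hx => annInd_eq_zero hR hx.le) (annInd_potential hR) i hρm (fun x _ => hρ x)).2
  have h2 : ∫ x in ann, (pd i (dil R u) x - m * pd i logKernel x) ^ 2 =
      ∫ z in ann, R ^ 2 * ρ (R • z) ^ 2 := by
    refine setIntegral_congr_fun measurableSet_ann fun z hz => ?_
    have hz1 := (mem_ann.1 hz).2
    have h0 : 0 < ‖z‖ := by linarith
    simp only [pd_dil hu, dil, pd_logKernel hz1, hρd, newt, PiLp.smul_apply, smul_eq_mul,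
      norm_smul, Real.norm_of_nonneg hR.le]
    field_simp
  rw [h2, integral_const_mul, setIntegral_ann_dil (fun x => ρ x ^ 2) hR]
  calc R ^ 2 * (R⁻¹ ^ 4 * ∫ x, annInd R x * ρ x ^ 2)
      ≤ R ^ 2 * (R⁻¹ ^ 4 * (4 * farMass f R ^ 2 * (2 * Real.pi ^ 2 * (9 * R) ^ 2))) := by gcongr
    _ = _ := by field_simp; ring

/-- The total mass `m` of the gradient potential satisfies `m(m+2) = 0`. -/
lemma mass_mul_eq_zero {u f : Eu 4 → ℝ} (hu : ContDiff ℝ ∞ u) (hf : Continuous f)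
    (hfi : Integrable f) (hb : ∀ i x, pd i u x = ∫ y, newt i (x - y) * f y)
    (hE : Integrable fun x => confLap u x ^ 2) : (∫ y, f y) * ((∫ y, f y) + 2) = 0 := by
  set m := ∫ y, f y with hm
  have hL := contDiff_logKernel
  have hcp : ∀ i R, Continuous (pd i (dil R u)) := fun i R =>
    (contDiff_pd (contDiff_dil hu R) i).continuous
  have hcL : ∀ i, Continuous fun x => m * pd i logKernel x := fun i =>
    continuous_const.mul (contDiff_pd hL i).continuous
  have hone : Tendsto (fun _ : ℝ => ∫ x in ann, ((1 : ℝ) - 1) ^ 2) atTop (𝓝 0) := by simp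
  have hP := tendsto_setIntegral_pd_dil hu hf hfi hb
  have t1 : Tendsto (fun R => ∫ x, annBump x * (confLap (dil R u) x * 1)) atTop
      (𝓝 (∫ x, annBump x * (0 * 1))) :=
    tendsto_integral_mul_mul (p₀ := fun _ => 0) (q := fun _ _ => 1) (q₀ := fun _ => 1)
      measurableSet_ann ann_subset isTest_annBump
      (fun _ h => annBump_eq_zero h) (fun R => (contDiff_confLap (contDiff_dil hu R)).continuous)
      (fun _ => continuous_const) continuous_const continuous_const
      (tendsto_setIntegral_confLap_dil hu hE) hone
  have t2 : ∀ i, Tendsto (fun R => ∫ x, annBump x * (pd i (dil R u) x * pd i (dil R u) x)) atTop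
      (𝓝 (∫ x, annBump x * ((m * pd i logKernel x) * (m * pd i logKernel x)))) := fun i =>
    tendsto_integral_mul_mul measurableSet_ann ann_subset isTest_annBump
      (fun _ h => annBump_eq_zero h) (hcp i) (hcp i) (hcL i) (hcL i) (hP i) (hP i)
  have t3 : ∀ i, Tendsto (fun R => ∫ x, pd i annBump x * (pd i (dil R u) x * 1)) atTop
      (𝓝 (∫ x, pd i annBump x * ((m * pd i logKernel x) * 1))) := fun i =>
    tendsto_integral_mul_mul (q := fun _ _ => 1) (q₀ := fun _ => 1)
      measurableSet_ann ann_subset (isTest_annBump.pd i)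
      (fun _ h => pd_annBump_eq_zero i h) (hcp i) (fun _ => continuous_const) (hcL i)
      continuous_const (hP i) hone
  have t4 : Tendsto (fun R => ∫ x, annBump x * (confLap (dil R u) x * 1)) atTop
      (𝓝 ((∑ i, ∫ x, annBump x * ((m * pd i logKernel x) * (m * pd i logKernel x))) -
        ∑ i, ∫ x, pd i annBump x * ((m * pd i logKernel x) * 1))) := by
    have := (tendsto_finsetSum Finset.univ fun i _ => t2 i).sub
      (tendsto_finsetSum Finset.univ fun i _ => t3 i)
    refine this.congr fun R => ?_
    simp only [mul_one, integral_mul_confLap (contDiff_dil hu R) isTest_annBump, pow_two]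
  have key := tendsto_nhds_unique t1 t4
  have e1 : ∑ i, ∫ x, annBump x * ((m * pd i logKernel x) * (m * pd i logKernel x)) =
      m ^ 2 / 2 * ∫ x, annBump x * lap logKernel x := by
    have hcLL : ∀ i, Continuous fun x => m * pd i logKernel x * (m * pd i logKernel x) :=
      fun i => (hcL i).mul (hcL i)
    rw [← integral_finsetSum _ fun i _ => isTest_annBump.integrable_mul (hcLL i),
      ← integral_const_mul]
    congr 1
    ext x
    by_cases hx : x ∈ ann
    · have hx1 := (mem_ann.1 hx).2
      have h2 : ∑ i, annBump x * ((m * pd i logKernel x) * (m * pd i logKernel x)) =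
          annBump x * m ^ 2 * gradSq logKernel x := by
        rw [gradSq, Finset.mul_sum]
        exact Finset.sum_congr rfl fun i _ => by ring
      rw [h2, gradSq_logKernel hx1, lap_logKernel hx1]
      ring
    · simp [annBump_eq_zero hx]
  have e2 : ∑ i, ∫ x, pd i annBump x * ((m * pd i logKernel x) * 1) =
      -(m * ∫ x, annBump x * lap logKernel x) := by
    rw [integral_mul_lap isTest_annBump hL, mul_neg, neg_neg, Finset.mul_sum]
    refine Finset.sum_congr rfl fun i _ => ?_
    rw [← integral_const_mul]
    congr 1
    ext x
    ring
  rw [e1, e2] at key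
  simp only [zero_mul, mul_zero, integral_zero] at key
  have hJ := integral_annBump_mul_lap_pos
  have : m * (m + 2) * ∫ x, annBump x * lap logKernel x = 0 := by linarith
  rcases mul_eq_zero.1 this with h | h
  · exact h
  · exact (hJ.ne' h).elim

/-- The integral of `σ₂` is determined by the total mass of the gradient potential. -/
lemma integral_sigma2_eq {u f : Eu 4 → ℝ} (hu : ContDiff ℝ ∞ u) (hf : Continuous f)
    (hfi : Integrable f) (hb : ∀ i x, pd i u x = ∫ y, newt i (x - y) * f y)
    (hE : Integrable fun x => confLap u x ^ 2)
    (hs : Integrable fun x => sigma2 (schoutenMatrix u x)) :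
    ∫ x, sigma2 (schoutenMatrix u x) = Real.pi ^ 2 * (∫ y, f y) ^ 2 := by
  set m := ∫ y, f y with hm
  have hL := contDiff_logKernel
  have hcp : ∀ i R, Continuous (pd i (dil R u)) := fun i R =>
    (contDiff_pd (contDiff_dil hu R) i).continuous
  have hcL : ∀ i, Continuous fun x => m * pd i logKernel x := fun i =>
    continuous_const.mul (contDiff_pd hL i).continuous
  have hP := tendsto_setIntegral_pd_dil hu hf hfi hb
  have t1 : ∀ i, Tendsto (fun R => ∫ x, pd i cutTwo x * (confLap (dil R u) x * pd i (dil R u) x))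
      atTop (𝓝 (∫ x, pd i cutTwo x * (0 * (m * pd i logKernel x)))) := fun i =>
    tendsto_integral_mul_mul (p₀ := fun _ => 0) measurableSet_ann ann_subset (isTest_cutTwo.pd i)
      (fun _ h => pd_cutTwo_eq_zero i h)
      (fun R => (contDiff_confLap (contDiff_dil hu R)).continuous) (hcp i) continuous_const (hcL i)
      (tendsto_setIntegral_confLap_dil hu hE) (hP i)
  have t2 : ∀ i, Tendsto (fun R => ∫ x, lap cutTwo x * (pd i (dil R u) x * pd i (dil R u) x)) atTop
      (𝓝 (∫ x, lap cutTwo x * ((m * pd i logKernel x) * (m * pd i logKernel x)))) := fun i =>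
    tendsto_integral_mul_mul measurableSet_ann ann_subset isTest_cutTwo.lap
      (fun _ h => lap_cutTwo_eq_zero h) (hcp i) (hcp i) (hcL i) (hcL i) (hP i) (hP i)
  have hsum : ∀ g : Fin 4 → Eu 4 → ℝ, (∀ i, Continuous (g i)) →
      ∫ x, lap cutTwo x * ∑ i, g i x ^ 2 = ∑ i, ∫ x, lap cutTwo x * (g i x * g i x) := by
    intro g hg
    have hgg : ∀ i, Continuous fun x => g i x * g i x := fun i => (hg i).mul (hg i)
    rw [← integral_finsetSum _ fun i _ => isTest_cutTwo.lap.integrable_mul (hgg i)]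
    congr 1
    ext x
    rw [Finset.mul_sum]
    exact Finset.sum_congr rfl fun i _ => by rw [pow_two]
  have t3 : Tendsto (fun R => ∫ x, cutTwo x * sigma2 (schoutenMatrix (dil R u) x)) atTop
      (𝓝 (Real.pi ^ 2 * m ^ 2)) := by
    have h := ((tendsto_finsetSum Finset.univ fun i _ => t1 i).const_mul (-(1 / 2))).sub
      ((tendsto_finsetSum Finset.univ fun i _ => t2 i).const_mul (1 / 4))
    have e : -(1 / 2) * (∑ i, ∫ x, pd i cutTwo x * (0 * (m * pd i logKernel x))) -
        1 / 4 * (∑ i, ∫ x, lap cutTwo x * ((m * pd i logKernel x) * (m * pd i logKernel x))) =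
          Real.pi ^ 2 * m ^ 2 := by
      rw [← hsum (fun i x => m * pd i logKernel x) hcL]
      simp only [zero_mul, mul_zero, integral_zero, Finset.sum_const_zero, mul_pow,
        ← Finset.mul_sum, mul_left_comm _ (m ^ 2)]
      have := integral_lap_cutTwo_mul_gradSq
      simp only [gradSq] at this
      rw [integral_const_mul, this]
      ring
    rw [e] at h
    refine h.congr fun R => ?_
    rw [integral_mul_sigma2 (contDiff_dil hu R) isTest_cutTwo]
    simp only [gradSq, ← hsum (fun i => pd i (dil R u)) fun i => hcp i R]
  have t4 : Tendsto (fun R => ∫ x, cutTwo x * sigma2 (schoutenMatrix (dil R u) x)) atTop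
      (𝓝 (∫ x, sigma2 (schoutenMatrix u x))) := by
    have h : Tendsto (fun R : ℝ => ∫ x, cutTwo (R⁻¹ • x) * sigma2 (schoutenMatrix u x)) atTop
        (𝓝 (∫ x, sigma2 (schoutenMatrix u x))) := by
      refine tendsto_integral_filter_of_dominated_convergence
        (fun x => |sigma2 (schoutenMatrix u x)|) (Eventually.of_forall fun R => ?_)
        (Eventually.of_forall fun R => Eventually.of_forall fun x => ?_) hs.abs
        (Eventually.of_forall fun x => ?_)
      · exact ((isTest_cutTwo.continuous.comp (continuous_const_smul R⁻¹)).aestronglyMeasurable).mul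
          hs.aestronglyMeasurable
      · have h0 : 0 ≤ cutTwo (R⁻¹ • x) := cutoff_nonneg _
        rw [norm_mul, Real.norm_of_nonneg h0, Real.norm_eq_abs]
        exact mul_le_of_le_one_left (abs_nonneg _) (cutoff_le_one _)
      · refine tendsto_const_nhds.congr' ?_
        filter_upwards [eventually_ge_atTop ‖x‖, eventually_gt_atTop 0] with R hR hR0
        have : ‖R⁻¹ • x‖ ≤ 2 := by
          rw [norm_smul, norm_inv, Real.norm_of_nonneg hR0.le, inv_mul_le_iff₀ hR0]
          linarith
        rw [cutTwo_eq_one this, one_mul]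
    refine h.congr' ?_
    filter_upwards [eventually_gt_atTop 0] with R hR
    have h1 : ∀ x, cutTwo x * sigma2 (schoutenMatrix (dil R u) x) = R ^ 4 *
        dil R (fun x => cutTwo (R⁻¹ • x) * sigma2 (schoutenMatrix u x)) x := by
      intro x
      rw [sigma2_dil hu, dil, inv_smul_smul₀ hR.ne']
      ring
    simp only [h1]
    rw [integral_const_mul, integral_dil _ hR]
    field_simp
  exact tendsto_nhds_unique t4 t3

/-- Under the `σ₂` pinching the gradient potential has zero total mass. -/
lemma mass_eq_zero {u f : Eu 4 → ℝ} (hu : ContDiff ℝ ∞ u) (hf : Continuous f)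
    (hfi : Integrable f) (hb : ∀ i x, pd i u x = ∫ y, newt i (x - y) * f y)
    (hE : Integrable fun x => confLap u x ^ 2)
    (hs : Integrable fun x => sigma2 (schoutenMatrix u x))
    (hlt : ∫ x, sigma2 (schoutenMatrix u x) < 2 * Real.pi ^ 2) : ∫ y, f y = 0 := by
  rcases mul_eq_zero.1 (mass_mul_eq_zero hu hf hfi hb hE) with h | h
  · exact h
  · rw [integral_sigma2_eq hu hf hfi hb hE hs, eq_neg_of_add_eq_zero_left h] at hlt
    nlinarith [Real.pi_pos]

lemma contDiff_inv_norm_sq_add {δ : ℝ} (hδ : 0 < δ) :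
    ContDiff ℝ ∞ (fun x : Eu 4 => (‖x‖ ^ 2 + δ)⁻¹) :=
  ((contDiff_norm_sq ℝ).add contDiff_const).inv fun x => by positivity

lemma pd_inv_norm_sq_add {δ : ℝ} (hδ : 0 < δ) (i : Fin 4) (x : Eu 4) :
    pd i (fun x : Eu 4 => (‖x‖ ^ 2 + δ)⁻¹) x = -(2 * x i * (‖x‖ ^ 2 + δ)⁻¹ ^ 2) := by
  have h : HasDerivAt (fun s : ℝ => (s + δ)⁻¹) (-1 / (‖x‖ ^ 2 + δ) ^ 2) (‖x‖ ^ 2) :=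
    ((hasDerivAt_id _).add_const δ).inv (by simp only [id]; positivity)
  rw [pd_radial (G := fun s => (s + δ)⁻¹) h.differentiableAt, h.deriv]
  field_simp

/-- Regularised Hardy inequality. -/
lemma integral_sq_mul_inv_add_le {φ : Eu 4 → ℝ} (hφ : IsTest φ) {δ : ℝ} (hδ : 0 < δ) :
    ∫ x, φ x ^ 2 * (‖x‖ ^ 2 + δ)⁻¹ ≤ ∫ x, gradSq φ x := by
  set g : Eu 4 → ℝ := fun x => (‖x‖ ^ 2 + δ)⁻¹ with hg
  have hgs : ContDiff ℝ ∞ g := contDiff_inv_norm_sq_add hδ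
  have hg0 : ∀ x, 0 < g x := fun x => by simp only [hg]; positivity
  have hgq : ∀ x, ‖x‖ ^ 2 * g x ≤ 1 := fun x => by
    simp only [hg]
    rw [← div_eq_mul_inv, div_le_one (by positivity)]
    linarith
  have hw : ∀ i, ContDiff ℝ ∞ (fun x : Eu 4 => x i * g x) := fun i => (contDiff_coord i).mul hgs
  have hφ2 := hφ.sq
  have hibp := fun i => integral_mul_pd hφ2 (hw i) i
  have hint : ∀ i, Integrable fun x => φ x ^ 2 * pd i (fun x : Eu 4 => x i * g x) x := fun i =>
    hφ2.integrable_mul (contDiff_pd (hw i) i).continuous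
  have hint2 : ∀ i, Integrable fun x => pd i (fun x => φ x ^ 2) x * (x i * g x) := fun i =>
    (hφ2.pd i).integrable_mul (hw i).continuous
  have hsum : ∫ x, ∑ i, φ x ^ 2 * pd i (fun x : Eu 4 => x i * g x) x =
      ∫ x, -∑ i, pd i (fun x => φ x ^ 2) x * (x i * g x) := by
    rw [integral_finsetSum _ fun i _ => hint i, integral_neg,
      integral_finsetSum _ fun i _ => hint2 i, ← Finset.sum_neg_distrib]
    exact Finset.sum_congr rfl fun i _ => hibp i
  have hig : Integrable fun x => φ x ^ 2 * g x := hφ2.integrable_mul hgs.continuous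
  have h1 : ∫ x, 2 * (φ x ^ 2 * g x) ≤ ∫ x, ∑ i, φ x ^ 2 * pd i (fun x : Eu 4 => x i * g x) x := by
    refine integral_mono (hig.const_mul 2) (integrable_finsetSum _ fun i _ => hint i) fun x => ?_
    have e : ∑ i, φ x ^ 2 * pd i (fun x : Eu 4 => x i * g x) x =
        φ x ^ 2 * (4 * g x - 2 * ‖x‖ ^ 2 * g x ^ 2) := by
      rw [← Finset.mul_sum]
      congr 1
      simp only [pd_mul (contDiff_coord _) hgs, pd_coord, EuclideanSpace.norm_sq_eq,
        Real.norm_eq_abs, sq_abs]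
      simp only [hg, pd_inv_norm_sq_add hδ, Fin.sum_univ_four]
      simp only [if_true]
      ring
    show 2 * (φ x ^ 2 * g x) ≤ _
    rw [e]
    nlinarith [mul_nonneg (mul_nonneg (sq_nonneg (φ x)) (hg0 x).le) (sub_nonneg.2 (hgq x))]
  have h2 : ∫ x, -∑ i, pd i (fun x => φ x ^ 2) x * (x i * g x) ≤
      ∫ x, φ x ^ 2 * g x + gradSq φ x := by
    refine integral_mono (integrable_finsetSum _ fun i _ => hint2 i).neg
      (hig.add hφ.gradSq.integrable) fun x => ?_
    have e : φ x ^ 2 * ‖x‖ ^ 2 * g x ^ 2 + gradSq φ x +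
        ∑ i, pd i (fun x => φ x ^ 2) x * (x i * g x) = ∑ i, (φ x * (x i * g x) + pd i φ x) ^ 2 := by
      simp only [pd_sq hφ.smooth, gradSq, EuclideanSpace.norm_sq_eq, Real.norm_eq_abs, sq_abs,
        Fin.sum_univ_four]
      ring
    have := Finset.sum_nonneg fun i (_ : i ∈ Finset.univ) => sq_nonneg (φ x * (x i * g x) + pd i φ x)
    show -∑ i, pd i (fun x => φ x ^ 2) x * (x i * g x) ≤ φ x ^ 2 * g x + gradSq φ x
    nlinarith [mul_nonneg (mul_nonneg (sq_nonneg (φ x)) (hg0 x).le) (sub_nonneg.2 (hgq x))]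
  rw [integral_const_mul] at h1
  rw [integral_add hig hφ.gradSq.integrable] at h2
  linarith

lemma IsTest.integrable_mul_inv_dist_sq {φ : Eu 4 → ℝ} (hφ : IsTest φ) (p : Eu 4) :
    Integrable fun x => φ x * (‖x - p‖ ^ 2)⁻¹ := by
  obtain ⟨C, hC0, hC⟩ := hφ.exists_bound
  obtain ⟨K, hK0, hK⟩ := hφ.exists_radius
  have h : IntegrableOn (fun x => C * (‖p - x‖ ^ 2)⁻¹) (ball 0 (K + 1)) :=
    (integrableOn_ball_inv_dist_sq p 0 (K + 1)).const_mul C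
  rw [← integrable_indicator_iff measurableSet_ball] at h
  refine h.mono' ?_ (Eventually.of_forall fun x => ?_)
  · exact hφ.continuous.aestronglyMeasurable.mul
      ((measurable_id.sub_const p).norm.pow_const 2).inv.aestronglyMeasurable
  · rw [norm_mul, Real.norm_eq_abs, Real.norm_of_nonneg (by positivity)]
    by_cases hx : x ∈ ball (0 : Eu 4) (K + 1)
    · rw [indicator_of_mem hx, norm_sub_rev p x]
      exact mul_le_mul_of_nonneg_right (hC x) (by positivity)
    · rw [mem_ball_zero_iff, not_lt] at hx
      rw [hK x (by linarith), abs_zero, zero_mul]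
      exact indicator_nonneg (fun y _ => by positivity) _

/-- Hardy's inequality in dimension four. -/
lemma integral_sq_mul_inv_dist_sq_le {φ : Eu 4 → ℝ} (hφ : IsTest φ) (p : Eu 4) :
    ∫ x, φ x ^ 2 * (‖x - p‖ ^ 2)⁻¹ ≤ ∫ x, gradSq φ x := by
  have hzero : ∀ ψ : Eu 4 → ℝ, IsTest ψ → ∫ x, ψ x ^ 2 * (‖x‖ ^ 2)⁻¹ ≤ ∫ x, gradSq ψ x := by
    intro ψ hψ
    have hlim : Tendsto (fun δ : ℝ => ∫ x, ψ x ^ 2 * (‖x‖ ^ 2 + δ)⁻¹) (𝓝[>] 0)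
        (𝓝 (∫ x, ψ x ^ 2 * (‖x‖ ^ 2)⁻¹)) := by
      have hi := hψ.sq.integrable_mul_inv_dist_sq 0
      simp only [sub_zero] at hi
      have hae : ∀ᵐ x : Eu 4, x ≠ 0 := by
        simp [ae_iff]
      refine tendsto_integral_filter_of_dominated_convergence _ ?_ ?_ hi ?_
      · filter_upwards [self_mem_nhdsWithin] with δ hδ
        exact (hψ.sq.continuous.mul
          (contDiff_inv_norm_sq_add hδ).continuous).aestronglyMeasurable
      · filter_upwards [self_mem_nhdsWithin] with δ hδ
        filter_upwards [hae] with x hx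
        have hδ' : (0 : ℝ) < δ := hδ
        have hx' : 0 < ‖x‖ ^ 2 := by positivity
        rw [norm_mul, Real.norm_of_nonneg (sq_nonneg _), Real.norm_of_nonneg (by positivity)]
        exact mul_le_mul_of_nonneg_left (inv_anti₀ hx' (by linarith)) (sq_nonneg _)
      · filter_upwards [hae] with x hx
        have hx' : ‖x‖ ^ 2 + 0 ≠ 0 := by simpa using hx
        have hc : ContinuousAt (fun δ : ℝ => ψ x ^ 2 * (‖x‖ ^ 2 + δ)⁻¹) 0 :=
          continuousAt_const.mul ((continuousAt_const.add continuousAt_id).inv₀ hx')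
        have := hc.tendsto
        simp only [add_zero] at this
        exact this.mono_left nhdsWithin_le_nhds
    refine le_of_tendsto hlim ?_
    filter_upwards [self_mem_nhdsWithin] with δ hδ
    exact integral_sq_mul_inv_add_le hψ hδ
  have h := hzero _ (hφ.rescale p one_pos)
  have e1 : ∫ x, rescale φ p 1 x ^ 2 * (‖x‖ ^ 2)⁻¹ = ∫ x, φ x ^ 2 * (‖x - p‖ ^ 2)⁻¹ := by
    rw [← integral_sub_left_eq_self (fun x => φ x ^ 2 * (‖x - p‖ ^ 2)⁻¹) volume p]
    simp [rescale]
  have e2 : ∫ x, gradSq (rescale φ p 1) x = ∫ x, gradSq φ x := by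
    simp only [gradSq_rescale hφ.smooth]
    rw [integral_const_mul, integral_rescale _ _ one_pos]
    simp
  rwa [e1, e2] at h

lemma integral_gradSq_mul_eq {η b : Eu 4 → ℝ} (hη : IsTest η) (hb : ContDiff ℝ ∞ b) :
    ∫ x, gradSq (fun x => η x * b x) x =
      (∫ x, gradSq η x * b x ^ 2) - ∫ x, (η x ^ 2 * b x) * lap b x := by
  have h2 : IsTest fun x => η x ^ 2 * b x := hη.sq.mul_right hb
  have hb2 : Continuous fun x => b x ^ 2 := hb.continuous.pow 2
  rw [integral_mul_lap h2 hb, sub_neg_eq_add,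
    ← integral_finsetSum _ fun i _ => (h2.pd i).integrable_mul (contDiff_pd hb i).continuous,
    ← integral_add (hη.gradSq.integrable_mul hb2)
      (integrable_finsetSum _ fun i _ => (h2.pd i).integrable_mul (contDiff_pd hb i).continuous)]
  congr 1
  ext x
  simp only [gradSq, pd_mul hη.smooth hb, pd_mul hη.sq.smooth hb, pd_sq hη.smooth, Fin.sum_univ_four]
  ring

/-- Localised second-order energy estimate for the gradient. -/
lemma sum_integral_gradSq_mul_pd_le {u η : Eu 4 → ℝ} (hu : ContDiff ℝ ∞ u) (hη : IsTest η) :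
    ∑ i, ∫ x, gradSq (fun x => η x * pd i u x) x ≤
      2 * (∫ x, gradSq η x * gradSq u x) + 2 * ∫ x, η x ^ 2 * lap u x ^ 2 := by
  have hb := fun i => contDiff_pd hu i
  have hl := contDiff_lap hu
  have h2 : ∀ i, IsTest fun x => η x ^ 2 * pd i u x := fun i => hη.sq.mul_right (hb i)
  have hb2 : ∀ i, Continuous fun x => pd i u x ^ 2 := fun i => (hb i).continuous.pow 2
  have hl2 : Continuous fun x => lap u x ^ 2 := hl.continuous.pow 2
  have hI1 := hη.gradSq.integrable_mul (contDiff_gradSq hu).continuous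
  have hI2 := hη.sq.integrable_mul hl2
  have h3 : ∀ i, Integrable fun x => pd i (fun x => η x ^ 2 * pd i u x) x * lap u x := fun i =>
    ((h2 i).pd i).integrable_mul hl.continuous
  simp only [fun i => integral_gradSq_mul_eq hη (hb i), lap_pd hu,
    fun i => integral_mul_pd (h2 i) hl i, sub_neg_eq_add, Finset.sum_add_distrib]
  rw [← integral_finsetSum _ fun i _ => hη.gradSq.integrable_mul (hb2 i),
    ← integral_finsetSum _ fun i _ => h3 i]
  have e1 : (fun x => ∑ i, gradSq η x * pd i u x ^ 2) = fun x => gradSq η x * gradSq u x := by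
    ext x
    rw [← Finset.mul_sum, gradSq.eq_def u]
  rw [e1]
  have : ∫ x, ∑ i, pd i (fun x => η x ^ 2 * pd i u x) x * lap u x ≤
      ∫ x, gradSq η x * gradSq u x + 2 * (η x ^ 2 * lap u x ^ 2) := by
    refine integral_mono (integrable_finsetSum _ fun i _ => h3 i)
      (hI1.add (hI2.const_mul 2)) fun x => ?_
    show ∑ i, pd i (fun x => η x ^ 2 * pd i u x) x * lap u x ≤
      gradSq η x * gradSq u x + 2 * (η x ^ 2 * lap u x ^ 2)
    have e2 : ∑ i, pd i (fun x => η x ^ 2 * pd i u x) x * lap u x =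
        2 * (η x * lap u x) * (∑ i, pd i η x * pd i u x) + η x ^ 2 * lap u x ^ 2 := by
      rw [lap_eq hu]
      simp only [pd_mul hη.sq.smooth (hb _), pd_sq hη.smooth, Fin.sum_univ_four]
      ring
    have cs := Finset.sum_mul_sq_le_sq_mul_sq Finset.univ (fun i => pd i η x) fun i => pd i u x
    rw [e2]
    simp only [gradSq]
    nlinarith [sq_nonneg (η x * lap u x - ∑ i, pd i η x * pd i u x)]
  rw [integral_add hI1 (hI2.const_mul 2), integral_const_mul] at this
  linarith

lemma integrable_newt_mul {f : Eu 4 → ℝ} (hf : Continuous f) (hfi : Integrable f) (i : Fin 4)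
    (x : Eu 4) : Integrable fun y => newt i (x - y) * f y := by
  refine (integrable_inv_dist_mul hf hfi x).mono
    (((measurable_newt i).comp (measurable_id.const_sub x)).aestronglyMeasurable.mul
      hf.aestronglyMeasurable) (Eventually.of_forall fun y => ?_)
  rw [norm_mul, norm_mul, Real.norm_eq_abs, Real.norm_of_nonneg (by positivity : 0 ≤ ‖x - y‖⁻¹)]
  exact mul_le_mul_of_nonneg_right (abs_newt_le i _) (norm_nonneg _)

/-- A small-potential estimate: where the far mass of `f` is small, the localised gradient energy
is controlled by the Caccioppoli term and the `L²` norm of `confLap u`. -/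
lemma sum_integral_gradSq_le_of_farMass {u f η : Eu 4 → ℝ} (hu : ContDiff ℝ ∞ u) (hf : Continuous f)
    (hfi : Integrable f) (hb : ∀ i x, pd i u x = ∫ y, newt i (x - y) * f y)
    (hm : ∫ y, f y = 0) (hE : Integrable fun x => confLap u x ^ 2) {R : ℝ} (hR : 0 < R)
    (hsmall : 128 * farMass f R ^ 2 ≤ 1) (hη : IsTest η) (hη1 : ∀ x, |η x| ≤ 1)
    (hη0 : ∀ x, ‖x‖ < R → η x = 0) :
    ∑ i, ∫ x, gradSq (fun x => η x * pd i u x) x ≤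
      4 * (∫ x, gradSq η x * gradSq u x) + 8 * ∫ x, confLap u x ^ 2 := by
  have hbs := fun i => contDiff_pd hu i
  set X := ∑ i, ∫ x, gradSq (fun x => η x * pd i u x) x with hX
  have hB : ∀ i, IsTest fun x => η x * pd i u x := fun i => hη.mul_right (hbs i)
  set k : Eu 4 → ℝ := fun x => η x ^ 2 * gradSq u x with hk
  have hkt : IsTest k := hη.sq.mul_right (contDiff_gradSq hu)
  have hksum : ∀ y x, k x * (‖x - y‖ ^ 2)⁻¹ =
      ∑ i, (η x * pd i u x) ^ 2 * (‖x - y‖ ^ 2)⁻¹ := by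
    intro y x
    rw [← Finset.sum_mul]
    simp only [hk, gradSq, mul_pow, Finset.mul_sum]
  have hA : ∀ y, Integrable (fun x => k x * (‖x - y‖ ^ 2)⁻¹) ∧
      ∫ x, k x * (‖x - y‖ ^ 2)⁻¹ ≤ X := by
    intro y
    refine ⟨hkt.integrable_mul_inv_dist_sq y, ?_⟩
    simp only [hksum]
    rw [integral_finsetSum _ fun i _ => (hB i).sq.integrable_mul_inv_dist_sq y]
    exact Finset.sum_le_sum fun i _ => integral_sq_mul_inv_dist_sq_le (hB i) y
  have hq := fun i => integral_weight_mul_sq_le hf hfi hR hkt.continuous.measurable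
    (fun x => mul_nonneg (sq_nonneg _) (gradSq_nonneg u x))
    (fun x hx => by simp [hk, hη0 x hx]) hA i (hbs i).continuous.measurable (fun x _ => by
      rw [hb]
      simp only [sub_mul]
      rw [integral_sub (integrable_newt_mul hf hfi i x) (hfi.const_mul _), integral_const_mul, hm,
        mul_zero, sub_zero])
  have hfour : ∫ x, k x * gradSq u x ≤ 16 * farMass f R ^ 2 * X := by
    have e : (fun x => k x * gradSq u x) = fun x => ∑ i, k x * pd i u x ^ 2 := by
      ext x
      rw [← Finset.mul_sum, gradSq.eq_def u]
    rw [e, integral_finsetSum _ fun i _ => (hq i).1]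
    refine (Finset.sum_le_sum fun i _ => (hq i).2).trans_eq ?_
    simp
    ring
  have hmain := sum_integral_gradSq_mul_pd_le hu hη
  have hkg : Integrable fun x => k x * gradSq u x :=
    hkt.integrable_mul (contDiff_gradSq hu).continuous
  have hl2 : Continuous fun x => lap u x ^ 2 := (contDiff_lap hu).continuous.pow 2
  have hlap : ∫ x, η x ^ 2 * lap u x ^ 2 ≤ ∫ x, 2 * confLap u x ^ 2 + 2 * (k x * gradSq u x) := by
    refine integral_mono (hη.sq.integrable_mul hl2)
      ((hE.const_mul 2).add (hkg.const_mul 2)) fun x => ?_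
    have h1 : η x ^ 2 ≤ 1 := by
      rw [← sq_abs]
      exact pow_le_one₀ (abs_nonneg _) (hη1 x)
    show η x ^ 2 * lap u x ^ 2 ≤ 2 * confLap u x ^ 2 + 2 * (k x * gradSq u x)
    have h2 : lap u x = confLap u x - gradSq u x := by rw [confLap]; ring
    have h3 : lap u x ^ 2 ≤ 2 * confLap u x ^ 2 + 2 * gradSq u x ^ 2 := by
      rw [h2]
      nlinarith [sq_nonneg (confLap u x + gradSq u x)]
    have h4 := mul_le_mul_of_nonneg_left h3 (sq_nonneg (η x))
    have h5 := mul_le_mul_of_nonneg_right h1 (sq_nonneg (confLap u x))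
    simp only [hk]
    linarith
  rw [integral_add (hE.const_mul 2) (hkg.const_mul 2), integral_const_mul, integral_const_mul]
    at hlap
  have hX0 : 0 ≤ X := Finset.sum_nonneg fun i _ => integral_nonneg fun x => gradSq_nonneg _ x
  have := mul_le_mul_of_nonneg_right hsmall hX0
  linarith

lemma exists_gradSq_rescale_cutoff_le {u : Eu 4 → ℝ} (hu : ContDiff ℝ ∞ u) {C : ℝ}
    (hC : ∀ p r, 0 < r → ∫ y in ball p r, gradSq u y ≤ C * r ^ 2) :
    ∃ K, ∀ r, 0 < r → ∫ x, gradSq (rescale cutoff 0 r) x * gradSq u x ≤ K := by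
  obtain ⟨M, hM0, hM⟩ := isTest_cutoff.gradSq.exists_bound
  refine ⟨M * (C * 9), fun r hr => ?_⟩
  have hg := (contDiff_gradSq hu).continuous
  have h0 : ∀ x, x ∉ ball (0 : Eu 4) (3 * r) → gradSq (rescale cutoff 0 r) x * gradSq u x = 0 := by
    intro x hx
    rw [mem_ball_zero_iff, not_lt] at hx
    have hz : rescale cutoff 0 r =ᶠ[𝓝 x] fun _ => 0 := by
      filter_upwards [(isOpen_lt continuous_const continuous_norm).mem_nhds
        (show 2 * r < ‖x‖ by linarith)] with y hy
      refine cutoff_eq_zero ?_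
      rw [zero_sub, smul_neg, norm_neg, norm_smul, norm_inv, Real.norm_of_nonneg hr.le,
        inv_mul_eq_div, le_div_iff₀ hr]
      exact le_of_lt hy
    have : gradSq (rescale cutoff 0 r) x = 0 := by
      simp [gradSq, pd, hz.fderiv_eq]
    rw [this, zero_mul]
  rw [← setIntegral_eq_integral_of_forall_compl_eq_zero h0]
  have hi := (isTest_cutoff.rescale 0 hr).gradSq.integrable_mul hg
  calc ∫ x in ball 0 (3 * r), gradSq (rescale cutoff 0 r) x * gradSq u x
      ≤ ∫ x in ball 0 (3 * r), (r⁻¹ ^ 2 * M) * gradSq u x := by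
        refine setIntegral_mono hi.integrableOn ((integrableOn_ball hg _ _).const_mul _) fun x => ?_
        rw [gradSq_rescale isTest_cutoff.smooth]
        refine mul_le_mul_of_nonneg_right (mul_le_mul_of_nonneg_left ?_ (by positivity))
          (gradSq_nonneg u x)
        exact (le_abs_self _).trans (hM _)
    _ ≤ (r⁻¹ ^ 2 * M) * (C * (3 * r) ^ 2) := by
        rw [integral_const_mul]
        exact mul_le_mul_of_nonneg_left (hC _ _ (by positivity)) (by positivity)
    _ = M * (C * 9) := by
        field_simp
        ring

lemma integrableOn_gradSq_mul_inv_dist_sq {u : Eu 4 → ℝ} (hu : ContDiff ℝ ∞ u) (p : Eu 4) {r : ℝ}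
    (hr : 0 < r) : IntegrableOn (fun x => gradSq u x * (‖p - x‖ ^ 2)⁻¹) (ball p r) := by
  have h := ((isTest_cutoff.rescale p hr).mul_left
    (contDiff_gradSq hu)).integrable_mul_inv_dist_sq p
  refine h.integrableOn.congr_fun (fun x hx => ?_) measurableSet_ball
  have : rescale cutoff p r x = 1 := by
    refine cutoff_eq_one ?_
    rw [mem_ball, dist_eq_norm, norm_sub_rev] at hx
    rw [norm_smul, norm_inv, Real.norm_of_nonneg hr.le, inv_mul_eq_div, div_le_one hr]
    exact hx.le
  simp only [this, mul_one, norm_sub_rev x p]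

/-- The gradient of `u` satisfies a uniform Hardy-type bound. -/
theorem exists_gradSq_inv_dist_sq_le {u f : Eu 4 → ℝ} (hu : ContDiff ℝ ∞ u) (hf : Continuous f)
    (hfi : Integrable f) (hb : ∀ i x, pd i u x = ∫ y, newt i (x - y) * f y)
    (hm : ∫ y, f y = 0) (hE : Integrable fun x => confLap u x ^ 2) {C : ℝ}
    (hC : ∀ p r, 0 < r → ∫ y in ball p r, gradSq u y ≤ C * r ^ 2) :
    ∃ D, 0 ≤ D ∧ ∀ p r, 0 < r → ∫ x in ball p r, gradSq u x * (‖p - x‖ ^ 2)⁻¹ ≤ D := by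
  obtain ⟨K, hK⟩ := exists_gradSq_rescale_cutoff_le hu hC
  have hg := (contDiff_gradSq hu).continuous
  obtain ⟨R, hR, hsmall⟩ : ∃ R, 0 < R ∧ 128 * farMass f R ^ 2 ≤ 1 := by
    have h := ((tendsto_farMass hfi).pow 2).const_mul 128
    have h' : ∀ᶠ R in atTop, 128 * farMass f R ^ 2 < 1 := h.eventually_lt_const (by norm_num)
    obtain ⟨R, h1, h2⟩ := (h'.and (eventually_gt_atTop 0)).exists
    exact ⟨R, h2, h1.le⟩
  obtain ⟨M, hM⟩ := (isCompact_closedBall (0 : Eu 4) (2 * R)).exists_bound_of_continuousOn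
    hg.continuousOn
  set E := ∫ x, confLap u x ^ 2
  have hbound : ∀ p r, 0 < r → ∫ x in ball p r, gradSq u x * (‖p - x‖ ^ 2)⁻¹ ≤
      (4 * (4 * K) + 8 * E) + |M| * (2 * Real.pi ^ 2 * (2 * R) ^ 2) := by
    intro p r hr
    set ρ := ‖p‖ + r + R with hρ
    have hρ0 : 0 < ρ := by positivity
    set η : Eu 4 → ℝ := fun x => rescale cutoff 0 ρ x - rescale cutoff 0 R x with hηd
    have t1 := isTest_cutoff.rescale 0 hρ0
    have t2 := isTest_cutoff.rescale 0 hR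
    have hη : IsTest η := ⟨t1.smooth.sub t2.smooth, t1.compact.sub t2.compact⟩
    have hone : ∀ s x, 0 < s → ‖x‖ ≤ s → rescale cutoff 0 s x = 1 := by
      intro s x hs hx
      refine cutoff_eq_one ?_
      rw [zero_sub, smul_neg, norm_neg, norm_smul, norm_inv, Real.norm_of_nonneg hs.le,
        inv_mul_eq_div, div_le_one hs]
      exact hx
    have hzer : ∀ s x, 0 < s → 2 * s ≤ ‖x‖ → rescale cutoff 0 s x = 0 := by
      intro s x hs hx
      refine cutoff_eq_zero ?_
      rw [zero_sub, smul_neg, norm_neg, norm_smul, norm_inv, Real.norm_of_nonneg hs.le,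
        inv_mul_eq_div, le_div_iff₀ hs]
      exact hx
    have hη1 : ∀ x, |η x| ≤ 1 := by
      intro x
      have a1 : 0 ≤ rescale cutoff 0 ρ x := cutoff_nonneg _
      have a2 : rescale cutoff 0 ρ x ≤ 1 := cutoff_le_one _
      have a3 : 0 ≤ rescale cutoff 0 R x := cutoff_nonneg _
      have a4 : rescale cutoff 0 R x ≤ 1 := cutoff_le_one _
      rw [abs_le]
      constructor <;> simp only [hηd] <;> linarith
    have hη0 : ∀ x, ‖x‖ < R → η x = 0 := by
      intro x hx
      have : ‖x‖ ≤ ρ := by rw [hρ]; linarith [norm_nonneg p]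
      simp only [hηd, hone ρ x hρ0 this, hone R x hR hx.le, sub_self]
    have hX := sum_integral_gradSq_le_of_farMass hu hf hfi hb hm hE hR hsmall hη hη1 hη0
    have hG : ∫ x, gradSq η x * gradSq u x ≤ 4 * K := by
      have i1 := t1.gradSq.integrable_mul hg
      have i2 := t2.gradSq.integrable_mul hg
      have : ∫ x, gradSq η x * gradSq u x ≤ ∫ x, 2 * (gradSq (rescale cutoff 0 ρ) x * gradSq u x) +
          2 * (gradSq (rescale cutoff 0 R) x * gradSq u x) := by
        refine integral_mono (hη.gradSq.integrable_mul hg)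
          ((i1.const_mul 2).add (i2.const_mul 2)) fun x => ?_
        show gradSq η x * gradSq u x ≤ 2 * (gradSq (rescale cutoff 0 ρ) x * gradSq u x) +
          2 * (gradSq (rescale cutoff 0 R) x * gradSq u x)
        have : gradSq η x ≤ 2 * gradSq (rescale cutoff 0 ρ) x + 2 * gradSq (rescale cutoff 0 R) x := by
          simp only [gradSq, hηd, pd_sub t1.smooth t2.smooth, Finset.mul_sum,
            ← Finset.sum_add_distrib]
          refine Finset.sum_le_sum fun i _ => ?_
          nlinarith [sq_nonneg (pd i (rescale cutoff 0 ρ) x + pd i (rescale cutoff 0 R) x)]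
        nlinarith [gradSq_nonneg u x]
      rw [integral_add (i1.const_mul 2) (i2.const_mul 2), integral_const_mul, integral_const_mul]
        at this
      linarith [hK ρ hρ0, hK R hR]
    have hB : ∀ i, IsTest fun x => η x * pd i u x := fun i => hη.mul_right (contDiff_pd hu i)
    have hkt : IsTest fun x => η x ^ 2 * gradSq u x := hη.sq.mul_right (contDiff_gradSq hu)
    have hhardy : ∫ x, (η x ^ 2 * gradSq u x) * (‖x - p‖ ^ 2)⁻¹ ≤ 4 * (4 * K) + 8 * E := by
      have e : (fun x => (η x ^ 2 * gradSq u x) * (‖x - p‖ ^ 2)⁻¹) =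
          fun x => ∑ i, (η x * pd i u x) ^ 2 * (‖x - p‖ ^ 2)⁻¹ := by
        ext x
        rw [← Finset.sum_mul]
        simp only [gradSq, mul_pow, Finset.mul_sum]
      rw [e, integral_finsetSum _ fun i _ => (hB i).sq.integrable_mul_inv_dist_sq p]
      have := Finset.sum_le_sum fun i (_ : i ∈ Finset.univ) =>
        integral_sq_mul_inv_dist_sq_le (hB i) p
      linarith
    have i1 := hkt.integrable_mul_inv_dist_sq p
    have i2 : Integrable ((ball (0 : Eu 4) (2 * R)).indicator
        fun x => |M| * (‖p - x‖ ^ 2)⁻¹) := by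
      rw [integrable_indicator_iff measurableSet_ball]
      exact (integrableOn_ball_inv_dist_sq p 0 (2 * R)).const_mul _
    have i0 : IntegrableOn (fun x => gradSq u x * (‖p - x‖ ^ 2)⁻¹) (ball p r) :=
      integrableOn_gradSq_mul_inv_dist_sq hu p hr
    have hle : ∫ x in ball p r, gradSq u x * (‖p - x‖ ^ 2)⁻¹ ≤
        ∫ x, (η x ^ 2 * gradSq u x) * (‖x - p‖ ^ 2)⁻¹ +
          (ball (0 : Eu 4) (2 * R)).indicator (fun x => |M| * (‖p - x‖ ^ 2)⁻¹) x := by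
      refine setIntegral_le_integral_of_le measurableSet_ball i0 (i1.add i2) (fun x => ?_)
        fun x hx => ?_
      · exact add_nonneg (mul_nonneg (mul_nonneg (sq_nonneg _) (gradSq_nonneg u x)) (by positivity))
          (indicator_nonneg (fun y _ => by positivity) _)
      · rw [norm_sub_rev p x]
        by_cases hx2 : x ∈ ball (0 : Eu 4) (2 * R)
        · rw [indicator_of_mem hx2, norm_sub_rev p x]
          have := (le_abs_self _).trans ((hM x (ball_subset_closedBall hx2)).trans (le_abs_self M))
          have h2 := mul_le_mul_of_nonneg_right this (by positivity : 0 ≤ (‖x - p‖ ^ 2)⁻¹)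
          have h3 : 0 ≤ η x ^ 2 * gradSq u x * (‖x - p‖ ^ 2)⁻¹ :=
            mul_nonneg (mul_nonneg (sq_nonneg _) (gradSq_nonneg u x)) (by positivity)
          linarith
        · rw [indicator_of_notMem hx2, add_zero]
          rw [mem_ball_zero_iff, not_lt] at hx2
          have hxρ : ‖x‖ ≤ ρ := by
            have h1 : ‖x - p‖ < r := by rwa [mem_ball, dist_eq_norm] at hx
            have h2 := norm_add_le (x - p) p
            rw [sub_add_cancel] at h2
            rw [hρ]
            linarith
          have : η x = 1 := by simp only [hηd, hone ρ x hρ0 hxρ, hzer R x hR hx2, sub_zero]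
          rw [this, one_pow, one_mul]
    rw [integral_add i1 i2, integral_indicator measurableSet_ball, integral_const_mul] at hle
    have h5 := mul_le_mul_of_nonneg_left (setIntegral_inv_dist_sq_le p 0 (by positivity : 0 < 2 * R))
      (abs_nonneg M)
    linarith
  exact ⟨_, le_max_left 0 _, fun p r hr => (hbound p r hr).trans (le_max_right _ _)⟩

section Conv

variable {V : Type*} [NormedAddCommGroup V]

lemma exists_norm_bound {κ : Eu 4 → V} (hκ : Continuous κ) (hc : HasCompactSupport κ) :
    ∃ C, 0 ≤ C ∧ ∀ z, ‖κ z‖ ≤ C := by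
  obtain ⟨C, hC⟩ := hc.exists_bound_of_continuous hκ
  exact ⟨|C|, abs_nonneg C, fun z => (hC z).trans (le_abs_self C)⟩

variable [NormedSpace ℝ V]

/-- Convolution of `g` against the kernel `κ` at scale `r`. -/
def conv (κ : Eu 4 → V) (g : Eu 4 → ℝ) (r : ℝ) (x : Eu 4) : V := ∫ y, g y • κ (r⁻¹ • (x - y))

lemma integrable_conv {κ : Eu 4 → V} (hκ : Continuous κ) (hc : HasCompactSupport κ) {g : Eu 4 → ℝ}
    (hg : Continuous g) (hgi : Integrable g) (r : ℝ) (x : Eu 4) :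
    Integrable fun y => g y • κ (r⁻¹ • (x - y)) := by
  obtain ⟨C, _, hC⟩ := exists_norm_bound hκ hc
  refine (hgi.norm.mul_const C).mono' (by fun_prop) (Eventually.of_forall fun y => ?_)
  rw [norm_smul]
  exact mul_le_mul_of_nonneg_left (hC _) (norm_nonneg _)

lemma hasFDerivAt_conv {κ : Eu 4 → V} (hκ : ContDiff ℝ ∞ κ) (hc : HasCompactSupport κ)
    {g : Eu 4 → ℝ} (hg : Continuous g) (hgi : Integrable g) (r : ℝ) (x : Eu 4) :
    HasFDerivAt (conv κ g r) (r⁻¹ • conv (fderiv ℝ κ) g r x) x := by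
  have hκ' : Continuous (fderiv ℝ κ) := hκ.continuous_fderiv (by simp)
  obtain ⟨C, hC0, hC⟩ := exists_norm_bound hκ' (hc.fderiv ℝ)
  have hk := hκ.continuous
  have h := hasFDerivAt_integral_of_dominated_of_fderiv_le (𝕜 := ℝ) (μ := volume) (s := univ)
    (x₀ := x) (F := fun x y => g y • κ (r⁻¹ • (x - y)))
    (F' := fun x y => g y • r⁻¹ • fderiv ℝ κ (r⁻¹ • (x - y)))
    (bound := fun y => |g y| * (|r⁻¹| * C)) univ_mem
    (Eventually.of_forall fun z => (by fun_prop)) (integrable_conv hκ.continuous hc hg hgi r x)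
    (by fun_prop) (Eventually.of_forall fun y z _ => ?_) (hgi.abs.mul_const _)
    (Eventually.of_forall fun y z _ => ?_)
  · have e : (∫ y, g y • r⁻¹ • fderiv ℝ κ (r⁻¹ • (x - y))) = r⁻¹ • conv (fderiv ℝ κ) g r x := by
      rw [conv, ← integral_smul]
      congr 1
      ext1 y
      rw [smul_comm]
    rw [← e]
    exact h
  · rw [norm_smul, norm_smul]
    exact mul_le_mul_of_nonneg_left (mul_le_mul_of_nonneg_left (hC _) (norm_nonneg _))
      (norm_nonneg _)
  · have h1 : HasFDerivAt κ (fderiv ℝ κ (r⁻¹ • (z - y))) (r⁻¹ • (z - y)) :=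
      ((hκ.differentiable (by simp)) _).hasFDerivAt
    have h2 : HasFDerivAt (fun x : Eu 4 => r⁻¹ • (x - y))
        (r⁻¹ • ContinuousLinearMap.id ℝ (Eu 4)) z := ((hasFDerivAt_id z).sub_const y).const_smul r⁻¹
    have h3 := (h1.comp z h2).const_smul (g y)
    have e : (fderiv ℝ κ (r⁻¹ • (z - y))).comp (r⁻¹ • ContinuousLinearMap.id ℝ (Eu 4)) =
        r⁻¹ • fderiv ℝ κ (r⁻¹ • (z - y)) := by
      ext w
      simp
    rw [e] at h3
    exact h3

/-- The convolution is controlled by the mass of `g` on the rescaled support of the kernel. -/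
lemma norm_conv_le {κ : Eu 4 → V} {C : ℝ} (hC : ∀ z, ‖κ z‖ ≤ C) {S : Set (Eu 4)}
    (hS : MeasurableSet S) {r : ℝ} {x : Eu 4} (h0 : ∀ y, y ∉ S → κ (r⁻¹ • (x - y)) = 0)
    {g : Eu 4 → ℝ} (hgi : Integrable g) :
    ‖conv κ g r x‖ ≤ C * ∫ y in S, |g y| := by
  have hC0 : 0 ≤ C := (norm_nonneg _).trans (hC 0)
  rw [conv, ← integral_const_mul, ← integral_indicator hS]
  refine norm_integral_le_of_norm_le ?_ (Eventually.of_forall fun y => ?_)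
  · exact (integrable_indicator_iff hS).2 (hgi.abs.const_mul C).integrableOn
  · by_cases hy : y ∈ S
    · rw [indicator_of_mem hy, norm_smul, mul_comm, Real.norm_eq_abs]
      exact mul_le_mul_of_nonneg_right (hC _) (abs_nonneg _)
    · rw [indicator_of_notMem hy, h0 y hy, smul_zero, norm_zero]

end Conv

lemma conv_eq_rescale (κ g : Eu 4 → ℝ) (r : ℝ) (x : Eu 4) :
    conv κ g r x = ∫ y, rescale κ x r y * g y := by
  simp only [conv, rescale, smul_eq_mul, mul_comm]

/-- The difference of logarithmic kernels at consecutive scales `1` and `l`. -/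
def stepKer (l : ℝ) (z : Eu 4) : ℝ := logKernel (l⁻¹ • z) + Real.log l - logKernel z

/-- The vector kernel of a step of the flow. -/
def vecKer (l : ℝ) (z : Eu 4) : Eu 4 := stepKer l z • z

lemma contDiff_stepKer (l : ℝ) : ContDiff ℝ ∞ (stepKer l) :=
  ((contDiff_logKernel.comp (contDiff_const_smul l⁻¹)).add contDiff_const).sub contDiff_logKernel

lemma contDiff_vecKer (l : ℝ) : ContDiff ℝ ∞ (vecKer l) := (contDiff_stepKer l).smul contDiff_id

lemma stepKer_eq_zero {l : ℝ} (h1 : 1 ≤ l) (h2 : l ≤ 2) {z : Eu 4} (hz : 2 ≤ ‖z‖) :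
    stepKer l z = 0 := by
  have hl : 0 < l := by linarith
  have hn : ‖l⁻¹ • z‖ = ‖z‖ / l := by
    rw [norm_smul, norm_inv, Real.norm_of_nonneg hl.le, inv_mul_eq_div]
  have h3 : 1 ≤ ‖l⁻¹ • z‖ := by
    rw [hn, le_div_iff₀ hl]
    linarith
  rw [stepKer, logKernel_of_ge h3, logKernel_of_ge (by linarith), hn,
    Real.log_div (by linarith) hl.ne']
  ring

lemma stepKer_eq_log {l : ℝ} (h1 : 1 ≤ l) {z : Eu 4} (hz : ‖z‖ ≤ 1 / 2) :
    stepKer l z = Real.log l := by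
  have hl : 0 < l := by linarith
  have h3 : ‖l⁻¹ • z‖ ≤ 1 / 2 := by
    rw [norm_smul, norm_inv, Real.norm_of_nonneg hl.le, inv_mul_eq_div]
    exact (div_le_self (norm_nonneg z) h1).trans hz
  rw [stepKer, logKernel_of_le h3, logKernel_of_le hz]
  ring

lemma isTest_stepKer {l : ℝ} (h1 : 1 ≤ l) (h2 : l ≤ 2) : IsTest (stepKer l) :=
  isTest_of_support (contDiff_stepKer l) fun _ hx => stepKer_eq_zero h1 h2 hx.le

lemma hasCompactSupport_vecKer {l : ℝ} (h1 : 1 ≤ l) (h2 : l ≤ 2) :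
    HasCompactSupport (vecKer l) := (isTest_stepKer h1 h2).compact.smul_right

lemma fderiv_vecKer (l : ℝ) (z : Eu 4) : fderiv ℝ (vecKer l) z =
    stepKer l z • ContinuousLinearMap.id ℝ (Eu 4) + (fderiv ℝ (stepKer l) z).smulRight z :=
  (((contDiff_stepKer l).differentiable (by simp) z).hasFDerivAt.smul (hasFDerivAt_id z)).fderiv

lemma fderiv_stepKer_eq_zero {l : ℝ} (h1 : 1 ≤ l) (h2 : l ≤ 2) {z : Eu 4}
    (hz : ‖z‖ < 1 / 2 ∨ 2 < ‖z‖) : fderiv ℝ (stepKer l) z = 0 := by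
  rcases hz with hz | hz
  · have : stepKer l =ᶠ[𝓝 z] fun _ => Real.log l := by
      filter_upwards [(isOpen_lt continuous_norm continuous_const).mem_nhds hz] with y hy
      exact stepKer_eq_log h1 (le_of_lt hy)
    rw [this.fderiv_eq]
    simp
  · have : stepKer l =ᶠ[𝓝 z] fun _ => 0 := by
      filter_upwards [(isOpen_lt continuous_const continuous_norm).mem_nhds hz] with y hy
      exact stepKer_eq_zero h1 h2 (le_of_lt hy)
    rw [this.fderiv_eq]
    simp

/-- For ratios close to one the step kernel and the derivative of its vector version are small. -/
lemma exists_stepKer_small {ε : ℝ} (hε : 0 < ε) :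
    ∃ l : ℝ, 1 < l ∧ l ≤ 2 ∧ ∀ z, |stepKer l z| ≤ ε ∧ ‖fderiv ℝ (vecKer l) z‖ ≤ ε := by
  have hL := contDiff_logKernel
  have hL' : Continuous (fderiv ℝ logKernel) := hL.continuous_fderiv (by simp)
  have hd : ∀ l z, fderiv ℝ (stepKer l) z =
      l⁻¹ • fderiv ℝ logKernel (l⁻¹ • z) - fderiv ℝ logKernel z := by
    intro l z
    have h1 : HasFDerivAt logKernel (fderiv ℝ logKernel (l⁻¹ • z)) (l⁻¹ • z) :=
      ((hL.differentiable (by simp)) _).hasFDerivAt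
    have h2 : HasFDerivAt (fun x : Eu 4 => l⁻¹ • x)
        (l⁻¹ • ContinuousLinearMap.id ℝ (Eu 4)) z := (hasFDerivAt_id z).const_smul l⁻¹
    have h3 := ((h1.comp z h2).add_const (Real.log l)).sub
      ((hL.differentiable (by simp)) z).hasFDerivAt
    have e : (fderiv ℝ logKernel (l⁻¹ • z)).comp (l⁻¹ • ContinuousLinearMap.id ℝ (Eu 4)) =
        l⁻¹ • fderiv ℝ logKernel (l⁻¹ • z) := by
      ext w
      simp
    rw [e] at h3
    exact h3.fderiv
  have hev : ∀ᶠ l in 𝓝 (1 : ℝ), ∀ z ∈ closedBall (0 : Eu 4) 2,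
      |stepKer l z| + ‖l⁻¹ • fderiv ℝ logKernel (l⁻¹ • z) - fderiv ℝ logKernel z‖ * ‖z‖ < ε := by
    refine (isCompact_closedBall _ _).eventually_forall_of_forall_eventually fun y _ => ?_
    have hi : ContinuousAt (fun q : ℝ × Eu 4 => q.1⁻¹) (1, y) :=
      continuousAt_fst.inv₀ (by simp)
    have hiz : ContinuousAt (fun q : ℝ × Eu 4 => q.1⁻¹ • q.2) (1, y) := hi.smul continuousAt_snd
    have hlog : ContinuousAt (fun q : ℝ × Eu 4 => Real.log q.1) (1, y) :=
      continuousAt_fst.log (by simp)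
    have c1 : ContinuousAt (fun q : ℝ × Eu 4 => stepKer q.1 q.2) (1, y) :=
      ((hL.continuous.continuousAt.comp hiz).add hlog).sub
        (hL.continuous.continuousAt.comp continuousAt_snd)
    have c2 : ContinuousAt (fun q : ℝ × Eu 4 =>
        q.1⁻¹ • fderiv ℝ logKernel (q.1⁻¹ • q.2) - fderiv ℝ logKernel q.2) (1, y) :=
      (hi.smul (hL'.continuousAt.comp hiz)).sub (hL'.continuousAt.comp continuousAt_snd)
    have c3 := c1.abs.add (c2.norm.mul (continuousAt_snd (p := ((1 : ℝ), y))).norm)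
    refine c3.tendsto.eventually_lt_const ?_
    simpa [stepKer] using hε
  have hgt : ∀ᶠ l in 𝓝[>] (1 : ℝ), 1 < l := self_mem_nhdsWithin
  have hle : ∀ᶠ l in 𝓝[>] (1 : ℝ), l ≤ 2 :=
    nhdsWithin_le_nhds (eventually_le_nhds (by norm_num))
  obtain ⟨l, hl, hl1, hl2⟩ :=
    ((hev.filter_mono nhdsWithin_le_nhds).and (hgt.and hle) :
      ∀ᶠ l in 𝓝[>] (1 : ℝ), _).exists
  refine ⟨l, hl1, hl2, fun z => ?_⟩
  rcases le_or_gt ‖z‖ 2 with hz | hz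
  · have h := hl z (by simpa using hz)
    rw [← hd] at h
    have h0 : 0 ≤ ‖fderiv ℝ (stepKer l) z‖ * ‖z‖ := by positivity
    refine ⟨by linarith, ?_⟩
    rw [fderiv_vecKer]
    refine (norm_add_le _ _).trans ?_
    rw [norm_smul, ContinuousLinearMap.norm_smulRight_apply, ContinuousLinearMap.norm_id, mul_one,
      Real.norm_eq_abs]
    exact h.le
  · have e : fderiv ℝ (vecKer l) z = 0 := by
      rw [fderiv_vecKer, fderiv_stepKer_eq_zero hl1.le hl2 (Or.inr hz),
        stepKer_eq_zero hl1.le hl2 hz.le]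
      ext1 w
      simp
    rw [e, stepKer_eq_zero hl1.le hl2 hz.le]
    simp [hε.le]

lemma sum_inv_sq_indicator_le {l : ℝ} (hl : 1 < l) (J : ℕ) {ρ t : ℝ} (hρ : 0 < ρ) :
    ∑ j ∈ Finset.range J, (if t < ρ * l ^ j then ((ρ * l ^ j) ^ 2)⁻¹ else 0) ≤
      (1 - (l ^ 2)⁻¹)⁻¹ * ((max t ρ) ^ 2)⁻¹ := by
  have hl2 : (l ^ 2)⁻¹ < 1 := inv_lt_one_of_one_lt₀ (by nlinarith)
  have hK : 0 < (1 - (l ^ 2)⁻¹)⁻¹ := inv_pos.2 (by linarith)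
  induction J generalizing ρ with
  | zero => simpa using by positivity
  | succ J ih =>
    have h := ih (ρ := ρ * l) (by positivity)
    rw [Finset.sum_range_succ']
    have e : ∀ j : ℕ, ρ * l ^ (j + 1) = ρ * l * l ^ j := fun j => by ring
    simp only [e, pow_zero, mul_one]
    rcases lt_or_ge t ρ with ht | ht
    · have h1 : t < ρ * l := by nlinarith
      rw [max_eq_right h1.le] at h
      rw [if_pos ht, max_eq_right ht.le]
      refine (add_le_add_left h _).trans (le_of_eq ?_)
      have : 1 - (l ^ 2)⁻¹ ≠ 0 := by linarith
      have hl0 : l ≠ 0 := by linarith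
      have : l ^ 2 - 1 ≠ 0 := by nlinarith
      field_simp
      ring
    · rw [if_neg ht.not_gt, add_zero, max_eq_left ht]
      have h0 : 0 < t := hρ.trans_le ht
      refine h.trans (mul_le_mul_of_nonneg_left ?_ hK.le)
      gcongr
      exact le_max_left _ _

lemma sum_setIntegral_ball_le {h : Eu 4 → ℝ} (hc : Continuous h) (h0 : ∀ y, 0 ≤ h y) {p : Eu 4}
    {D : ℝ} (hi : ∀ r, 0 < r → IntegrableOn (fun y => h y * (‖p - y‖ ^ 2)⁻¹) (ball p r))
    (hD : ∀ r, 0 < r → ∫ y in ball p r, h y * (‖p - y‖ ^ 2)⁻¹ ≤ D) {l : ℝ} (hl : 1 < l) (J : ℕ)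
    {ρ : ℝ} (hρ : 0 < ρ) :
    ∑ j ∈ Finset.range J, ((ρ * l ^ j) ^ 2)⁻¹ * ∫ y in ball p (ρ * l ^ j), h y ≤
      (1 - (l ^ 2)⁻¹)⁻¹ * D := by
  have hl2 : (l ^ 2)⁻¹ < 1 := inv_lt_one_of_one_lt₀ (by nlinarith)
  have hK : 0 < (1 - (l ^ 2)⁻¹)⁻¹ := inv_pos.2 (by linarith)
  have hl0 : 0 < l := by linarith
  have hS : 0 < ρ * l ^ J := by positivity
  have hih : ∀ c r, IntegrableOn (fun y => (ball p r).indicator (fun y => c * h y) y)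
      (ball p (ρ * l ^ J)) := fun c r =>
    ((integrableOn_ball hc p _).const_mul c).indicator measurableSet_ball
  have e : ∀ j ∈ Finset.range J, ((ρ * l ^ j) ^ 2)⁻¹ * ∫ y in ball p (ρ * l ^ j), h y =
      ∫ y in ball p (ρ * l ^ J),
        (ball p (ρ * l ^ j)).indicator (fun y => ((ρ * l ^ j) ^ 2)⁻¹ * h y) y := by
    intro j hj
    rw [setIntegral_indicator measurableSet_ball, ← integral_const_mul,
      inter_eq_self_of_subset_right]
    refine ball_subset_ball (mul_le_mul_of_nonneg_left ?_ hρ.le)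
    exact pow_le_pow_right₀ hl.le (Finset.mem_range.1 hj).le
  rw [Finset.sum_congr rfl e, ← integral_finsetSum _ fun j _ => hih _ _]
  refine le_trans ?_ (mul_le_mul_of_nonneg_left (hD _ hS) hK.le)
  rw [← integral_const_mul]
  refine integral_mono_ae (integrable_finsetSum _ fun j _ => hih _ _)
    ((hi _ hS).const_mul _) ?_
  have hne : ∀ᵐ y ∂(volume.restrict (ball p (ρ * l ^ J))), y ≠ p :=
    ae_restrict_of_ae (Measure.ae_ne volume p)
  filter_upwards [hne] with y hy
  have hn : 0 < ‖p - y‖ := norm_pos_iff.2 (sub_ne_zero.2 hy.symm)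
  have e2 : ∀ j ∈ Finset.range J,
      (ball p (ρ * l ^ j)).indicator (fun y => ((ρ * l ^ j) ^ 2)⁻¹ * h y) y =
      (if ‖p - y‖ < ρ * l ^ j then ((ρ * l ^ j) ^ 2)⁻¹ else 0) * h y := by
    intro j _
    by_cases hy : ‖p - y‖ < ρ * l ^ j
    · rw [indicator_of_mem (by rwa [mem_ball', dist_eq_norm]), if_pos hy]
    · rw [indicator_of_notMem (by rwa [mem_ball', dist_eq_norm]), if_neg hy, zero_mul]
  rw [Finset.sum_congr rfl e2, ← Finset.sum_mul, mul_comm (h y), ← mul_assoc]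
  refine mul_le_mul_of_nonneg_right ((sum_inv_sq_indicator_le hl J hρ).trans ?_) (h0 y)
  gcongr
  exact le_max_left _ _

/-- The scale-invariant energy of `u` and of the mass density `g` in a ball. -/
def energy (u g : Eu 4 → ℝ) (p : Eu 4) (r : ℝ) : ℝ :=
  (r ^ 2)⁻¹ * ∫ y in ball p r, (gradSq u y + ‖p - y‖ ^ 2 * |g y|)

section Energy

variable {u g : Eu 4 → ℝ}

lemma energy_nonneg (p : Eu 4) (r : ℝ) : 0 ≤ energy u g p r :=
  mul_nonneg (by positivity) (setIntegral_nonneg measurableSet_ball fun y _ =>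
    add_nonneg (gradSq_nonneg u y) (by positivity))

lemma sum_energy_le (hu : ContDiff ℝ ∞ u) (hg : Continuous g) (hgi : Integrable g) {D : ℝ}
    (hD : ∀ p r, 0 < r → ∫ y in ball p r, gradSq u y * (‖p - y‖ ^ 2)⁻¹ ≤ D) {l : ℝ} (hl : 1 < l)
    (J : ℕ) {ρ : ℝ} (hρ : 0 < ρ) (p : Eu 4) :
    ∑ j ∈ Finset.range J, energy u g p (ρ * l ^ j) ≤
      (1 - (l ^ 2)⁻¹)⁻¹ * (D + ∫ y, |g y|) := by
  have hu' := (contDiff_gradSq hu).continuous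
  have ha : ∀ᵐ y : Eu 4, (gradSq u y + ‖p - y‖ ^ 2 * |g y|) * (‖p - y‖ ^ 2)⁻¹ =
      gradSq u y * (‖p - y‖ ^ 2)⁻¹ + |g y| := by
    filter_upwards [Measure.ae_ne volume p] with y hy
    have hn : ‖p - y‖ ≠ 0 := norm_ne_zero_iff.2 (sub_ne_zero.2 hy.symm)
    field_simp
  have hi : ∀ r, 0 < r → IntegrableOn (fun y => gradSq u y * (‖p - y‖ ^ 2)⁻¹ + |g y|)
      (ball p r) := fun r hr =>
    (integrableOn_gradSq_mul_inv_dist_sq hu p hr).add hgi.abs.integrableOn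
  refine sum_setIntegral_ball_le (by fun_prop)
    (fun y => add_nonneg (gradSq_nonneg u y) (by positivity)) (fun r hr => ?_)
    (fun r hr => ?_) hl J hρ
  · exact (hi r hr).congr (ae_restrict_of_ae (ha.mono fun _ h => h.symm))
  · rw [integral_congr_ae (ae_restrict_of_ae ha),
      integral_add (integrableOn_gradSq_mul_inv_dist_sq hu p hr) hgi.abs.integrableOn]
    exact add_le_add (hD p r hr) (setIntegral_le_integral hgi.abs
      (Eventually.of_forall fun y => abs_nonneg _))

lemma setIntegral_gradSq_le_energy (hu : ContDiff ℝ ∞ u) (hg : Continuous g) {p q : Eu 4}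
    {r s : ℝ} (hs : 0 < s) (h : ball q r ⊆ ball p s) :
    ∫ y in ball q r, gradSq u y ≤ s ^ 2 * energy u g p s := by
  have hu' := (contDiff_gradSq hu).continuous
  rw [energy, mul_inv_cancel_left₀ (by positivity)]
  refine (setIntegral_mono_set (integrableOn_ball hu' p s)
    (Eventually.of_forall fun y => gradSq_nonneg u y) (Eventually.of_forall h)).trans ?_
  refine setIntegral_mono (integrableOn_ball hu' p s) (integrableOn_ball (by fun_prop) p s)
    fun y => ?_
  have : 0 ≤ ‖p - y‖ ^ 2 * |g y| := by positivity
  linarith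

lemma setIntegral_abs_le_energy (hu : ContDiff ℝ ∞ u) (hg : Continuous g) {p : Eu 4}
    {t s : ℝ} (hs : 0 < s) (ht : 0 < t) {S : Set (Eu 4)} (hS : MeasurableSet S)
    (h : S ⊆ ball p s) (ht' : ∀ y ∈ S, t ≤ ‖p - y‖) :
    ∫ y in S, |g y| ≤ (s / t) ^ 2 * energy u g p s := by
  have hu' := (contDiff_gradSq hu).continuous
  have e : (s / t) ^ 2 * energy u g p s =
      ∫ y in ball p s, (t ^ 2)⁻¹ * (gradSq u y + ‖p - y‖ ^ 2 * |g y|) := by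
    rw [energy, integral_const_mul]
    field_simp
  have hn : ∀ y, 0 ≤ (t ^ 2)⁻¹ * (gradSq u y + ‖p - y‖ ^ 2 * |g y|) := fun y =>
    mul_nonneg (by positivity) (add_nonneg (gradSq_nonneg u y) (by positivity))
  have hib : IntegrableOn (fun y => (t ^ 2)⁻¹ * (gradSq u y + ‖p - y‖ ^ 2 * |g y|)) (ball p s) :=
    integrableOn_ball (by fun_prop) p s
  rw [e]
  refine le_trans ?_ (setIntegral_mono_set hib (Eventually.of_forall hn) (Eventually.of_forall h))
  refine setIntegral_mono_on ((integrableOn_ball hg.abs p s).mono_set h) (hib.mono_set h) hS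
    fun y hy => ?_
  have h1 : t ^ 2 ≤ ‖p - y‖ ^ 2 := pow_le_pow_left₀ ht.le (ht' y hy) 2
  rw [inv_mul_eq_div, le_div_iff₀ (by positivity)]
  nlinarith [gradSq_nonneg u y, mul_le_mul_of_nonneg_right h1 (abs_nonneg (g y))]

end Energy

lemma opNorm_le_sum_abs (A : Eu 4 →L[ℝ] ℝ) : ‖A‖ ≤ ∑ i, |A (EuclideanSpace.single i 1)| := by
  refine A.opNorm_le_bound (Finset.sum_nonneg fun i _ => abs_nonneg _) fun h => ?_
  have e : h = ∑ i, h i • EuclideanSpace.single i (1 : ℝ) := by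
    ext j
    simp [Finset.sum_apply, Pi.single_apply]
  have e2 : A h = ∑ i, h i * A (EuclideanSpace.single i 1) := by
    conv_lhs => rw [e]
    simp
  rw [e2, Finset.sum_mul, Real.norm_eq_abs]
  refine (Finset.abs_sum_le_sum_abs _ _).trans (Finset.sum_le_sum fun i _ => ?_)
  rw [abs_mul, mul_comm]
  exact mul_le_mul_of_nonneg_left (abs_coord_le h i) (abs_nonneg _)

lemma opNorm_sq_le_sum_sq (A : Eu 4 →L[ℝ] ℝ) :
    ‖A‖ ^ 2 ≤ 4 * ∑ i, A (EuclideanSpace.single i 1) ^ 2 := by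
  have h1 := pow_le_pow_left₀ (norm_nonneg A) (opNorm_le_sum_abs A) 2
  have h2 := sq_sum_le_card_mul_sum_sq (s := (Finset.univ : Finset (Fin 4)))
    (f := fun i => |A (EuclideanSpace.single i 1)|)
  simp only [sq_abs, Finset.card_univ, Fintype.card_fin] at h2
  push_cast at h2
  exact h1.trans h2

lemma sq_setIntegral_abs_le {g : Eu 4 → ℝ} (hg : Continuous g) (p : Eu 4) {r : ℝ} (hr : 0 < r) :
    (∫ y in ball p r, |g y|) ^ 2 ≤ r ^ 4 * (Real.pi ^ 2 / 2) * ∫ y in ball p r, g y ^ 2 := by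
  have hv : (volume.restrict (ball p r)).real univ = r ^ 4 * (Real.pi ^ 2 / 2) := by
    rw [measureReal_restrict_apply_univ, volume_real_ball _ hr.le]
  have h := sq_integral_mul_le (μ := volume.restrict (ball p r)) (g := fun _ => (1 : ℝ))
    (h := fun y => |g y|) (fun _ => zero_le_one)
    (integrableOn_ball continuous_const p r) (integrableOn_ball (by fun_prop) p r)
    (integrableOn_ball (by fun_prop) p r)
  simpa [hv] using h

lemma pd_eq_zero_of_support {κ : Eu 4 → ℝ} {K : ℝ} (hK : ∀ z, K < ‖z‖ → κ z = 0) (i : Fin 4)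
    {z : Eu 4} (hz : K < ‖z‖) : pd i κ z = 0 := by
  have : κ =ᶠ[𝓝 z] fun _ => 0 := by
    filter_upwards [(isOpen_lt continuous_const continuous_norm).mem_nhds hz] with y hy
    exact hK y hy
  simp [pd, this.fderiv_eq]

lemma lap_eq_zero_of_support {κ : Eu 4 → ℝ} (hκ : ContDiff ℝ ∞ κ) {K : ℝ}
    (hK : ∀ z, K < ‖z‖ → κ z = 0) {z : Eu 4} (hz : K < ‖z‖) : lap κ z = 0 := by
  rw [lap_eq hκ]
  exact Finset.sum_eq_zero fun i _ =>
    pd_eq_zero_of_support (fun y hy => pd_eq_zero_of_support hK i hy) i hz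

lemma exists_sq_integral_rescale_le {ψ : Eu 4 → ℝ} (hψ : IsTest ψ)
    (hK : ∀ z, 2 < ‖z‖ → ψ z = 0) :
    ∃ C, 0 ≤ C ∧ ∀ (g : Eu 4 → ℝ) (_ : Continuous g) (x : Eu 4) (r : ℝ), 0 < r →
      (∫ y, rescale ψ x r y * g y) ^ 2 ≤ C * r ^ 4 * ∫ y in ball x (3 * r), g y ^ 2 := by
  obtain ⟨C, hC0, hC⟩ := hψ.exists_bound
  refine ⟨C ^ 2 * (3 ^ 4 * (Real.pi ^ 2 / 2)), by positivity, fun g hg x r hr => ?_⟩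
  have h1 := abs_integral_rescale_mul_le hC (K := 3) (fun z hz => hK z (by linarith)) hg x hr
  have h2 := pow_le_pow_left₀ (abs_nonneg _) h1 2
  rw [sq_abs, mul_pow] at h2
  refine h2.trans ?_
  have h3 := sq_setIntegral_abs_le hg x (r := 3 * r) (by positivity)
  refine (mul_le_mul_of_nonneg_left h3 (sq_nonneg C)).trans (le_of_eq ?_)
  ring

lemma conv_lap_lap_eq {u κ : Eu 4 → ℝ} (hu : ContDiff ℝ ∞ u) (hκ : IsTest κ) (x : Eu 4) {r : ℝ}
    (hr : 0 < r) : conv κ (lap (lap u)) r x =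
      ∑ i, (r ^ 3)⁻¹ * ∫ y, rescale (pd i (lap κ)) x r y * pd i u y := by
  rw [conv_eq_rescale, integral_mul_lap_comm (hκ.rescale x hr) (contDiff_lap hu),
    integral_mul_lap (hκ.rescale x hr).lap hu, ← Finset.sum_neg_distrib]
  refine Finset.sum_congr rfl fun i _ => ?_
  rw [lap_rescale hκ.smooth, pd_const_mul (contDiff_rescale hκ.lap.smooth x r),
    pd_rescale hκ.lap.smooth, ← integral_neg, ← integral_const_mul]
  congr 1
  ext1 y
  field_simp

/-- A convolution of `Δ²u` at scale `r` is controlled by the Dirichlet energy at scale `r`. -/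
lemma exists_sq_conv_le {u κ : Eu 4 → ℝ} (hu : ContDiff ℝ ∞ u) (hκ : IsTest κ)
    (hK : ∀ z, 2 < ‖z‖ → κ z = 0) (a : ℝ) :
    ∃ C, 0 ≤ C ∧ ∀ r, 0 < r → ∀ x, (conv κ (fun y => a * lap (lap u) y) r x) ^ 2 ≤
      C * ((r ^ 2)⁻¹ * ∫ y in ball x (3 * r), gradSq u y) := by
  have hs : ∀ i z, 2 < ‖z‖ → pd i (lap κ) z = 0 := fun i z hz =>
    pd_eq_zero_of_support (fun y hy => lap_eq_zero_of_support hκ.smooth hK hy) i hz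
  choose C hC0 hC using fun i => exists_sq_integral_rescale_le (hκ.lap.pd i) (hs i)
  refine ⟨a ^ 2 * (4 * ∑ i, C i), by
    have := Finset.sum_nonneg fun i (_ : i ∈ Finset.univ) => hC0 i
    positivity, fun r hr x => ?_⟩
  have e : conv κ (fun y => a * lap (lap u) y) r x = a * conv κ (lap (lap u)) r x := by
    simp only [conv, smul_eq_mul, mul_assoc, integral_const_mul]
  rw [e, conv_lap_lap_eq hu hκ x hr, mul_pow]
  have h2 := sq_sum_le_card_mul_sum_sq (s := (Finset.univ : Finset (Fin 4)))
    (f := fun i => (r ^ 3)⁻¹ * ∫ y, rescale (pd i (lap κ)) x r y * pd i u y)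
  simp only [Finset.card_univ, Fintype.card_fin] at h2
  push_cast at h2
  have h3 : ∀ i ∈ Finset.univ,
      ((r ^ 3)⁻¹ * ∫ y, rescale (pd i (lap κ)) x r y * pd i u y) ^ 2 ≤
      C i * ((r ^ 2)⁻¹ * ∫ y in ball x (3 * r), gradSq u y) := by
    intro i _
    have hp := (contDiff_pd hu i).continuous
    have h4 := hC i (pd i u) hp x r hr
    have h5 : ∫ y in ball x (3 * r), pd i u y ^ 2 ≤ ∫ y in ball x (3 * r), gradSq u y :=
      setIntegral_mono (integrableOn_ball (by fun_prop) _ _)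
        (integrableOn_ball (contDiff_gradSq hu).continuous _ _) fun y => pd_sq_le_gradSq u i y
    rw [mul_pow]
    have h6 := h4.trans (mul_le_mul_of_nonneg_left h5 (by have := hC0 i; positivity))
    refine (mul_le_mul_of_nonneg_left h6 (by positivity)).trans (le_of_eq ?_)
    field_simp
  refine (mul_le_mul_of_nonneg_left (h2.trans (mul_le_mul_of_nonneg_left
    (Finset.sum_le_sum h3) (by norm_num))) (sq_nonneg a)).trans (le_of_eq ?_)
  rw [← Finset.sum_mul]
  ring

lemma conv_fderiv_apply {κ g : Eu 4 → ℝ} (hκ : IsTest κ) (hg : Continuous g) (hgi : Integrable g)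
    (r : ℝ) (x : Eu 4) (i : Fin 4) :
    conv (fderiv ℝ κ) g r x (EuclideanSpace.single i 1) = conv (pd i κ) g r x := by
  rw [conv, ContinuousLinearMap.integral_apply (integrable_conv
    (hκ.smooth.continuous_fderiv (by simp)) (hκ.compact.fderiv ℝ) hg hgi r x)]
  rfl

lemma exists_sq_norm_conv_fderiv_le {u κ : Eu 4 → ℝ} (hu : ContDiff ℝ ∞ u) (hκ : IsTest κ)
    (hK : ∀ z, 2 < ‖z‖ → κ z = 0) {a : ℝ} (hi : Integrable fun y => a * lap (lap u) y) :
    ∃ C, 0 ≤ C ∧ ∀ r, 0 < r → ∀ x, ‖conv (fderiv ℝ κ) (fun y => a * lap (lap u) y) r x‖ ^ 2 ≤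
      C * ((r ^ 2)⁻¹ * ∫ y in ball x (3 * r), gradSq u y) := by
  have hc : Continuous fun y => a * lap (lap u) y :=
    continuous_const.mul (contDiff_lap (contDiff_lap hu)).continuous
  choose C hC0 hC using fun i => exists_sq_conv_le hu (hκ.pd i)
    (fun z hz => pd_eq_zero_of_support hK i hz) a
  refine ⟨4 * ∑ i, C i, by
    have := Finset.sum_nonneg fun i (_ : i ∈ Finset.univ) => hC0 i
    positivity, fun r hr x => (opNorm_sq_le_sum_sq _).trans ?_⟩
  rw [mul_assoc, Finset.sum_mul]
  refine mul_le_mul_of_nonneg_left (Finset.sum_le_sum fun i _ => ?_) (by norm_num)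
  rw [conv_fderiv_apply hκ hc hi]
  exact hC i r hr x

lemma conv_vector_apply {κ : Eu 4 → Eu 4} (hκ : Continuous κ) (hc : HasCompactSupport κ)
    {g : Eu 4 → ℝ} (hg : Continuous g) (hgi : Integrable g) (r : ℝ) (x : Eu 4) (i : Fin 4) :
    conv κ g r x i = conv (fun z => κ z i) g r x := by
  have h := (EuclideanSpace.proj (𝕜 := ℝ) i).integral_comp_comm
    (integrable_conv hκ hc hg hgi r x)
  exact h.symm

lemma isTest_vecKer_apply {l : ℝ} (h1 : 1 ≤ l) (h2 : l ≤ 2) (i : Fin 4) :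
    IsTest fun z => vecKer l z i :=
  (isTest_stepKer h1 h2).mul_right (contDiff_coord i)

lemma exists_sq_norm_conv_vecKer_le {u : Eu 4 → ℝ} (hu : ContDiff ℝ ∞ u) {l : ℝ} (h1 : 1 ≤ l)
    (h2 : l ≤ 2) {a : ℝ} (hi : Integrable fun y => a * lap (lap u) y) :
    ∃ C, 0 ≤ C ∧ ∀ r, 0 < r → ∀ x, ‖conv (vecKer l) (fun y => a * lap (lap u) y) r x‖ ^ 2 ≤
      C * ((r ^ 2)⁻¹ * ∫ y in ball x (3 * r), gradSq u y) := by
  have hc : Continuous fun y => a * lap (lap u) y :=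
    continuous_const.mul (contDiff_lap (contDiff_lap hu)).continuous
  choose C hC0 hC using fun i => exists_sq_conv_le hu (isTest_vecKer_apply h1 h2 i)
    (fun z hz => by simp [vecKer, stepKer_eq_zero h1 h2 hz.le]) a
  refine ⟨∑ i, C i, Finset.sum_nonneg fun i _ => hC0 i, fun r hr x => ?_⟩
  rw [EuclideanSpace.real_norm_sq_eq, Finset.sum_mul]
  refine Finset.sum_le_sum fun i _ => ?_
  rw [conv_vector_apply (contDiff_vecKer l).continuous (hasCompactSupport_vecKer h1 h2) hc hi]
  exact hC i r hr x

/-- The average of `u` at scale `r` against the normalised kernel `Δ²` of the truncated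
logarithm. -/
def scaleAvg (u : Eu 4 → ℝ) (r : ℝ) (x : Eu 4) : ℝ :=
  -(8 * Real.pi ^ 2)⁻¹ * mollify biKernel u x r

lemma scaleAvg_zero (u : Eu 4 → ℝ) : scaleAvg u 0 = u := by
  ext x
  rw [scaleAvg, mollify_zero, integral_biKernel]
  field_simp

lemma continuous_scaleAvg {u : Eu 4 → ℝ} (hu : Continuous u) :
    Continuous fun q : ℝ × Eu 4 => scaleAvg u q.1 q.2 :=
  continuous_const.mul ((continuous_mollify isTest_biKernel hu).comp continuous_swap)

/-- The signed density of which `u` is the logarithmic potential. -/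
def qMass (u : Eu 4 → ℝ) (y : Eu 4) : ℝ := (8 * Real.pi ^ 2)⁻¹ * lap (lap u) y

lemma conv_stepKer_eq {u : Eu 4 → ℝ} (hu : ContDiff ℝ ∞ u) {l r : ℝ} (hl : 1 ≤ l) (hr : 0 < r)
    (x : Eu 4) : conv (stepKer l) (qMass u) r x = scaleAvg u r x - scaleAvg u (l * r) x := by
  have hl0 : 0 < l := by linarith
  have hR : 0 < l * r := by positivity
  have hT := isTest_logKernel_sub x hr (le_mul_of_one_le_left hr.le hl)
  have hs : ∀ s, ContDiff ℝ ∞ fun y => rescale logKernel x s y + Real.log s := fun s =>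
    (contDiff_rescale contDiff_logKernel x s).add contDiff_const
  have h1 := integral_mul_lap_comm hT (contDiff_lap hu)
  have h2 := integral_mul_lap_comm hT.lap hu
  rw [lap_sub (hs _) (hs _)] at h1 h2
  rw [lap_sub (contDiff_lap (hs _)) (contDiff_lap (hs _)), lap_lap_rescale_logKernel,
    lap_lap_rescale_logKernel] at h2
  have h5 : ∀ s, 0 < s → mollify biKernel u x s =
      ∫ y, s⁻¹ ^ 4 * rescale biKernel x s y * u y := by
    intro s hs
    simp only [mul_assoc]
    rw [integral_const_mul, integral_rescale_mul _ _ _ hs]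
    field_simp
  have hint : ∀ s, 0 < s → Integrable fun y => s⁻¹ ^ 4 * rescale biKernel x s y * u y := by
    intro s hs
    simp only [mul_assoc]
    exact ((isTest_biKernel.rescale x hs).integrable_mul hu.continuous).const_mul _
  rw [scaleAvg, scaleAvg, ← mul_sub, h5 r hr, h5 _ hR, ← integral_sub (hint r hr) (hint _ hR)]
  simp only [← sub_mul]
  rw [← h2, ← h1, conv, ← integral_const_mul]
  refine integral_congr_ae (Eventually.of_forall fun y => ?_)
  simp only [qMass, stepKer, rescale, smul_smul, smul_eq_mul, mul_inv]
  rw [Real.log_mul hl0.ne' hr.ne']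
  ring

lemma hasFDerivAt_conv_of_continuous {κ g : Eu 4 → ℝ} (hκ : IsTest κ) (hg : Continuous g) {r : ℝ}
    (hr : 0 < r) (x : Eu 4) : ∃ A : Eu 4 →L[ℝ] ℝ, HasFDerivAt (conv κ g r) A x ∧
      ∀ i, A (EuclideanSpace.single i 1) = r⁻¹ * ∫ y, rescale (pd i κ) x r y * g y := by
  have hT := hκ.comp_smul (inv_ne_zero hr.ne')
  have h := hT.compact.hasFDerivAt_convolution_right
    (μ := volume) (ContinuousLinearMap.mul ℝ ℝ) hg.locallyIntegrable (hT.smooth.of_le (by simp)) x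
  have e : convolution g (fun y => κ (r⁻¹ • y)) (ContinuousLinearMap.mul ℝ ℝ) volume =
      conv κ g r := by
    ext y
    rfl
  rw [e] at h
  refine ⟨_, h, fun i => ?_⟩
  rw [convolution_precompR_apply _ hg.locallyIntegrable (hT.compact.fderiv ℝ)
    (hT.smooth.continuous_fderiv (by simp)), convolution, ← integral_const_mul]
  refine integral_congr_ae (Eventually.of_forall fun y => ?_)
  have := congrFun (pd_comp_smul hκ.smooth i r⁻¹) (x - y)
  simp only [pd] at this
  simp only [ContinuousLinearMap.mul_apply', this, rescale, pd]
  ring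

lemma exists_abs_scaleAvg_sub_le {u : Eu 4 → ℝ} (hu : ContDiff ℝ ∞ u) {C : ℝ}
    (hC : EnergyGrowth u C) :
    ∃ B, 0 ≤ B ∧ ∀ r, 0 < r → ∀ x y, |scaleAvg u r x - scaleAvg u r y| ≤ B * ‖x - y‖ / r := by
  obtain ⟨K, hK0, hK⟩ := exists_sq_integral_rescale_le isTest_biKernel
    (fun z hz => biKernel_eq_zero (by linarith))
  have hC0 := hC.1
  have hf : ∀ r, 0 < r → ∀ x, ∃ A : Eu 4 →L[ℝ] ℝ, HasFDerivAt (scaleAvg u r) A x ∧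
      ‖A‖ ≤ (8 * Real.pi ^ 2)⁻¹ * (4 * Real.sqrt (9 * K * C)) / r := by
    intro r hr x
    obtain ⟨A, hA, hA'⟩ := hasFDerivAt_conv_of_continuous isTest_biKernel hu.continuous hr x
    have e : scaleAvg u r = fun z => -(8 * Real.pi ^ 2)⁻¹ * (r ^ 4)⁻¹ * conv biKernel u r z := by
      ext z
      rw [conv_eq_rescale, integral_rescale_mul _ _ _ hr, scaleAvg]
      field_simp
    refine ⟨_, e ▸ hA.const_mul _, ?_⟩
    have hi : ∀ i ∈ Finset.univ, |A (EuclideanSpace.single i 1)| ≤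
        Real.sqrt (9 * K * C) * r ^ 3 := by
      intro i _
      have h1 : A (EuclideanSpace.single i 1) = ∫ y, rescale biKernel x r y * pd i u y := by
        rw [hA' i, integral_mul_pd (isTest_biKernel.rescale x hr) hu,
          pd_rescale isTest_biKernel.smooth, ← integral_neg, ← integral_const_mul]
        congr 1
        ext1 y
        ring
      have hp := (contDiff_pd hu i).continuous
      have h2 := hK (pd i u) hp x r hr
      have h3 : ∫ y in ball x (3 * r), pd i u y ^ 2 ≤ ∫ y in ball x (3 * r), gradSq u y :=
        setIntegral_mono (integrableOn_ball (by fun_prop) _ _)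
          (integrableOn_ball (contDiff_gradSq hu).continuous _ _) fun y => pd_sq_le_gradSq u i y
      have h4 := h3.trans (hC.2 x (3 * r) (by positivity))
      rw [← h1] at h2
      have h5 := h2.trans (mul_le_mul_of_nonneg_left h4 (by positivity))
      refine abs_le_of_sq_le_sq ?_ (by positivity)
      rw [mul_pow, Real.sq_sqrt (by positivity)]
      refine h5.trans (le_of_eq ?_)
      ring
    have hs := (opNorm_le_sum_abs A).trans (Finset.sum_le_sum hi)
    simp only [Finset.sum_const, Finset.card_univ, Fintype.card_fin, nsmul_eq_mul] at hs
    rw [norm_smul, norm_mul, norm_neg, norm_inv, norm_inv, Real.norm_of_nonneg (by positivity),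
      Real.norm_of_nonneg (by positivity)]
    refine (mul_le_mul_of_nonneg_left hs (by positivity)).trans (le_of_eq ?_)
    push_cast
    field_simp
  refine ⟨(8 * Real.pi ^ 2)⁻¹ * (4 * Real.sqrt (9 * K * C)), by positivity, fun r hr x y => ?_⟩
  choose A hA hA' using hf r hr
  have := convex_univ.norm_image_sub_le_of_norm_hasFDerivWithin_le
    (fun z _ => (hA z).hasFDerivWithinAt) (fun z _ => hA' z) (mem_univ y) (mem_univ x)
  rw [Real.norm_eq_abs] at this
  refine this.trans (le_of_eq ?_)
  ring

/-- A scale-dependent family of vector fields `W r`, whose derivative is close to the conformal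
matrix `(U r - U (lam * r)) • id` up to an error that is summable over geometric scales. -/
structure ScaleField (u : Eu 4 → ℝ) where
  /-- The ratio of consecutive scales. -/
  lam : ℝ
  /-- The average of `u` at a given scale. -/
  U : ℝ → Eu 4 → ℝ
  /-- The displacement field at a given scale. -/
  W : ℝ → Eu 4 → Eu 4
  /-- The derivative of the displacement field. -/
  D : ℝ → Eu 4 → Eu 4 →L[ℝ] Eu 4
  /-- A bound for the displacement and for the oscillation of the averages. -/
  B : ℝ
  one_lt_lam : 1 < lam
  U_zero : U 0 = u
  continuous_U : Continuous fun q : ℝ × Eu 4 => U q.1 q.2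
  B_nonneg : 0 ≤ B
  hasFDerivAt_W : ∀ r, 0 < r → ∀ x, HasFDerivAt (W r) (D r x) x
  norm_D_le : ∀ r, 0 < r → ∀ x, ‖D r x‖ ≤ 1 / 8
  norm_W_le : ∀ r, 0 < r → ∀ x, ‖W r x‖ ≤ B * r
  abs_step_le : ∀ r, 0 < r → ∀ x, |U r x - U (lam * r) x| ≤ 1 / 8
  abs_U_sub_le : ∀ r, 0 < r → ∀ x y, |U r x - U r y| ≤ B * ‖x - y‖ / r
  exists_error : ∀ M, 0 ≤ M → ∃ C, 0 ≤ C ∧ ∃ e : ℝ → Eu 4 → ℝ, (∀ r p, 0 ≤ e r p) ∧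
    (∀ ρ, 0 < ρ → ∀ (J : ℕ) p, ∑ j ∈ Finset.range J, e (ρ * lam ^ j) p ≤ C) ∧
    (∀ r, 0 < r → ∀ p, (U r p - U (lam * r) p) ^ 2 ≤ e r p) ∧
    ∀ r, 0 < r → ∀ z p, ‖z - p‖ ≤ M * r → ‖W r z‖ ^ 2 ≤ r ^ 2 * e r p ∧
      ‖D r z - (U r p - U (lam * r) p) • ContinuousLinearMap.id ℝ (Eu 4)‖ ≤
        e r p + C * (‖z - p‖ / r) ^ 2
  exists_lip_of_le_one : ∀ R, 0 ≤ R → ∃ L, 0 ≤ L ∧ ∀ r, 0 < r → r ≤ 1 → ∀ a b, ‖a‖ ≤ R → ‖b‖ ≤ R →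
    ‖D r a - D r b‖ ≤ L * r * ‖a - b‖
  exists_lip : ∃ L, 0 ≤ L ∧ ∀ r, 0 < r → ∀ a b, ‖D r a - D r b‖ ≤ L * r⁻¹ * ‖a - b‖

lemma fderiv_eq_zero_of_support {V : Type*} [NormedAddCommGroup V] [NormedSpace ℝ V]
    {κ : Eu 4 → V} {K : ℝ} (hK : ∀ z, K < ‖z‖ → κ z = 0) {z : Eu 4} (hz : K < ‖z‖) :
    fderiv ℝ κ z = 0 := by
  have : κ =ᶠ[𝓝 z] fun _ => 0 := by
    filter_upwards [(isOpen_lt continuous_const continuous_norm).mem_nhds hz] with y hy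
    exact hK y hy
  simp [this.fderiv_eq]

lemma norm_smul_sub_gt {r : ℝ} (hr : 0 < r) {K : ℝ} {x y : Eu 4} (h : K * r < ‖x - y‖) :
    K < ‖r⁻¹ • (x - y)‖ := by
  rwa [norm_smul, norm_inv, Real.norm_of_nonneg hr.le, inv_mul_eq_div, lt_div_iff₀ hr]

section Lipschitz

variable {V : Type*} [NormedAddCommGroup V] [NormedSpace ℝ V] {κ : Eu 4 → V}
  {g : Eu 4 → ℝ}

lemma exists_norm_conv_sub_le (hκ : ContDiff ℝ ∞ κ) (hc : HasCompactSupport κ)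
    (hg : Continuous g) (hgi : Integrable g) :
    ∃ L, 0 ≤ L ∧ ∀ r, 0 < r → ∀ a b, ‖conv κ g r a - conv κ g r b‖ ≤ L * r⁻¹ * ‖a - b‖ := by
  obtain ⟨C, hC0, hC⟩ := exists_norm_bound (hκ.continuous_fderiv (by simp)) (hc.fderiv ℝ)
  have hI : 0 ≤ ∫ y, |g y| := integral_nonneg fun y => abs_nonneg _
  refine ⟨C * ∫ y, |g y|, by positivity, fun r hr a b => ?_⟩
  refine convex_univ.norm_image_sub_le_of_norm_hasFDerivWithin_le
    (fun z _ => (hasFDerivAt_conv hκ hc hg hgi r z).hasFDerivWithinAt) (fun z _ => ?_)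
    (mem_univ b) (mem_univ a)
  have h := norm_conv_le hC MeasurableSet.univ (r := r) (x := z) (fun y hy => absurd (mem_univ y) hy)
    hgi
  rw [setIntegral_univ] at h
  rw [norm_smul, norm_inv, Real.norm_of_nonneg hr.le, mul_comm]
  gcongr

lemma exists_norm_conv_sub_le_of_le_one (hκ : ContDiff ℝ ∞ κ) (hc : HasCompactSupport κ)
    (h2 : ∀ z, 2 < ‖z‖ → κ z = 0) (hg : Continuous g) (hgi : Integrable g) (R : ℝ) :
    ∃ L, 0 ≤ L ∧ ∀ r, 0 < r → r ≤ 1 → ∀ a b, ‖a‖ ≤ R → ‖b‖ ≤ R →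
      ‖conv κ g r a - conv κ g r b‖ ≤ L * r * ‖a - b‖ := by
  obtain ⟨C, hC0, hC⟩ := exists_norm_bound (hκ.continuous_fderiv (by simp)) (hc.fderiv ℝ)
  obtain ⟨G, hG⟩ := (isCompact_closedBall (0 : Eu 4) (R + 3)).exists_bound_of_continuousOn
    hg.continuousOn
  refine ⟨C * (|G| * (3 ^ 4 * (Real.pi ^ 2 / 2))), by positivity,
    fun r hr hr1 a b ha hb => ?_⟩
  refine (convex_closedBall (0 : Eu 4) R).norm_image_sub_le_of_norm_hasFDerivWithin_le
    (fun z _ => (hasFDerivAt_conv hκ hc hg hgi r z).hasFDerivWithinAt) (fun z hz => ?_)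
    (by simpa using hb) (by simpa using ha)
  have h := norm_conv_le hC (measurableSet_ball (x := z) (ε := 3 * r)) (r := r) (x := z)
    (fun y hy => fderiv_eq_zero_of_support h2 (norm_smul_sub_gt hr (by
      rw [mem_ball', dist_eq_norm] at hy
      linarith))) hgi
  have hs : ∫ y in ball z (3 * r), |g y| ≤ |G| * ((3 * r) ^ 4 * (Real.pi ^ 2 / 2)) := by
    have e : |G| * ((3 * r) ^ 4 * (Real.pi ^ 2 / 2)) = ∫ _ in ball z (3 * r), |G| := by
      rw [setIntegral_const, volume_real_ball z (by positivity), smul_eq_mul, mul_comm]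
    rw [e]
    refine setIntegral_mono_on (integrableOn_ball hg.abs _ _)
      (integrableOn_ball continuous_const _ _) measurableSet_ball fun y hy => ?_
    refine (hG y ?_).trans (le_abs_self G)
    rw [mem_closedBall_zero_iff] at hz ⊢
    rw [mem_ball, dist_eq_norm] at hy
    have := norm_le_insert' y z
    linarith
  rw [norm_smul, norm_inv, Real.norm_of_nonneg hr.le]
  have h3 := h.trans (mul_le_mul_of_nonneg_left hs hC0)
  refine (mul_le_mul_of_nonneg_left h3 (by positivity)).trans ?_
  have e : r⁻¹ * (C * (|G| * ((3 * r) ^ 4 * (Real.pi ^ 2 / 2)))) =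
      C * (|G| * (3 ^ 4 * (Real.pi ^ 2 / 2))) * (r * r ^ 2) := by
    field_simp
  rw [e]
  refine mul_le_mul_of_nonneg_left ?_ (by positivity)
  have : r ^ 2 ≤ 1 := pow_le_one₀ hr.le hr1
  nlinarith

end Lipschitz

section Error

variable {u : Eu 4 → ℝ}

lemma continuous_qMass (hu : ContDiff ℝ ∞ u) : Continuous (qMass u) :=
  continuous_const.mul (contDiff_lap (contDiff_lap hu)).continuous

lemma setIntegral_gradSq_le {p z : Eu 4} (hu : ContDiff ℝ ∞ u) {M r : ℝ} (hM : 0 ≤ M)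
    (hr : 0 < r) (h : ‖z - p‖ ≤ M * r) :
    (r ^ 2)⁻¹ * ∫ y in ball z (3 * r), gradSq u y ≤
      (3 + M) ^ 2 * energy u (qMass u) p ((3 + M) * r) := by
  have hs : 0 < (3 + M) * r := by positivity
  have := setIntegral_gradSq_le_energy hu (continuous_qMass hu) (p := p) (q := z) (r := 3 * r) hs
    (ball_subset_ball' (by rw [dist_eq_norm]; linarith))
  refine (mul_le_mul_of_nonneg_left this (by positivity)).trans (le_of_eq ?_)
  field_simp

/-- The nonconformal part of the derivative of the displacement. -/
lemma norm_conv_sub_le_energy (hu : ContDiff ℝ ∞ u) (hi : Integrable (qMass u)) {l ε : ℝ}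
    (h1 : 1 ≤ l) (h2 : l ≤ 2) (hε : ∀ z, |stepKer l z| ≤ ε ∧ ‖fderiv ℝ (vecKer l) z‖ ≤ ε)
    {p z : Eu 4} {M r : ℝ} (hM : 0 ≤ M) (hr : 0 < r) (h : ‖z - p‖ ≤ M * r) :
    ‖conv (fderiv ℝ (vecKer l)) (qMass u) r z -
        conv (stepKer l) (qMass u) r z • ContinuousLinearMap.id ℝ (Eu 4)‖ ≤
      2 * ε * (16 * (3 + M) ^ 2 * energy u (qMass u) p ((3 + M) * r) +
        16 * (∫ y, |qMass u y|) * (‖z - p‖ / r) ^ 2) := by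
  have hg := continuous_qMass hu
  have hε0 : 0 ≤ ε := (abs_nonneg _).trans (hε 0).1
  have hI : 0 ≤ ∫ y, |qMass u y| := integral_nonneg fun y => abs_nonneg _
  have hkv := contDiff_vecKer l
  have hks := isTest_stepKer h1 h2
  have e : conv (fderiv ℝ (vecKer l)) (qMass u) r z -
      conv (stepKer l) (qMass u) r z • ContinuousLinearMap.id ℝ (Eu 4) =
      conv (fun w => fderiv ℝ (vecKer l) w - stepKer l w • ContinuousLinearMap.id ℝ (Eu 4))
        (qMass u) r z := by
    have i1 := integrable_conv (hkv.continuous_fderiv (by simp))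
      ((hasCompactSupport_vecKer h1 h2).fderiv ℝ) hg hi r z
    have i2 := (integrable_conv hks.continuous hks.compact hg hi r z).smul_const
      (ContinuousLinearMap.id ℝ (Eu 4))
    have i3 : ∫ y, (qMass u y • stepKer l (r⁻¹ • (z - y))) • ContinuousLinearMap.id ℝ (Eu 4) =
        conv (stepKer l) (qMass u) r z • ContinuousLinearMap.id ℝ (Eu 4) :=
      integral_smul_const _ _
    rw [← i3, conv, conv, ← integral_sub i1 i2]
    refine integral_congr_ae (Eventually.of_forall fun y => ?_)
    simp only [smul_sub, smul_assoc]
  rw [e]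
  set S : Set (Eu 4) := {y | r / 2 ≤ ‖z - y‖ ∧ ‖z - y‖ ≤ 2 * r} with hS
  have hzy : Continuous fun y : Eu 4 => ‖z - y‖ := by fun_prop
  have hSm : MeasurableSet S :=
    ((isClosed_le continuous_const hzy).inter (isClosed_le hzy continuous_const)).measurableSet
  have hb : ∀ w, ‖fderiv ℝ (vecKer l) w - stepKer l w • ContinuousLinearMap.id ℝ (Eu 4)‖ ≤
      2 * ε := by
    intro w
    refine (norm_sub_le _ _).trans ?_
    rw [norm_smul, Real.norm_eq_abs]
    have h3 : |stepKer l w| * ‖ContinuousLinearMap.id ℝ (Eu 4)‖ ≤ ε * 1 :=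
      mul_le_mul (hε w).1 ContinuousLinearMap.norm_id_le (norm_nonneg _) hε0
    linarith [(hε w).2]
  refine (norm_conv_le hb hSm (fun y hy => ?_) hi).trans
    (mul_le_mul_of_nonneg_left ?_ (by positivity))
  · rw [fderiv_vecKer, fderiv_stepKer_eq_zero h1 h2, ContinuousLinearMap.zero_smulRight, add_zero,
      sub_self]
    rw [norm_smul, norm_inv, Real.norm_of_nonneg hr.le, inv_mul_eq_div, lt_div_iff₀ hr,
      div_lt_iff₀ hr]
    by_contra! hcon
    exact hy ⟨by linarith [hcon.1], hcon.2⟩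
  · have hen := energy_nonneg (u := u) (g := qMass u) p ((3 + M) * r)
    rcases le_or_gt (‖z - p‖) (r / 4) with hd | hd
    · have := setIntegral_abs_le_energy hu hg (p := p) (s := (3 + M) * r) (t := r / 4)
        (by positivity) (by positivity) hSm (fun y hy => ?_) (fun y hy => ?_)
      · refine this.trans ?_
        have e2 : (3 + M) * r / (r / 4) = 4 * (3 + M) := by field_simp
        rw [e2]
        have : 0 ≤ 16 * (∫ y, |qMass u y|) * (‖z - p‖ / r) ^ 2 := by positivity
        nlinarith
      · rw [mem_ball, dist_eq_norm]
        have h4 := norm_sub_le_norm_sub_add_norm_sub y z p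
        rw [norm_sub_rev y z] at h4
        linarith [hy.2]
      · have h4 := norm_sub_le_norm_sub_add_norm_sub z p y
        linarith [hy.1]
    · have h4 : ∫ y in S, |qMass u y| ≤ ∫ y, |qMass u y| :=
        setIntegral_le_integral hi.abs (Eventually.of_forall fun y => abs_nonneg _)
      have h5 : 1 / 4 ≤ ‖z - p‖ / r := by
        rw [le_div_iff₀ hr]
        linarith
      have h6 : 1 ≤ 16 * (‖z - p‖ / r) ^ 2 := by nlinarith
      have : 0 ≤ 16 * (3 + M) ^ 2 * energy u (qMass u) p ((3 + M) * r) := by positivity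
      nlinarith

/-- The oscillation of a convolution in terms of the energy. -/
lemma exists_abs_conv_stepKer_sub_le (hu : ContDiff ℝ ∞ u) (hi : Integrable (qMass u)) {l : ℝ}
    (h1 : 1 ≤ l) (h2 : l ≤ 2) :
    ∃ C, 0 ≤ C ∧ ∀ M r, 0 ≤ M → 0 < r → ∀ z p, ‖z - p‖ ≤ M * r →
      |conv (stepKer l) (qMass u) r z - conv (stepKer l) (qMass u) r p| ≤
        C * ((3 + M) ^ 2 * energy u (qMass u) p ((3 + M) * r)) + (‖z - p‖ / r) ^ 2 := by
  have hg := continuous_qMass hu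
  have hks := isTest_stepKer h1 h2
  obtain ⟨C, hC0, hC⟩ := exists_sq_norm_conv_fderiv_le hu hks
    (fun z hz => stepKer_eq_zero h1 h2 hz.le) hi
  refine ⟨C, hC0, fun M r hM hr z p h => ?_⟩
  have hen := energy_nonneg (u := u) (g := qMass u) p ((3 + M) * r)
  set X := C * ((3 + M) ^ 2 * energy u (qMass u) p ((3 + M) * r)) with hX
  have hX0 : 0 ≤ X := by positivity
  have hmv := (convex_closedBall p (M * r)).norm_image_sub_le_of_norm_hasFDerivWithin_le
    (C := r⁻¹ * √X) (x := p) (y := z)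
    (fun w _ => (hasFDerivAt_conv hks.smooth hks.compact hg hi r w).hasFDerivWithinAt)
    (fun w hw => ?_) (mem_closedBall_self (by positivity))
    (by rwa [mem_closedBall, dist_eq_norm])
  · rw [Real.norm_eq_abs] at hmv
    refine hmv.trans ?_
    have e : r⁻¹ * √X * ‖z - p‖ = √X * (‖z - p‖ / r) := by ring
    rw [e]
    nlinarith [Real.sq_sqrt hX0, sq_nonneg (√X - ‖z - p‖ / r), sq_nonneg (√X + ‖z - p‖ / r)]
  · rw [mem_closedBall, dist_eq_norm] at hw
    rw [norm_smul, norm_inv, Real.norm_of_nonneg hr.le]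
    refine mul_le_mul_of_nonneg_left (Real.le_sqrt_of_sq_le ?_) (by positivity)
    exact (hC r hr w).trans (mul_le_mul_of_nonneg_left (setIntegral_gradSq_le hu hM hr hw) hC0)

end Error

lemma exists_displacement_bound {u : Eu 4 → ℝ} (hu : ContDiff ℝ ∞ u) (hi : Integrable (qMass u))
    {C : ℝ} (hC : EnergyGrowth u C) {l : ℝ} (h1 : 1 ≤ l) (h2 : l ≤ 2) :
    ∃ B, 0 ≤ B ∧ ∀ r, 0 < r → ∀ x, ‖r • conv (vecKer l) (qMass u) r x‖ ≤ B * r := by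
  obtain ⟨K, hK0, hK⟩ := exists_sq_norm_conv_vecKer_le hu h1 h2 hi
  have hC0 := hC.1
  refine ⟨√(9 * K * C), Real.sqrt_nonneg _, fun r hr x => ?_⟩
  rw [norm_smul, Real.norm_of_nonneg hr.le, mul_comm]
  refine mul_le_mul_of_nonneg_right (Real.le_sqrt_of_sq_le ((hK r hr x).trans ?_)) hr.le
  refine (mul_le_mul_of_nonneg_left (mul_le_mul_of_nonneg_left
    (hC.2 x (3 * r) (by positivity)) (by positivity)) hK0).trans (le_of_eq ?_)
  field_simp
  ring

lemma exists_displacement_error {u : Eu 4 → ℝ} (hu : ContDiff ℝ ∞ u) (hi : Integrable (qMass u))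
    {D : ℝ} (hD0 : 0 ≤ D)
    (hD : ∀ p r, 0 < r → ∫ y in ball p r, gradSq u y * (‖p - y‖ ^ 2)⁻¹ ≤ D)
    {l ε : ℝ} (h1 : 1 < l) (h2 : l ≤ 2)
    (hε : ∀ z, |stepKer l z| ≤ ε ∧ ‖fderiv ℝ (vecKer l) z‖ ≤ ε) {M : ℝ} (hM : 0 ≤ M) :
    ∃ C, 0 ≤ C ∧ ∃ e : ℝ → Eu 4 → ℝ, (∀ r p, 0 ≤ e r p) ∧
    (∀ ρ, 0 < ρ → ∀ (J : ℕ) p, ∑ j ∈ Finset.range J, e (ρ * l ^ j) p ≤ C) ∧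
    (∀ r, 0 < r → ∀ p, conv (stepKer l) (qMass u) r p ^ 2 ≤ e r p) ∧
    ∀ r, 0 < r → ∀ z p, ‖z - p‖ ≤ M * r →
      ‖r • conv (vecKer l) (qMass u) r z‖ ^ 2 ≤ r ^ 2 * e r p ∧
      ‖conv (fderiv ℝ (vecKer l)) (qMass u) r z -
          conv (stepKer l) (qMass u) r p • ContinuousLinearMap.id ℝ (Eu 4)‖ ≤
        e r p + C * (‖z - p‖ / r) ^ 2 := by
  have hg := continuous_qMass hu
  have hε0 : 0 ≤ ε := (abs_nonneg _).trans (hε 0).1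
  have hI : 0 ≤ ∫ y, |qMass u y| := integral_nonneg fun y => abs_nonneg _
  have hl : 0 < (1 - (l ^ 2)⁻¹)⁻¹ :=
    inv_pos.2 (sub_pos.2 (inv_lt_one_of_one_lt₀ (by nlinarith)))
  obtain ⟨C₁, hC₁, h₁⟩ := exists_sq_norm_conv_vecKer_le hu h1.le h2 hi
  obtain ⟨C₂, hC₂, h₂⟩ := exists_sq_conv_le hu (isTest_stepKer h1.le h2)
    (fun z hz => stepKer_eq_zero h1.le h2 hz.le) (8 * Real.pi ^ 2)⁻¹
  obtain ⟨C₃, hC₃, h₃⟩ := exists_abs_conv_stepKer_sub_le hu hi h1.le h2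
  set K := (C₁ + C₂ + C₃ + 2 * ε * 16) * (3 + M) ^ 2 with hK
  have hK0 : 0 ≤ K := by positivity
  set S := (1 - (l ^ 2)⁻¹)⁻¹ * (D + ∫ y, |qMass u y|) with hS
  have hS0 : 0 ≤ S := by positivity
  have hen := fun p r => energy_nonneg (u := u) (g := qMass u) p ((3 + M) * r)
  refine ⟨K * S + (2 * ε * (16 * ∫ y, |qMass u y|) + 1), by positivity,
    fun r p => K * energy u (qMass u) p ((3 + M) * r), fun r p => mul_nonneg hK0 (hen p r),
    fun ρ hρ J p => ?_, fun r hr p => ?_, fun r hr z p h => ⟨?_, ?_⟩⟩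
  · have hs := sum_energy_le hu hg hi hD h1 J (ρ := (3 + M) * ρ) (by positivity) p
    have hs' := mul_le_mul_of_nonneg_left hs hK0
    simp only [mul_assoc, Finset.mul_sum] at hs' ⊢
    have : 0 ≤ 2 * (ε * (16 * ∫ y, |qMass u y|)) + 1 := by positivity
    linarith
  · refine (h₂ r hr p).trans ((mul_le_mul_of_nonneg_left
      (setIntegral_gradSq_le hu hM hr (p := p) (by simpa using by positivity)) hC₂).trans ?_)
    rw [← mul_assoc]
    refine mul_le_mul_of_nonneg_right ?_ (hen p r)
    rw [hK]
    gcongr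
    linarith [mul_nonneg (mul_nonneg zero_le_two hε0) (by norm_num : (0 : ℝ) ≤ 16)]
  · rw [norm_smul, mul_pow, Real.norm_of_nonneg hr.le]
    refine mul_le_mul_of_nonneg_left ((h₁ r hr z).trans ((mul_le_mul_of_nonneg_left
      (setIntegral_gradSq_le hu hM hr h) hC₁).trans ?_)) (by positivity)
    rw [← mul_assoc]
    refine mul_le_mul_of_nonneg_right ?_ (hen p r)
    rw [hK]
    gcongr
    linarith [mul_nonneg (mul_nonneg zero_le_two hε0) (by norm_num : (0 : ℝ) ≤ 16)]
  · have a1 := norm_conv_sub_le_energy hu hi h1.le h2 hε hM hr h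
    have a2 := h₃ M r hM hr z p h
    have a3 := norm_sub_le_norm_sub_add_norm_sub (conv (fderiv ℝ (vecKer l)) (qMass u) r z)
      (conv (stepKer l) (qMass u) r z • ContinuousLinearMap.id ℝ (Eu 4))
      (conv (stepKer l) (qMass u) r p • ContinuousLinearMap.id ℝ (Eu 4))
    have a4 : ‖conv (stepKer l) (qMass u) r z • ContinuousLinearMap.id ℝ (Eu 4) -
        conv (stepKer l) (qMass u) r p • ContinuousLinearMap.id ℝ (Eu 4)‖ ≤
        |conv (stepKer l) (qMass u) r z - conv (stepKer l) (qMass u) r p| := by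
      have e : conv (stepKer l) (qMass u) r z • ContinuousLinearMap.id ℝ (Eu 4) -
        conv (stepKer l) (qMass u) r p • ContinuousLinearMap.id ℝ (Eu 4) =
        (conv (stepKer l) (qMass u) r z - conv (stepKer l) (qMass u) r p) •
          ContinuousLinearMap.id ℝ (Eu 4) := by
        ext1 w
        simp [sub_smul]
      rw [e, norm_smul, Real.norm_eq_abs]
      exact mul_le_of_le_one_right (abs_nonneg _) ContinuousLinearMap.norm_id_le
    have a5 : 0 ≤ C₁ * ((3 + M) ^ 2 * energy u (qMass u) p ((3 + M) * r)) := by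
      have := hen p r
      positivity
    have a6 : 0 ≤ C₂ * ((3 + M) ^ 2 * energy u (qMass u) p ((3 + M) * r)) := by
      have := hen p r
      positivity
    have a7 : 0 ≤ K * S * (‖z - p‖ / r) ^ 2 := by positivity
    rw [hK] at a7 ⊢
    linarith

/-- Smooth functions with integrable bilaplacian, controlled energy and finite Hardy potential
admit a scale field. -/
lemma nonempty_scaleField {u : Eu 4 → ℝ} (hu : ContDiff ℝ ∞ u) (hf : Integrable (lap (lap u)))
    {C : ℝ} (hC : EnergyGrowth u C) {D : ℝ} (hD0 : 0 ≤ D)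
    (hD : ∀ p r, 0 < r → ∫ y in ball p r, gradSq u y * (‖p - y‖ ^ 2)⁻¹ ≤ D) :
    Nonempty (ScaleField u) := by
  have hi : Integrable (qMass u) := hf.const_mul _
  have hg := continuous_qMass hu
  have hI : 0 ≤ ∫ y, |qMass u y| := integral_nonneg fun y => abs_nonneg _
  obtain ⟨l, h1, h2, hε⟩ := exists_stepKer_small (ε := (8 * ((∫ y, |qMass u y|) + 1))⁻¹)
    (by positivity)
  have hsmall : (8 * ((∫ y, |qMass u y|) + 1))⁻¹ * ∫ y, |qMass u y| ≤ 1 / 8 := by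
    rw [inv_mul_eq_div, div_le_iff₀ (by positivity)]
    linarith
  have hkv := contDiff_vecKer l
  have hkc := hasCompactSupport_vecKer h1.le h2
  have hkd : ContDiff ℝ ∞ (fderiv ℝ (vecKer l)) := hkv.fderiv_right (by simp)
  have hks : ∀ z, 2 < ‖z‖ → fderiv ℝ (vecKer l) z = 0 := fun z hz =>
    fderiv_eq_zero_of_support (fun w hw => by simp [vecKer, stepKer_eq_zero h1.le h2 hw.le]) hz
  obtain ⟨B₁, hB₁, hW⟩ := exists_displacement_bound hu hi hC h1.le h2
  obtain ⟨B₂, hB₂, hU⟩ := exists_abs_scaleAvg_sub_le hu hC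
  have hv := fun r (hr : 0 < r) x => conv_stepKer_eq hu h1.le hr x
  refine ⟨{
    lam := l
    U := scaleAvg u
    W := fun r x => r • conv (vecKer l) (qMass u) r x
    D := fun r x => conv (fderiv ℝ (vecKer l)) (qMass u) r x
    B := B₁ + B₂
    one_lt_lam := h1
    U_zero := scaleAvg_zero u
    continuous_U := continuous_scaleAvg hu.continuous
    B_nonneg := by positivity
    hasFDerivAt_W := fun r hr x => ?_
    norm_D_le := fun r hr x => ?_
    norm_W_le := fun r hr x => (hW r hr x).trans (by gcongr; linarith)
    abs_step_le := fun r hr x => ?_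
    abs_U_sub_le := fun r hr x y => (hU r hr x y).trans (by gcongr; linarith)
    exists_error := fun M hM => ?_
    exists_lip_of_le_one := fun R _ =>
      exists_norm_conv_sub_le_of_le_one hkd (hkc.fderiv ℝ) hks hg hi R
    exists_lip := exists_norm_conv_sub_le hkd (hkc.fderiv ℝ) hg hi }⟩
  · have := (hasFDerivAt_conv hkv hkc hg hi r x).const_smul r
    rwa [smul_inv_smul₀ hr.ne'] at this
  · have := norm_conv_le (fun z => (hε z).2) MeasurableSet.univ (r := r) (x := x)
      (fun y hy => absurd (mem_univ y) hy) hi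
    rw [setIntegral_univ] at this
    exact this.trans hsmall
  · have := norm_conv_le (κ := stepKer l) (fun z => (hε z).1) MeasurableSet.univ (r := r) (x := x)
      (fun y hy => absurd (mem_univ y) hy) hi
    rw [setIntegral_univ, hv r hr, Real.norm_eq_abs] at this
    exact this.trans hsmall
  · obtain ⟨C, hC0, e, he0, he1, he2, he3⟩ := exists_displacement_error hu hi hD0 hD h1 h2 hε hM
    exact ⟨C, hC0, e, he0, he1, fun r hr p => hv r hr p ▸ he2 r hr p,
      fun r hr z p h => hv r hr p ▸ he3 r hr z p h⟩

lemma det_id_add_pos {A : Eu 4 →L[ℝ] Eu 4} (hA : ‖A‖ < 1) :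
    0 < (ContinuousLinearMap.id ℝ (Eu 4) + A).det := by
  have hne : ∀ t ∈ Icc (0 : ℝ) 1, (ContinuousLinearMap.id ℝ (Eu 4) + t • A).det ≠ 0 := by
    intro t ht h0
    have hlt : ‖-(t • A)‖ < 1 := by
      rw [norm_neg, norm_smul, Real.norm_of_nonneg ht.1]
      nlinarith [norm_nonneg A, ht.2]
    have hu : IsUnit (1 - -(t • A)) := isUnit_one_sub_of_norm_lt_one hlt
    have hu2 : IsUnit ((ContinuousLinearMap.id ℝ (Eu 4) + t • A : Eu 4 →L[ℝ] Eu 4) :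
        Eu 4 →ₗ[ℝ] Eu 4) := by
      rw [sub_neg_eq_add] at hu
      exact hu.map (ContinuousLinearMap.toLinearMapRingHom (R₁ := ℝ) (M₁ := Eu 4))
    exact (LinearMap.isUnit_iff_isUnit_det _).1 hu2 |>.ne_zero h0
  have hc : ContinuousOn (fun t : ℝ => (ContinuousLinearMap.id ℝ (Eu 4) + t • A).det)
      (Icc 0 1) := by
    apply Continuous.continuousOn
    exact ContinuousLinearMap.continuous_det.comp (by fun_prop)
  by_contra hneg
  have h1 : (0 : ℝ) ∈ Icc ((ContinuousLinearMap.id ℝ (Eu 4) + (1 : ℝ) • A).det)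
      ((ContinuousLinearMap.id ℝ (Eu 4) + (0 : ℝ) • A).det) := by
    refine ⟨by simpa using hneg, ?_⟩
    have h2 : ContinuousLinearMap.id ℝ (Eu 4) + (0 : ℝ) • A = ContinuousLinearMap.id ℝ (Eu 4) := by
      ext1 w; simp
    rw [h2]
    simp [ContinuousLinearMap.det]
  obtain ⟨t, ht, h0⟩ := intermediate_value_Icc' zero_le_one hc h1
  exact hne t ht h0

namespace ScaleField

variable {u : Eu 4 → ℝ} (S : ScaleField u)

/-- The composition of the maps `id + W` over the first `j` scales starting at `ρ`. -/
def flow (ρ : ℝ) : ℕ → Eu 4 → Eu 4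
  | 0, x => x
  | j + 1, x => flow ρ j x + S.W (ρ * S.lam ^ j) (flow ρ j x)

/-- The derivative of the flow. -/
def flowDeriv (ρ : ℝ) : ℕ → Eu 4 → Eu 4 →L[ℝ] Eu 4
  | 0, _ => ContinuousLinearMap.id ℝ (Eu 4)
  | j + 1, x => (ContinuousLinearMap.id ℝ (Eu 4) + S.D (ρ * S.lam ^ j) (S.flow ρ j x)).comp
      (flowDeriv ρ j x)

lemma lam_pos : 0 < S.lam := zero_lt_one.trans S.one_lt_lam

lemma scale_pos {ρ : ℝ} (hρ : 0 < ρ) (j : ℕ) : 0 < ρ * S.lam ^ j :=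
  mul_pos hρ (pow_pos S.lam_pos j)

lemma hasFDerivAt_flow {ρ : ℝ} (hρ : 0 < ρ) (j : ℕ) (x : Eu 4) :
    HasFDerivAt (S.flow ρ j) (S.flowDeriv ρ j x) x := by
  induction j with
  | zero => exact hasFDerivAt_id x
  | succ j ih =>
    have h1 := S.hasFDerivAt_W _ (S.scale_pos hρ j) (S.flow ρ j x)
    exact ((hasFDerivAt_id (S.flow ρ j x)).add h1).comp x ih

lemma det_flowDeriv_pos {ρ : ℝ} (hρ : 0 < ρ) (j : ℕ) (x : Eu 4) :
    0 < (S.flowDeriv ρ j x).det := by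
  induction j with
  | zero => simp [flowDeriv, ContinuousLinearMap.det]
  | succ j ih =>
    have h1 : ‖S.D (ρ * S.lam ^ j) (S.flow ρ j x)‖ < 1 :=
      (S.norm_D_le _ (S.scale_pos hρ j) _).trans_lt (by norm_num)
    have h2 := mul_pos (det_id_add_pos h1) ih
    rwa [ContinuousLinearMap.det, ContinuousLinearMap.det, ← LinearMap.det_comp] at h2

lemma exists_homeomorph_id_add {r : ℝ} (hr : 0 < r) :
    ∃ h : Eu 4 ≃ₜ Eu 4, ∀ x, h x = x + S.W r x := by
  have hl : ∀ x y, ‖S.W r x - S.W r y‖ ≤ 1 / 8 * ‖x - y‖ := by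
    intro x y
    exact convex_univ.norm_image_sub_le_of_norm_hasFDerivWithin_le
      (fun z _ => (S.hasFDerivAt_W r hr z).hasFDerivWithinAt)
      (fun z _ => S.norm_D_le r hr z) (mem_univ y) (mem_univ x)
  have happ : ApproximatesLinearOn (fun x => x + S.W r x)
      ((ContinuousLinearEquiv.refl ℝ (Eu 4) : Eu 4 ≃L[ℝ] Eu 4) : Eu 4 →L[ℝ] Eu 4) univ
      (1 / 8) := by
    intro x _ y _
    have : x + S.W r x - (y + S.W r y) -
        ((ContinuousLinearEquiv.refl ℝ (Eu 4) : Eu 4 ≃L[ℝ] Eu 4) : Eu 4 →L[ℝ] Eu 4) (x - y) =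
        S.W r x - S.W r y := by
      simp; abel
    rw [this]
    simpa using hl x y
  refine ⟨happ.toHomeomorph _ (Or.inr ?_), fun x => rfl⟩
  have hn : ‖((ContinuousLinearEquiv.refl ℝ (Eu 4)).symm : Eu 4 →L[ℝ] Eu 4)‖₊ ≤ 1 :=
    ContinuousLinearMap.norm_id_le
  have hp : 0 < ‖((ContinuousLinearEquiv.refl ℝ (Eu 4)).symm : Eu 4 →L[ℝ] Eu 4)‖₊ := by
    have : ‖ContinuousLinearMap.id ℝ (Eu 4)‖₊ = 1 := by
      ext; simp
    change 0 < ‖ContinuousLinearMap.id ℝ (Eu 4)‖₊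
    rw [this]; exact one_pos
  calc (1 / 8 : NNReal) < 1 := by
        rw [div_lt_one (by norm_num)]; norm_num
    _ ≤ _ := (one_le_inv₀ hp).2 hn

lemma exists_homeomorph_flow {ρ : ℝ} (hρ : 0 < ρ) (j : ℕ) :
    ∃ h : Eu 4 ≃ₜ Eu 4, ∀ x, h x = S.flow ρ j x := by
  induction j with
  | zero => exact ⟨Homeomorph.refl _, fun x => rfl⟩
  | succ j ih =>
    obtain ⟨h, hh⟩ := ih
    obtain ⟨k, hk⟩ := S.exists_homeomorph_id_add (S.scale_pos hρ j)
    refine ⟨h.trans k, fun x => ?_⟩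
    simp [hk, hh, flow]

/-- A bound for the total displacement relative to the final scale. -/
def M : ℝ := S.B / (S.lam - 1)

lemma M_nonneg : 0 ≤ S.M := div_nonneg S.B_nonneg (by linarith [S.one_lt_lam])

lemma norm_flow_sub_le {ρ : ℝ} (hρ : 0 < ρ) (j : ℕ) (x : Eu 4) :
    ‖S.flow ρ j x - x‖ ≤ S.M * (ρ * S.lam ^ j) := by
  have hl : 0 < S.lam - 1 := by linarith [S.one_lt_lam]
  have key : ‖S.flow ρ j x - x‖ ≤ S.M * (ρ * S.lam ^ j - ρ) := by
    induction j with
    | zero => simp [flow]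
    | succ j ih =>
      have h1 := S.norm_W_le _ (S.scale_pos hρ j) (S.flow ρ j x)
      have h2 : S.flow ρ (j + 1) x - x =
        (S.flow ρ j x - x) + S.W (ρ * S.lam ^ j) (S.flow ρ j x) := by
        simp only [flow]; abel
      have h3 : S.M * (S.lam - 1) = S.B := div_mul_cancel₀ _ hl.ne'
      rw [h2]
      refine (norm_add_le _ _).trans ?_
      rw [← h3] at h1
      rw [pow_succ]
      nlinarith
  nlinarith [S.M_nonneg]

/-- The displacement of `x` relative to the current scale. -/
def rel (ρ : ℝ) (j : ℕ) (x : Eu 4) : ℝ := ‖S.flow ρ j x - x‖ / (ρ * S.lam ^ j)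

lemma rel_sum_mul_bounds {ρ : ℝ} (hρ : 0 < ρ) (x : Eu 4) {e : ℝ → Eu 4 → ℝ}
    (he : ∀ j, ‖S.W (ρ * S.lam ^ j) (S.flow ρ j x)‖ ^ 2 ≤
      (ρ * S.lam ^ j) ^ 2 * e (ρ * S.lam ^ j) x) (J : ℕ) :
    S.lam / (S.lam - 1) * S.rel ρ J x ^ 2 + ∑ j ∈ Finset.range J, S.rel ρ j x ^ 2 ≤
      ((S.lam - 1) ^ 2)⁻¹ * ∑ j ∈ Finset.range J, e (ρ * S.lam ^ j) x := by
  have hl : 0 < S.lam - 1 := by linarith [S.one_lt_lam]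
  have hl0 := S.lam_pos
  induction J with
  | zero => simp [rel, flow]
  | succ J ih =>
    rw [Finset.sum_range_succ, Finset.sum_range_succ, mul_add]
    have hr := S.scale_pos hρ J
    set r := ρ * S.lam ^ J with hrdef
    set d := ‖S.flow ρ J x - x‖ with hd
    set w := ‖S.W r (S.flow ρ J x)‖ with hw
    have hw0 : 0 ≤ w := norm_nonneg _
    have hd0 : 0 ≤ d := norm_nonneg _
    have hE := he J
    have hstep : ‖S.flow ρ (J + 1) x - x‖ ≤ d + w := by
      have h2 : S.flow ρ (J + 1) x - x =
        (S.flow ρ J x - x) + S.W r (S.flow ρ J x) := by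
        simp only [flow]; abel
      rw [h2]; exact norm_add_le _ _
    have hsq : ‖S.flow ρ (J + 1) x - x‖ ^ 2 ≤ (d + w) ^ 2 := by gcongr
    have hyoung : (d + w) ^ 2 ≤ S.lam * d ^ 2 + S.lam / (S.lam - 1) * w ^ 2 := by
      have : S.lam * d ^ 2 + S.lam / (S.lam - 1) * w ^ 2 - (d + w) ^ 2 =
          ((S.lam - 1) * d - w) ^ 2 / (S.lam - 1) := by
        field_simp; ring
      have h2 : 0 ≤ ((S.lam - 1) * d - w) ^ 2 / (S.lam - 1) := by positivity
      linarith
    have hrel : S.rel ρ (J + 1) x ^ 2 =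
        ‖S.flow ρ (J + 1) x - x‖ ^ 2 / (S.lam * r) ^ 2 := by
      rw [rel, div_pow]; congr 2; rw [hrdef, pow_succ]; ring
    have hrelJ : S.rel ρ J x ^ 2 = d ^ 2 / r ^ 2 := by rw [rel, div_pow]
    have hb : S.lam / (S.lam - 1) * S.rel ρ (J + 1) x ^ 2 ≤
        (S.lam - 1)⁻¹ * (d ^ 2 / r ^ 2) + ((S.lam - 1) ^ 2)⁻¹ * e r x := by
      rw [hrel]
      have h3 : ‖S.flow ρ (J + 1) x - x‖ ^ 2 ≤
          S.lam * d ^ 2 + S.lam / (S.lam - 1) * (r ^ 2 * e r x) := by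
        refine hsq.trans (hyoung.trans ?_)
        gcongr
      calc S.lam / (S.lam - 1) * (‖S.flow ρ (J + 1) x - x‖ ^ 2 / (S.lam * r) ^ 2)
          ≤ S.lam / (S.lam - 1) * ((S.lam * d ^ 2 + S.lam / (S.lam - 1) *
            (r ^ 2 * e r x)) / (S.lam * r) ^ 2) := by gcongr
        _ = _ := by field_simp
    have hid : S.lam / (S.lam - 1) * (d ^ 2 / r ^ 2) =
        (S.lam - 1)⁻¹ * (d ^ 2 / r ^ 2) + d ^ 2 / r ^ 2 := by
      field_simp; ring
    rw [hrelJ] at ih ⊢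
    linarith

lemma rel_sum_le {ρ : ℝ} (hρ : 0 < ρ) (x : Eu 4) {e : ℝ → Eu 4 → ℝ} {C : ℝ}
    (he : ∀ j, ‖S.W (ρ * S.lam ^ j) (S.flow ρ j x)‖ ^ 2 ≤
      (ρ * S.lam ^ j) ^ 2 * e (ρ * S.lam ^ j) x)
    (hC : ∀ J : ℕ, ∑ j ∈ Finset.range J, e (ρ * S.lam ^ j) x ≤ C) (J : ℕ) :
    ∑ j ∈ Finset.range J, S.rel ρ j x ^ 2 ≤ ((S.lam - 1) ^ 2)⁻¹ * C := by
  have hl : 0 < S.lam - 1 := by linarith [S.one_lt_lam]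
  have h := S.rel_sum_mul_bounds hρ x he J
  have h0 : 0 ≤ S.lam / (S.lam - 1) * S.rel ρ J x ^ 2 := by
    have := S.lam_pos
    positivity
  have h1 : ((S.lam - 1) ^ 2)⁻¹ * ∑ j ∈ Finset.range J, e (ρ * S.lam ^ j) x ≤
      ((S.lam - 1) ^ 2)⁻¹ * C := by
    gcongr
    exact hC J
  linarith

end ScaleField

lemma exp_sub_le_one_add {t y : ℝ} (ht : |t| ≤ 1 / 8) (hy0 : 0 ≤ y) (hy : y ≤ 1 / 4) :
    Real.exp (t - 4 * t ^ 2 - 2 * y) ≤ 1 + t - y := by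
  have ht' := abs_le.1 ht
  have hp : 0 < 1 + t - y := by linarith
  rw [← Real.le_log_iff_exp_le hp]
  refine le_trans ?_ (Real.one_sub_inv_le_log_of_pos hp)
  have h1 : 1 - (1 + t - y)⁻¹ = (t - y) / (1 + t - y) := by
    field_simp; ring
  rw [h1]
  have h2 : t - y - 2 * (t - y) ^ 2 ≤ (t - y) / (1 + t - y) := by
    rw [le_div_iff₀ hp]
    nlinarith [mul_nonneg (sq_nonneg (t - y)) (by linarith : 0 ≤ 1 + 2 * (t - y))]
  nlinarith [sq_nonneg (t + y)]

lemma one_add_add_le_exp (t y : ℝ) : 1 + t + y ≤ Real.exp (t + y) := by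
  linarith [Real.add_one_le_exp (t + y)]

lemma norm_id_add_apply_bounds {D : Eu 4 →L[ℝ] Eu 4} {t y : ℝ} (ht : |t| ≤ 1 / 8)
    (hy : y ≤ 1 / 4) (hD : ‖D - t • ContinuousLinearMap.id ℝ (Eu 4)‖ ≤ y) (h : Eu 4) :
    Real.exp (t - 4 * t ^ 2 - 2 * y) * ‖h‖ ≤ ‖h + D h‖ ∧
      ‖h + D h‖ ≤ Real.exp (t + y) * ‖h‖ := by
  have hy0 : 0 ≤ y := (norm_nonneg _).trans hD
  have ht' := abs_le.1 ht
  have h1 : ‖D h - t • h‖ ≤ y * ‖h‖ := by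
    have := (D - t • ContinuousLinearMap.id ℝ (Eu 4)).le_of_opNorm_le hD h
    simpa using this
  have h2 : h + D h = (1 + t) • h + (D h - t • h) := by
    rw [add_smul, one_smul]; abel
  have h3 : ‖(1 + t) • h‖ = (1 + t) * ‖h‖ := by
    rw [norm_smul, Real.norm_of_nonneg (by linarith)]
  constructor
  · calc Real.exp (t - 4 * t ^ 2 - 2 * y) * ‖h‖ ≤ (1 + t - y) * ‖h‖ := by
          gcongr; exact exp_sub_le_one_add ht hy0 hy
      _ ≤ ‖(1 + t) • h‖ - ‖D h - t • h‖ := by rw [h3]; linarith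
      _ ≤ ‖h + D h‖ := by rw [h2]; exact norm_sub_le_norm_add _ _
  · calc ‖h + D h‖ ≤ ‖(1 + t) • h‖ + ‖D h - t • h‖ := by rw [h2]; exact norm_add_le _ _
      _ ≤ (1 + t + y) * ‖h‖ := by rw [h3]; linarith
      _ ≤ _ := by gcongr; exact one_add_add_le_exp t y

namespace ScaleField

variable {u : Eu 4 → ℝ} (S : ScaleField u)

/-- The increment of the averages of `u` between consecutive scales. -/
def step (ρ : ℝ) (j : ℕ) (x : Eu 4) : ℝ :=
  S.U (ρ * S.lam ^ j) x - S.U (ρ * S.lam ^ (j + 1)) x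

lemma step_eq (ρ : ℝ) (j : ℕ) (x : Eu 4) :
    S.step ρ j x = S.U (ρ * S.lam ^ j) x - S.U (S.lam * (ρ * S.lam ^ j)) x := by
  rw [step, pow_succ]; congr 2; ring

lemma abs_step {ρ : ℝ} (hρ : 0 < ρ) (j : ℕ) (x : Eu 4) : |S.step ρ j x| ≤ 1 / 8 := by
  rw [step_eq]; exact S.abs_step_le _ (S.scale_pos hρ j) x

lemma sum_step (ρ : ℝ) (J : ℕ) (x : Eu 4) :
    ∑ j ∈ Finset.range J, S.step ρ j x = S.U ρ x - S.U (ρ * S.lam ^ J) x := by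
  have := Finset.sum_range_sub' (fun j => S.U (ρ * S.lam ^ j) x) J
  simpa [step] using this

/-- The deviation of the derivative along the flow from a homothety. -/
def dev (ρ : ℝ) (j : ℕ) (x : Eu 4) : ℝ :=
  ‖S.D (ρ * S.lam ^ j) (S.flow ρ j x) - S.step ρ j x • ContinuousLinearMap.id ℝ (Eu 4)‖

lemma dev_nonneg (ρ : ℝ) (j : ℕ) (x : Eu 4) : 0 ≤ S.dev ρ j x := norm_nonneg _

lemma dev_le {ρ : ℝ} (hρ : 0 < ρ) (j : ℕ) (x : Eu 4) : S.dev ρ j x ≤ 1 / 4 := by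
  have h1 := S.norm_D_le _ (S.scale_pos hρ j) (S.flow ρ j x)
  have h2 : ‖S.step ρ j x • ContinuousLinearMap.id ℝ (Eu 4)‖ ≤ 1 / 8 := by
    rw [norm_smul, Real.norm_eq_abs]
    calc |S.step ρ j x| * ‖ContinuousLinearMap.id ℝ (Eu 4)‖ ≤ 1 / 8 * 1 :=
          mul_le_mul (S.abs_step hρ j x) ContinuousLinearMap.norm_id_le (norm_nonneg _)
            (by norm_num)
      _ = 1 / 8 := mul_one _
  exact (norm_sub_le _ _).trans (by linarith)

lemma exists_sum_rel_le : ∀ Q, S.M ≤ Q → ∃ C, 0 ≤ C ∧ ∃ e : ℝ → Eu 4 → ℝ, (∀ r p, 0 ≤ e r p) ∧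
    (∀ ρ, 0 < ρ → ∀ (J : ℕ) p, ∑ j ∈ Finset.range J, e (ρ * S.lam ^ j) p ≤ C) ∧
    (∀ ρ, 0 < ρ → ∀ (J : ℕ) p, ∑ j ∈ Finset.range J, S.step ρ j p ^ 2 ≤ C) ∧
    (∀ ρ, 0 < ρ → ∀ (J : ℕ) p, ∑ j ∈ Finset.range J, S.rel ρ j p ^ 2 ≤ C) ∧
    ∀ r, 0 < r → ∀ z p, ‖z - p‖ ≤ Q * r →
      ‖S.D r z - (S.U r p - S.U (S.lam * r) p) • ContinuousLinearMap.id ℝ (Eu 4)‖ ≤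
        e r p + C * (‖z - p‖ / r) ^ 2 := by
  intro Q hQ
  have hQ0 : 0 ≤ Q := S.M_nonneg.trans hQ
  obtain ⟨C, hC0, e, he0, hes, hsq, hWD⟩ := S.exists_error Q hQ0
  have hl : 0 < S.lam - 1 := by linarith [S.one_lt_lam]
  have hK : 0 ≤ ((S.lam - 1) ^ 2)⁻¹ := by positivity
  have hle : C ≤ (((S.lam - 1) ^ 2)⁻¹ + 1) * C := by nlinarith
  refine ⟨(((S.lam - 1) ^ 2)⁻¹ + 1) * C, by positivity, e, he0,
    fun ρ hρ J p => (hes ρ hρ J p).trans hle, fun ρ hρ J p => ?_, fun ρ hρ J p => ?_,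
    fun r hr z p hz => ?_⟩
  · refine (Finset.sum_le_sum fun j _ => ?_).trans ((hes ρ hρ J p).trans hle)
    rw [step_eq]; exact hsq _ (S.scale_pos hρ j) p
  · refine (S.rel_sum_le hρ p (e := e) (fun j => ?_) (fun J => hes ρ hρ J p) J).trans ?_
    · refine (hWD _ (S.scale_pos hρ j) _ p ?_).1
      exact (S.norm_flow_sub_le hρ j p).trans (by have := S.scale_pos hρ j; gcongr)
    · nlinarith
  · refine ((hWD r hr z p hz).2).trans ?_
    gcongr

lemma exists_sum_dev_le : ∃ C, 0 ≤ C ∧ ∀ ρ, 0 < ρ → ∀ (J : ℕ) x,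
    ∑ j ∈ Finset.range J, S.step ρ j x ^ 2 ≤ C ∧ ∑ j ∈ Finset.range J, S.dev ρ j x ≤ C := by
  obtain ⟨C, hC0, e, he0, hes, hst, hrel, hD⟩ := S.exists_sum_rel_le S.M le_rfl
  refine ⟨C + C * C, by positivity, fun ρ hρ J x => ⟨(hst ρ hρ J x).trans (by nlinarith), ?_⟩⟩
  have h1 : ∀ j, S.dev ρ j x ≤ e (ρ * S.lam ^ j) x + C * S.rel ρ j x ^ 2 := by
    intro j
    have := hD _ (S.scale_pos hρ j) _ x (S.norm_flow_sub_le hρ j x)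
    rwa [← step_eq] at this
  calc ∑ j ∈ Finset.range J, S.dev ρ j x
      ≤ ∑ j ∈ Finset.range J, (e (ρ * S.lam ^ j) x + C * S.rel ρ j x ^ 2) :=
        Finset.sum_le_sum fun j _ => h1 j
    _ = ∑ j ∈ Finset.range J, e (ρ * S.lam ^ j) x +
        C * ∑ j ∈ Finset.range J, S.rel ρ j x ^ 2 := by
        rw [Finset.sum_add_distrib, Finset.mul_sum]
    _ ≤ C + C * C := by
        have := hes ρ hρ J x
        have := hrel ρ hρ J x
        gcongr

lemma norm_flowDeriv_bounds {ρ : ℝ} (hρ : 0 < ρ) (J : ℕ) (x h : Eu 4) :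
    Real.exp (∑ j ∈ Finset.range J, (S.step ρ j x - 4 * S.step ρ j x ^ 2 - 2 * S.dev ρ j x)) *
        ‖h‖ ≤ ‖S.flowDeriv ρ J x h‖ ∧
      ‖S.flowDeriv ρ J x h‖ ≤
        Real.exp (∑ j ∈ Finset.range J, (S.step ρ j x + S.dev ρ j x)) * ‖h‖ := by
  induction J with
  | zero => simp [flowDeriv]
  | succ J ih =>
    have hb := norm_id_add_apply_bounds (S.abs_step hρ J x) (S.dev_le hρ J x) le_rfl
      (S.flowDeriv ρ J x h)
    have he : S.flowDeriv ρ (J + 1) x h = S.flowDeriv ρ J x h +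
      S.D (ρ * S.lam ^ J) (S.flow ρ J x) (S.flowDeriv ρ J x h) := rfl
    rw [Finset.sum_range_succ, Finset.sum_range_succ, he,
      add_comm (∑ j ∈ Finset.range J, _), add_comm (∑ j ∈ Finset.range J, (_ + _)),
      Real.exp_add, Real.exp_add, mul_assoc, mul_assoc]
    exact ⟨le_trans (by gcongr; exact ih.1) hb.1, hb.2.trans (by gcongr; exact ih.2)⟩

lemma exists_flowDeriv_bounds : ∃ C, 0 ≤ C ∧ ∀ ρ, 0 < ρ → ∀ (J : ℕ) x h,
    Real.exp (S.U ρ x - S.U (ρ * S.lam ^ J) x - C) * ‖h‖ ≤ ‖S.flowDeriv ρ J x h‖ ∧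
      ‖S.flowDeriv ρ J x h‖ ≤ Real.exp (S.U ρ x - S.U (ρ * S.lam ^ J) x + C) * ‖h‖ := by
  obtain ⟨C, hC0, hC⟩ := S.exists_sum_dev_le
  refine ⟨6 * C, by positivity, fun ρ hρ J x h => ?_⟩
  obtain ⟨h1, h2⟩ := S.norm_flowDeriv_bounds hρ J x h
  obtain ⟨h3, h4⟩ := hC ρ hρ J x
  rw [Finset.sum_sub_distrib, Finset.sum_sub_distrib, ← Finset.mul_sum, ← Finset.mul_sum,
    S.sum_step] at h1
  rw [Finset.sum_add_distrib, S.sum_step] at h2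
  refine ⟨le_trans ?_ h1, h2.trans ?_⟩ <;>
    refine mul_le_mul_of_nonneg_right (Real.exp_le_exp.2 ?_) (norm_nonneg h) <;> linarith

end ScaleField

namespace ScaleField

variable {u : Eu 4 → ℝ} (S : ScaleField u)

lemma exists_abs_U_sub_le {δ : ℝ} (hδ : 0 < δ) : ∃ C, 0 ≤ C ∧ ∀ ρ, 0 < ρ → ∀ (a : ℕ) x,
    |S.U ρ x - S.U (ρ * S.lam ^ a) x| ≤ δ * a + C := by
  obtain ⟨C, hC0, hC⟩ := S.exists_sum_dev_le
  refine ⟨(4 * δ)⁻¹ * C, by positivity, fun ρ hρ a x => ?_⟩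
  rw [← S.sum_step]
  calc |∑ j ∈ Finset.range a, S.step ρ j x| ≤ ∑ j ∈ Finset.range a, |S.step ρ j x| :=
        Finset.abs_sum_le_sum_abs _ _
    _ ≤ ∑ j ∈ Finset.range a, (δ + (4 * δ)⁻¹ * S.step ρ j x ^ 2) := by
        refine Finset.sum_le_sum fun j _ => ?_
        rw [← sq_abs (S.step ρ j x)]
        have h1 : δ + (4 * δ)⁻¹ * |S.step ρ j x| ^ 2 - |S.step ρ j x| =
            (4 * δ)⁻¹ * (2 * δ - |S.step ρ j x|) ^ 2 := by
          field_simp; ring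
        have h2 : 0 ≤ (4 * δ)⁻¹ * (2 * δ - |S.step ρ j x|) ^ 2 := by positivity
        linarith
    _ = δ * a + (4 * δ)⁻¹ * ∑ j ∈ Finset.range a, S.step ρ j x ^ 2 := by
        rw [Finset.sum_add_distrib, Finset.mul_sum]; simp; ring
    _ ≤ _ := by
        have := (hC ρ hρ a x).1
        gcongr

lemma exists_abs_U_le_of_le_one (R : ℝ) : ∃ K, 0 ≤ K ∧ ∀ r, 0 ≤ r → r ≤ 1 → ∀ x, ‖x‖ ≤ R →
    |S.U r x| ≤ K := by
  have hc : IsCompact (Icc (0 : ℝ) 1 ×ˢ closedBall (0 : Eu 4) R) :=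
    isCompact_Icc.prod (isCompact_closedBall 0 R)
  obtain ⟨K, hK⟩ := hc.exists_bound_of_continuousOn S.continuous_U.continuousOn
  refine ⟨max K 0, le_max_right _ _, fun r h0 h1 x hx => ?_⟩
  exact (hK (r, x) ⟨⟨h0, h1⟩, by simpa using hx⟩).trans (le_max_left _ _)

/-- The initial scale of the `N`-th approximation. -/
def sc (N : ℕ) : ℝ := S.lam⁻¹ ^ N

lemma sc_pos (N : ℕ) : 0 < S.sc N := pow_pos (inv_pos.2 S.lam_pos) N

lemma sc_mul_add (N k : ℕ) : S.sc N * S.lam ^ (N + k) = S.lam ^ k := by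
  rw [sc, pow_add, ← mul_assoc, ← mul_pow, inv_mul_cancel₀ S.lam_pos.ne', one_pow, one_mul]

lemma sc_mul_le_one {N j : ℕ} (h : j ≤ N) : S.sc N * S.lam ^ j ≤ 1 := by
  have h1 : S.sc N * S.lam ^ N = 1 := by simpa using S.sc_mul_add N 0
  rw [← h1]
  have := S.sc_pos N
  gcongr
  exact S.one_lt_lam.le

lemma sc_le_one (N : ℕ) : S.sc N ≤ 1 := by
  simpa using S.sc_mul_le_one (Nat.zero_le N)

lemma exists_abs_U_le {δ : ℝ} (hδ : 0 < δ) (R : ℝ) : ∃ K, 0 ≤ K ∧ ∀ x, ‖x‖ ≤ R → ∀ N j : ℕ,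
    |S.U (S.sc N * S.lam ^ j) x| ≤ K + δ * ((j - N : ℕ) : ℝ) := by
  obtain ⟨C, hC0, hC⟩ := S.exists_abs_U_sub_le hδ
  obtain ⟨K, hK0, hK⟩ := S.exists_abs_U_le_of_le_one R
  refine ⟨K + C, by positivity, fun x hx N j => ?_⟩
  rcases le_total j N with h | h
  · have := hK _ (S.scale_pos (S.sc_pos N) j).le (S.sc_mul_le_one h) x hx
    have h2 : 0 ≤ δ * ((j - N : ℕ) : ℝ) := by positivity
    linarith
  · obtain ⟨k, rfl⟩ := Nat.exists_eq_add_of_le h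
    rw [S.sc_mul_add, Nat.add_sub_cancel_left]
    have h1 := hK 1 zero_le_one le_rfl x hx
    have h2 := hC 1 one_pos k x
    rw [one_mul] at h2
    have h3 := abs_sub_abs_le_abs_sub (S.U (S.lam ^ k) x) (S.U 1 x)
    rw [abs_sub_comm] at h3
    linarith

/-- The accumulated logarithmic expansion along the flow. -/
def growth (ρ : ℝ) (J : ℕ) (x : Eu 4) : ℝ :=
  ∑ j ∈ Finset.range J, (S.step ρ j x + S.dev ρ j x)

lemma exists_growth_bounds : ∃ C, 0 ≤ C ∧ ∀ ρ, 0 < ρ → ∀ (J : ℕ) x,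
    S.U ρ x - S.U (ρ * S.lam ^ J) x ≤ S.growth ρ J x ∧
      S.growth ρ J x ≤ S.U ρ x - S.U (ρ * S.lam ^ J) x + C := by
  obtain ⟨C, hC0, hC⟩ := S.exists_sum_dev_le
  refine ⟨C, hC0, fun ρ hρ J x => ?_⟩
  rw [growth, Finset.sum_add_distrib, S.sum_step]
  have h1 := (hC ρ hρ J x).2
  have h2 := Finset.sum_nonneg fun j (_ : j ∈ Finset.range J) => S.dev_nonneg ρ j x
  constructor <;> linarith

lemma norm_id_add_le {ρ : ℝ} (hρ : 0 < ρ) (j : ℕ) (x : Eu 4) :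
    ‖ContinuousLinearMap.id ℝ (Eu 4) + S.D (ρ * S.lam ^ j) (S.flow ρ j x)‖ ≤
      Real.exp (S.step ρ j x + S.dev ρ j x) :=
  ContinuousLinearMap.opNorm_le_bound _ (Real.exp_pos _).le fun h =>
    (norm_id_add_apply_bounds (S.abs_step hρ j x) (S.dev_le hρ j x) le_rfl h).2

lemma norm_flowDeriv_le {ρ : ℝ} (hρ : 0 < ρ) (j : ℕ) (x : Eu 4) :
    ‖S.flowDeriv ρ j x‖ ≤ Real.exp (S.growth ρ j x) :=
  ContinuousLinearMap.opNorm_le_bound _ (Real.exp_pos _).le fun h =>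
    (S.norm_flowDeriv_bounds hρ j x h).2

lemma norm_flowDeriv_sub_le {ρ : ℝ} (hρ : 0 < ρ) (J : ℕ) (a b : Eu 4) :
    ‖S.flowDeriv ρ J a - S.flowDeriv ρ J b‖ ≤ Real.exp (S.growth ρ J a) *
      ∑ j ∈ Finset.range J, Real.exp (-S.growth ρ (j + 1) a) *
        (‖S.D (ρ * S.lam ^ j) (S.flow ρ j a) - S.D (ρ * S.lam ^ j) (S.flow ρ j b)‖ *
          ‖S.flowDeriv ρ j b‖) := by
  induction J with
  | zero => simp [flowDeriv]
  | succ J ih =>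
    set X := ‖S.D (ρ * S.lam ^ J) (S.flow ρ J a) - S.D (ρ * S.lam ^ J) (S.flow ρ J b)‖ *
          ‖S.flowDeriv ρ J b‖ with hX
    have h1 : S.flowDeriv ρ (J + 1) a - S.flowDeriv ρ (J + 1) b =
        (ContinuousLinearMap.id ℝ (Eu 4) + S.D (ρ * S.lam ^ J) (S.flow ρ J a)).comp
          (S.flowDeriv ρ J a - S.flowDeriv ρ J b) +
        (S.D (ρ * S.lam ^ J) (S.flow ρ J a) - S.D (ρ * S.lam ^ J) (S.flow ρ J b)).comp
          (S.flowDeriv ρ J b) := by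
      ext1 w
      simp [flowDeriv]
      abel
    have hg : S.growth ρ (J + 1) a = S.step ρ J a + S.dev ρ J a + S.growth ρ J a := by
      rw [growth, Finset.sum_range_succ, add_comm]; rfl
    rw [h1, Finset.sum_range_succ, mul_add]
    have h2 : Real.exp (S.growth ρ (J + 1) a) * (Real.exp (-S.growth ρ (J + 1) a) * X) = X := by
      rw [← mul_assoc, ← Real.exp_add, add_neg_cancel, Real.exp_zero, one_mul]
    rw [h2]
    refine (norm_add_le _ _).trans (add_le_add ?_ (ContinuousLinearMap.opNorm_comp_le _ _))
    refine (ContinuousLinearMap.opNorm_comp_le _ _).trans ?_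
    rw [hg, Real.exp_add, mul_assoc]
    exact mul_le_mul (S.norm_id_add_le hρ J a) ih (norm_nonneg _) (Real.exp_pos _).le

lemma sum_scale_le (N : ℕ) : ∑ j ∈ Finset.range N, S.sc N * S.lam ^ j ≤ (S.lam - 1)⁻¹ := by
  have hl : 0 < S.lam - 1 := by linarith [S.one_lt_lam]
  have h1 : S.sc N * S.lam ^ N = 1 := by simpa using S.sc_mul_add N 0
  rw [← Finset.mul_sum, geom_sum_eq S.one_lt_lam.ne', ← mul_div_assoc, mul_sub, h1,
    div_eq_mul_inv]
  refine mul_le_of_le_one_left (inv_nonneg.2 hl.le) ?_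
  linarith [S.sc_pos N]

/-- The normalised approximating map. -/
def approx (N : ℕ) (x : Eu 4) : Eu 4 :=
  Real.exp (S.U (S.sc N * S.lam ^ (N + N)) 0) •
    (S.flow (S.sc N) (N + N) x - S.flow (S.sc N) (N + N) 0)

/-- The derivative of the normalised approximating map. -/
def approxDeriv (N : ℕ) (x : Eu 4) : Eu 4 →L[ℝ] Eu 4 :=
  Real.exp (S.U (S.sc N * S.lam ^ (N + N)) 0) • S.flowDeriv (S.sc N) (N + N) x

lemma norm_flow_sub_flow_le {ρ R E : ℝ} (hρ : 0 < ρ) {j : ℕ}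
    (hE : ∀ x, ‖x‖ ≤ R → ‖S.flowDeriv ρ j x‖ ≤ E) {a b : Eu 4} (ha : ‖a‖ ≤ R) (hb : ‖b‖ ≤ R) :
    ‖S.flow ρ j a - S.flow ρ j b‖ ≤ E * ‖a - b‖ :=
  (convex_closedBall (0 : Eu 4) R).norm_image_sub_le_of_norm_hasFDerivWithin_le
    (fun z _ => (S.hasFDerivAt_flow hρ j z).hasFDerivWithinAt)
    (fun z hz => hE z (by simpa using hz)) (by simpa using hb) (by simpa using ha)

lemma exists_flowDeriv_sub_le (R : ℝ) (hR : 0 ≤ R) : ∃ L, 0 ≤ L ∧ ∀ N a b, ‖a‖ ≤ R → ‖b‖ ≤ R →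
    ‖S.flowDeriv (S.sc N) (N + N) a - S.flowDeriv (S.sc N) (N + N) b‖ ≤
      Real.exp (S.growth (S.sc N) (N + N) a) * (L * ‖a - b‖) := by
  have hl1 := S.one_lt_lam
  have hl := S.lam_pos
  have hll : 0 < Real.log S.lam := Real.log_pos hl1
  set δ := Real.log S.lam / 6 with hδdef
  have hδ : 0 < δ := by positivity
  obtain ⟨C, hC0, hC⟩ := S.exists_growth_bounds
  obtain ⟨K, hK0, hK⟩ := S.exists_abs_U_le hδ R
  obtain ⟨L₁, hL₁0, hL₁⟩ := S.exists_lip_of_le_one (R + S.M) (add_nonneg hR S.M_nonneg)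
  obtain ⟨L₂, hL₂0, hL₂⟩ := S.exists_lip
  set E : ℕ → ℝ := fun k => Real.exp (2 * K + C + δ + δ * k) with hE
  have hE0 : ∀ k, 0 ≤ E k := fun k => (Real.exp_pos _).le
  have hU : ∀ N j x, ‖x‖ ≤ R →
      |S.U (S.sc N) x - S.U (S.sc N * S.lam ^ j) x| ≤ 2 * K + δ * ((j - N : ℕ) : ℝ) := by
    intro N j x hx
    have h1 := hK x hx N 0
    have h2 := hK x hx N j
    simp only [pow_zero, mul_one, Nat.zero_sub, Nat.cast_zero, mul_zero, add_zero] at h1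
    have := abs_sub (S.U (S.sc N) x) (S.U (S.sc N * S.lam ^ j) x)
    linarith
  have hDE : ∀ N j x, ‖x‖ ≤ R → ‖S.flowDeriv (S.sc N) j x‖ ≤ E (j - N) := by
    intro N j x hx
    refine (S.norm_flowDeriv_le (S.sc_pos N) j x).trans (Real.exp_le_exp.2 ?_)
    have h1 := (hC _ (S.sc_pos N) j x).2
    have h2 := (abs_le.1 (hU N j x hx)).2
    linarith
  have hgE : ∀ N j x, ‖x‖ ≤ R → Real.exp (-S.growth (S.sc N) (j + 1) x) ≤ E (j - N) := by
    intro N j x hx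
    refine Real.exp_le_exp.2 ?_
    have h1 := (hC _ (S.sc_pos N) (j + 1) x).1
    have h2 := (abs_le.1 (hU N (j + 1) x hx)).1
    have h3 : ((j + 1 - N : ℕ) : ℝ) ≤ ((j - N : ℕ) : ℝ) + 1 := by
      exact_mod_cast (by omega : j + 1 - N ≤ j - N + 1)
    nlinarith
  have hterm : ∀ N j a b T, ‖a‖ ≤ R → ‖b‖ ≤ R → 0 ≤ T →
      ‖S.D (S.sc N * S.lam ^ j) (S.flow (S.sc N) j a) -
        S.D (S.sc N * S.lam ^ j) (S.flow (S.sc N) j b)‖ ≤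
          T * ‖S.flow (S.sc N) j a - S.flow (S.sc N) j b‖ →
      Real.exp (-S.growth (S.sc N) (j + 1) a) *
        (‖S.D (S.sc N * S.lam ^ j) (S.flow (S.sc N) j a) -
          S.D (S.sc N * S.lam ^ j) (S.flow (S.sc N) j b)‖ * ‖S.flowDeriv (S.sc N) j b‖) ≤
        T * E (j - N) ^ 3 * ‖a - b‖ := by
    intro N j a b T ha hb hT hD
    have h1 := S.norm_flow_sub_flow_le (S.sc_pos N) (hDE N j) ha hb
    calc _ ≤ E (j - N) * (T * (E (j - N) * ‖a - b‖) * E (j - N)) := by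
          refine mul_le_mul (hgE N j a ha) ?_ (by positivity) (hE0 _)
          refine mul_le_mul (hD.trans ?_) (hDE N j b hb) (norm_nonneg _) ?_
          · gcongr
          · have := hE0 (j - N)
            positivity
      _ = _ := by ring
  have hE3 : ∀ k, E k ^ 3 = E 0 ^ 3 * Real.exp (3 * δ) ^ k := by
    intro k
    simp only [hE]
    rw [← Real.exp_nat_mul, ← Real.exp_nat_mul, ← Real.exp_nat_mul, ← Real.exp_add]
    congr 1; push_cast; ring
  set q := S.lam⁻¹ * Real.exp (3 * δ) with hq
  have hq0 : 0 ≤ q := by positivity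
  have hq1 : q < 1 := by
    rw [hq, inv_mul_lt_one₀ hl]
    calc Real.exp (3 * δ) < Real.exp (Real.log S.lam) := by
          rw [Real.exp_lt_exp, hδdef]; linarith
      _ = S.lam := Real.exp_log hl
  refine ⟨L₁ * E 0 ^ 3 * (S.lam - 1)⁻¹ + L₂ * E 0 ^ 3 * (1 - q)⁻¹, ?_, fun N a b ha hb => ?_⟩
  · have := hE0 0
    have h1 : 0 < S.lam - 1 := by linarith
    have h2 : 0 < 1 - q := by linarith
    positivity
  refine (S.norm_flowDeriv_sub_le (S.sc_pos N) (N + N) a b).trans ?_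
  gcongr
  rw [Finset.sum_range_add, add_mul]
  refine add_le_add ?_ ?_
  · calc _ ≤ ∑ j ∈ Finset.range N, L₁ * E 0 ^ 3 * ‖a - b‖ * (S.sc N * S.lam ^ j) := by
          refine Finset.sum_le_sum fun j hj => ?_
          have hjN := (Finset.mem_range.1 hj).le
          have hr := S.scale_pos (S.sc_pos N) j
          have hr1 := S.sc_mul_le_one hjN
          have hfl : ∀ x, ‖x‖ ≤ R → ‖S.flow (S.sc N) j x‖ ≤ R + S.M := by
            intro x hx
            have h1 := S.norm_flow_sub_le (S.sc_pos N) j x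
            have h2 : S.M * (S.sc N * S.lam ^ j) ≤ S.M * 1 := by
              have := S.M_nonneg; gcongr
            have h3 := norm_le_norm_add_norm_sub' (S.flow (S.sc N) j x) x
            linarith
          have := hterm N j a b (L₁ * (S.sc N * S.lam ^ j)) ha hb (by positivity)
            (hL₁ _ hr hr1 _ _ (hfl a ha) (hfl b hb))
          rw [Nat.sub_eq_zero_of_le hjN] at this
          refine this.trans (le_of_eq ?_)
          ring
      _ = L₁ * E 0 ^ 3 * ‖a - b‖ * ∑ j ∈ Finset.range N, S.sc N * S.lam ^ j := by
          rw [Finset.mul_sum]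
      _ ≤ L₁ * E 0 ^ 3 * ‖a - b‖ * (S.lam - 1)⁻¹ := by
          have := S.sum_scale_le N
          have := hE0 0
          gcongr
      _ = _ := by ring
  · calc _ ≤ ∑ k ∈ Finset.range N, L₂ * E 0 ^ 3 * ‖a - b‖ * q ^ k := by
          refine Finset.sum_le_sum fun k _ => ?_
          have hr := S.scale_pos (S.sc_pos N) (N + k)
          have := hterm N (N + k) a b (L₂ * (S.sc N * S.lam ^ (N + k))⁻¹) ha hb (by positivity)
            (hL₂ _ hr _ _)
          refine this.trans (le_of_eq ?_)
          rw [Nat.add_sub_cancel_left, hE3, S.sc_mul_add, hq, mul_pow, inv_pow]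
          ring
      _ = L₂ * E 0 ^ 3 * ‖a - b‖ * ∑ k ∈ Finset.range N, q ^ k := by
          rw [Finset.mul_sum]
      _ ≤ L₂ * E 0 ^ 3 * ‖a - b‖ * (1 - q)⁻¹ := by
          have h1 : ∑ k ∈ Finset.range N, q ^ k ≤ (1 - q)⁻¹ := by
            rw [← tsum_geometric_of_lt_one hq0 hq1]
            exact (summable_geometric_of_lt_one hq0 hq1).sum_le_tsum _
              fun k _ => pow_nonneg hq0 k
          have := hE0 0
          gcongr
      _ = _ := by ring

end ScaleField

namespace ScaleField

variable {u : Eu 4 → ℝ} (S : ScaleField u)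

lemma sc_mul_two (N : ℕ) : S.sc N * S.lam ^ (N + N) = S.lam ^ N := S.sc_mul_add N N

lemma hasFDerivAt_approx (N : ℕ) (x : Eu 4) :
    HasFDerivAt (S.approx N) (S.approxDeriv N x) x :=
  ((S.hasFDerivAt_flow (S.sc_pos N) (N + N) x).sub_const _).fun_const_smul _

lemma approx_zero (N : ℕ) : S.approx N 0 = 0 := by simp [approx]

lemma exists_homeomorph_approx (N : ℕ) : ∃ h : Eu 4 ≃ₜ Eu 4, ∀ x, h x = S.approx N x := by
  obtain ⟨h, hh⟩ := S.exists_homeomorph_flow (S.sc_pos N) (N + N)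
  refine ⟨(h.trans (Homeomorph.subRight (S.flow (S.sc N) (N + N) 0))).trans
    (Homeomorph.smulOfNeZero _ (Real.exp_pos (S.U (S.sc N * S.lam ^ (N + N)) 0)).ne'),
    fun x => ?_⟩
  simp [hh, approx]

lemma det_approxDeriv_pos (N : ℕ) (x : Eu 4) : 0 < (S.approxDeriv N x).det := by
  have h1 := S.det_flowDeriv_pos (S.sc_pos N) (N + N) x
  rw [approxDeriv, ContinuousLinearMap.det, ContinuousLinearMap.toLinearMap_smul,
    LinearMap.det_smul]
  exact mul_pos (pow_pos (Real.exp_pos _) _) h1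

/-- The logarithm of the expansion of the approximating map. -/
def logFactor (N : ℕ) (x : Eu 4) : ℝ :=
  S.U (S.sc N) x - S.U (S.lam ^ N) x + S.U (S.lam ^ N) 0

lemma exists_approxDeriv_bounds : ∃ C, 0 ≤ C ∧ ∀ N x h,
    Real.exp (S.logFactor N x - C) * ‖h‖ ≤ ‖S.approxDeriv N x h‖ ∧
      ‖S.approxDeriv N x h‖ ≤ Real.exp (S.logFactor N x + C) * ‖h‖ := by
  obtain ⟨C, hC0, hC⟩ := S.exists_flowDeriv_bounds
  refine ⟨C, hC0, fun N x h => ?_⟩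
  obtain ⟨h1, h2⟩ := hC _ (S.sc_pos N) (N + N) x h
  rw [sc_mul_two] at h1 h2
  have h3 : ‖S.approxDeriv N x h‖ =
      Real.exp (S.U (S.lam ^ N) 0) * ‖S.flowDeriv (S.sc N) (N + N) x h‖ := by
    rw [approxDeriv, sc_mul_two, _root_.smul_apply, norm_smul,
      Real.norm_of_nonneg (Real.exp_pos _).le]
  rw [h3]
  constructor
  · refine le_trans (le_of_eq ?_) (mul_le_mul_of_nonneg_left h1 (Real.exp_pos _).le)
    rw [← mul_assoc, ← Real.exp_add]
    congr 2; rw [logFactor]; ring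
  · refine (mul_le_mul_of_nonneg_left h2 (Real.exp_pos _).le).trans (le_of_eq ?_)
    rw [← mul_assoc, ← Real.exp_add]
    congr 2; rw [logFactor]; ring

lemma abs_U_lam_sub_le (N : ℕ) (x : Eu 4) :
    |S.U (S.lam ^ N) 0 - S.U (S.lam ^ N) x| ≤ S.B * ‖x‖ / S.lam ^ N := by
  simpa using S.abs_U_sub_le _ (pow_pos S.lam_pos N) 0 x

lemma abs_U_lam_sub_le' (N : ℕ) (x : Eu 4) :
    |S.U (S.lam ^ N) 0 - S.U (S.lam ^ N) x| ≤ S.B * ‖x‖ :=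
  (S.abs_U_lam_sub_le N x).trans
    (div_le_self (mul_nonneg S.B_nonneg (norm_nonneg _)) (one_le_pow₀ S.one_lt_lam.le))

lemma tendsto_logFactor (x : Eu 4) : Tendsto (fun N => S.logFactor N x) atTop (𝓝 (u x)) := by
  have h1 : Tendsto S.sc atTop (𝓝 0) :=
    tendsto_pow_atTop_nhds_zero_of_lt_one (inv_pos.2 S.lam_pos).le
      (inv_lt_one_of_one_lt₀ S.one_lt_lam)
  have h2 : Tendsto (fun N => S.U (S.sc N) x) atTop (𝓝 (u x)) := by
    have hc : Continuous fun r => S.U r x :=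
      S.continuous_U.comp (by fun_prop : Continuous fun r : ℝ => (r, x))
    have := (hc.tendsto 0).comp h1
    rwa [S.U_zero] at this
  have h3 : Tendsto (fun N => S.U (S.lam ^ N) 0 - S.U (S.lam ^ N) x) atTop (𝓝 0) := by
    refine squeeze_zero_norm (fun N => S.abs_U_lam_sub_le N x) ?_
    exact tendsto_const_nhds.div_atTop (tendsto_pow_atTop_atTop_of_one_lt S.one_lt_lam)
  have := h2.add h3
  rw [add_zero] at this
  refine this.congr fun N => ?_
  rw [logFactor]; ring

lemma exists_abs_logFactor_le (R : ℝ) : ∃ K, 0 ≤ K ∧ ∀ N x, ‖x‖ ≤ R → |S.logFactor N x| ≤ K := by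
  obtain ⟨K, hK0, hK⟩ := S.exists_abs_U_le_of_le_one R
  refine ⟨K + S.B * max R 0, add_nonneg hK0 (mul_nonneg S.B_nonneg (le_max_right _ _)),
    fun N x hx => ?_⟩
  have h1 := hK _ (S.sc_pos N).le (S.sc_le_one N) x hx
  have h2 := S.abs_U_lam_sub_le' N x
  have h3 : S.B * ‖x‖ ≤ S.B * max R 0 :=
    mul_le_mul_of_nonneg_left (hx.trans (le_max_left _ _)) S.B_nonneg
  have h4 : S.logFactor N x = S.U (S.sc N) x + (S.U (S.lam ^ N) 0 - S.U (S.lam ^ N) x) := by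
    rw [logFactor]; ring
  rw [h4]
  exact (abs_add_le _ _).trans (by linarith)

lemma exists_approxDeriv_sub_le (R : ℝ) (hR : 0 ≤ R) : ∃ L, 0 ≤ L ∧ ∀ N a b, ‖a‖ ≤ R → ‖b‖ ≤ R →
    ‖S.approxDeriv N a - S.approxDeriv N b‖ ≤ L * ‖a - b‖ := by
  obtain ⟨L, hL0, hL⟩ := S.exists_flowDeriv_sub_le R hR
  obtain ⟨K, hK0, hK⟩ := S.exists_abs_logFactor_le R
  obtain ⟨C, hC0, hC⟩ := S.exists_growth_bounds
  refine ⟨Real.exp (K + C) * L, by positivity, fun N a b ha hb => ?_⟩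
  have h1 := hL N a b ha hb
  have h2 := (hC _ (S.sc_pos N) (N + N) a).2
  rw [sc_mul_two] at h2
  have h3 := (abs_le.1 (hK N a ha)).2
  have h4 : S.approxDeriv N a - S.approxDeriv N b = Real.exp (S.U (S.lam ^ N) 0) •
      (S.flowDeriv (S.sc N) (N + N) a - S.flowDeriv (S.sc N) (N + N) b) := by
    rw [approxDeriv, approxDeriv, sc_mul_two]
    exact (smul_sub _ _ _).symm
  rw [h4, norm_smul, Real.norm_of_nonneg (Real.exp_pos _).le]
  calc Real.exp (S.U (S.lam ^ N) 0) * ‖S.flowDeriv (S.sc N) (N + N) a -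
        S.flowDeriv (S.sc N) (N + N) b‖
      ≤ Real.exp (S.U (S.lam ^ N) 0) *
        (Real.exp (S.growth (S.sc N) (N + N) a) * (L * ‖a - b‖)) := by gcongr
    _ = Real.exp (S.U (S.lam ^ N) 0 + S.growth (S.sc N) (N + N) a) * (L * ‖a - b‖) := by
        rw [Real.exp_add]; ring
    _ ≤ Real.exp (K + C) * (L * ‖a - b‖) := by
        refine mul_le_mul_of_nonneg_right (Real.exp_le_exp.2 ?_) (by positivity)
        rw [logFactor] at h3
        linarith
    _ = _ := by ring

end ScaleField

namespace ScaleField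

variable {u : Eu 4 → ℝ} (S : ScaleField u)

lemma exp_mul_norm_sub_le {r t Y m : ℝ} (hr : 0 < r) (ht : |t| ≤ 1 / 8)
    (hD : ∀ z, ‖z‖ ≤ m → ‖S.D r z - t • ContinuousLinearMap.id ℝ (Eu 4)‖ ≤ Y)
    {a b : Eu 4} (ha : ‖a‖ ≤ m) (hb : ‖b‖ ≤ m) :
    Real.exp (t - 4 * t ^ 2 - 2 * Y) * ‖a - b‖ ≤ ‖(a + S.W r a) - (b + S.W r b)‖ := by
  have hY : 0 ≤ Y := (norm_nonneg _).trans (hD a ha)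
  have hD' : ∀ z, ‖z‖ ≤ m → ‖S.D r z - t • ContinuousLinearMap.id ℝ (Eu 4)‖ ≤ min Y (1 / 4) := by
    intro z hz
    refine le_min (hD z hz) ((norm_sub_le _ _).trans ?_)
    have h2 : ‖t • ContinuousLinearMap.id ℝ (Eu 4)‖ ≤ 1 / 8 := by
      rw [norm_smul, Real.norm_eq_abs]
      calc |t| * ‖ContinuousLinearMap.id ℝ (Eu 4)‖ ≤ 1 / 8 * 1 :=
            mul_le_mul ht ContinuousLinearMap.norm_id_le (norm_nonneg _) (by norm_num)
        _ = 1 / 8 := mul_one _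
    linarith [S.norm_D_le r hr z]
  have hmv : ‖(S.W r a - t • a) - (S.W r b - t • b)‖ ≤ min Y (1 / 4) * ‖a - b‖ := by
    refine (convex_closedBall (0 : Eu 4) m).norm_image_sub_le_of_norm_hasFDerivWithin_le
      (f := fun z => S.W r z - t • z)
      (f' := fun z => S.D r z - t • ContinuousLinearMap.id ℝ (Eu 4))
      (fun z _ => ?_) (fun z hz => hD' z (by simpa using hz)) (by simpa using hb)
      (by simpa using ha)
    exact ((S.hasFDerivAt_W r hr z).sub ((hasFDerivAt_id z).const_smul t)).hasFDerivWithinAt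
  have ht' := abs_le.1 ht
  have hmin0 : 0 ≤ min Y (1 / 4) := le_min hY (by norm_num)
  have h1 : (a + S.W r a) - (b + S.W r b) =
      (1 + t) • (a - b) + ((S.W r a - t • a) - (S.W r b - t • b)) := by
    rw [add_smul, one_smul, smul_sub]; abel
  have h3 : ‖(1 + t) • (a - b)‖ = (1 + t) * ‖a - b‖ := by
    rw [norm_smul, Real.norm_of_nonneg (by linarith)]
  calc Real.exp (t - 4 * t ^ 2 - 2 * Y) * ‖a - b‖
      ≤ Real.exp (t - 4 * t ^ 2 - 2 * min Y (1 / 4)) * ‖a - b‖ := by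
        refine mul_le_mul_of_nonneg_right (Real.exp_le_exp.2 ?_) (norm_nonneg _)
        linarith [min_le_left Y (1 / 4)]
    _ ≤ (1 + t - min Y (1 / 4)) * ‖a - b‖ := by
        gcongr; exact exp_sub_le_one_add ht hmin0 (min_le_right _ _)
    _ ≤ ‖(1 + t) • (a - b)‖ - ‖(S.W r a - t • a) - (S.W r b - t • b)‖ := by
        rw [h3]; linarith
    _ ≤ _ := by rw [h1]; exact norm_sub_le_norm_add _ _

lemma sum_shift_le {f : ℕ → ℝ} (hf : ∀ j, 0 ≤ f j) {C : ℝ}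
    (hC : ∀ J, ∑ j ∈ Finset.range J, f j ≤ C) (m n : ℕ) :
    ∑ i ∈ Finset.range n, f (m + i) ≤ C := by
  have h1 := hC (m + n)
  rw [Finset.sum_range_add] at h1
  have h2 := Finset.sum_nonneg fun j (_ : j ∈ Finset.range m) => hf j
  linarith

lemma exists_flow_sub_ge {A : ℝ} (hA : 4 * S.M ≤ A) (hA0 : 0 ≤ A) : ∃ C, 0 ≤ C ∧ ∀ N k x, k ≤ N →
    A * S.lam ^ k ≤ ‖x‖ → (k = N ∨ ‖x‖ ≤ A * S.lam ^ (k + 1)) →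
    Real.exp (S.U (S.lam ^ k) 0 - S.U (S.lam ^ N) 0 - C) * (‖x‖ / 2) ≤
      ‖S.flow (S.sc N) (N + N) x - S.flow (S.sc N) (N + N) 0‖ := by
  have hM0 := S.M_nonneg
  have hl := S.lam_pos
  have hl1 := S.one_lt_lam
  obtain ⟨C, hC0, e, he0, hes, hst, hrel, hD⟩ :=
    S.exists_sum_rel_le (2 * S.M + S.lam * A) (by nlinarith)
  set T := (1 - S.lam⁻¹)⁻¹ with hT
  have hinv1 : S.lam⁻¹ < 1 := inv_lt_one_of_one_lt₀ hl1
  have hinv0 : 0 < S.lam⁻¹ := inv_pos.2 hl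
  have hT0 : 0 < T := inv_pos.2 (by linarith)
  refine ⟨4 * C + 2 * (C + 3 * C * (C + C + (S.lam * A) ^ 2 * T)), by positivity,
    fun N k x hkN hxA hx => ?_⟩
  have hρ := S.sc_pos N
  have hr : ∀ j, 0 < S.sc N * S.lam ^ j := S.scale_pos hρ
  obtain ⟨n, rfl⟩ := Nat.exists_eq_add_of_le hkN
  set N := k + n with hN
  set Y : ℕ → ℝ := fun i => e (S.sc N * S.lam ^ (N + k + i)) 0 +
    C * (3 * (S.rel (S.sc N) (N + k + i) 0 ^ 2 + S.rel (S.sc N) (N + k + i) x ^ 2 +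
      (S.lam * A) ^ 2 * S.lam⁻¹ ^ i)) with hY
  have hscale : ∀ i, S.sc N * S.lam ^ (N + k + i) = S.lam ^ (k + i) := by
    intro i; rw [add_assoc, S.sc_mul_add]
  have hstart : ‖x‖ / 2 ≤ ‖S.flow (S.sc N) (N + k) x - S.flow (S.sc N) (N + k) 0‖ := by
    have h1 := S.norm_flow_sub_le hρ (N + k) x
    have h2 := S.norm_flow_sub_le hρ (N + k) 0
    rw [S.sc_mul_add, sub_zero] at h2
    rw [S.sc_mul_add] at h1
    have h3 : x = (S.flow (S.sc N) (N + k) x - S.flow (S.sc N) (N + k) 0) -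
      (S.flow (S.sc N) (N + k) x - x) + S.flow (S.sc N) (N + k) 0 := by abel
    have h4 : ‖x‖ ≤ ‖S.flow (S.sc N) (N + k) x - S.flow (S.sc N) (N + k) 0‖ +
      ‖S.flow (S.sc N) (N + k) x - x‖ + ‖S.flow (S.sc N) (N + k) 0‖ := by
      conv_lhs => rw [h3]
      exact (norm_add_le _ _).trans (add_le_add_left (norm_sub_le _ _) _)
    have h5 : 4 * S.M * S.lam ^ k ≤ A * S.lam ^ k := by gcongr
    linarith
  have hind : ∀ i, i ≤ n → Real.exp (∑ l ∈ Finset.range i, (S.step (S.sc N) (N + k + l) 0 -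
      4 * S.step (S.sc N) (N + k + l) 0 ^ 2 - 2 * Y l)) * (‖x‖ / 2) ≤
      ‖S.flow (S.sc N) (N + k + i) x - S.flow (S.sc N) (N + k + i) 0‖ := by
    intro i
    induction i with
    | zero => intro _; simpa using hstart
    | succ i ih =>
      intro hi
      have hxi : ‖x‖ / (S.sc N * S.lam ^ (N + k + i)) ≤ S.lam * A * S.lam⁻¹ ^ i := by
        rcases hx with h | h
        · omega
        · rw [div_le_iff₀ (hr _), hscale]
          refine h.trans (le_of_eq ?_)
          rw [pow_add S.lam k i, inv_pow]
          field_simp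
          ring
      set j := N + k + i with hj
      set r := S.sc N * S.lam ^ j with hrdef
      have hrj : 0 < r := hr j
      have h0n : ‖S.flow (S.sc N) j 0‖ = r * S.rel (S.sc N) j 0 := by
        rw [rel, sub_zero, ← hrdef, mul_div_cancel₀ _ hrj.ne']
      have hxn : ‖S.flow (S.sc N) j x‖ ≤ ‖x‖ + r * S.rel (S.sc N) j x := by
        rw [rel, ← hrdef, mul_div_cancel₀ _ hrj.ne']
        exact norm_le_norm_add_norm_sub' _ _
      have hrelM : ∀ y, S.rel (S.sc N) j y ≤ S.M := by
        intro y
        rw [rel, div_le_iff₀ (hr j)]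
        exact S.norm_flow_sub_le hρ j y
      have hrel0 : ∀ y, 0 ≤ S.rel (S.sc N) j y := fun y =>
        div_nonneg (norm_nonneg _) hrj.le
      have hxr : ‖x‖ = r * (‖x‖ / r) := by field_simp
      have hxr0 : 0 ≤ ‖x‖ / r := by positivity
      set m := r * (S.rel (S.sc N) j 0 + S.rel (S.sc N) j x + ‖x‖ / r) with hm
      have hpow1 : S.lam⁻¹ ^ i ≤ 1 := pow_le_one₀ hinv0.le hinv1.le
      have hpow0 : 0 ≤ S.lam⁻¹ ^ i := by positivity
      have hmQ : m ≤ (2 * S.M + S.lam * A) * r := by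
        have h1 := hrelM 0
        have h2 := hrelM x
        have h3 : S.lam * A * S.lam⁻¹ ^ i ≤ S.lam * A * 1 := by gcongr
        rw [hm, mul_comm]
        exact mul_le_mul_of_nonneg_right (by linarith) hrj.le
      have hDz : ∀ z, ‖z‖ ≤ m → ‖S.D r z - S.step (S.sc N) j 0 •
          ContinuousLinearMap.id ℝ (Eu 4)‖ ≤ Y i := by
        intro z hz
        have h1 := hD r hrj z 0 (by rw [sub_zero]; exact hz.trans hmQ)
        rw [sub_zero] at h1
        rw [S.step_eq]
        refine h1.trans ?_
        simp only [hY]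
        gcongr
        have h2 : ‖z‖ / r ≤ S.rel (S.sc N) j 0 + S.rel (S.sc N) j x + ‖x‖ / r := by
          rw [div_le_iff₀ hrj, mul_comm]; exact hz
        have h3 : (‖z‖ / r) ^ 2 ≤ (S.rel (S.sc N) j 0 + S.rel (S.sc N) j x + ‖x‖ / r) ^ 2 := by
          gcongr
        have h4 : (‖x‖ / r) ^ 2 ≤ (S.lam * A) ^ 2 * S.lam⁻¹ ^ i := by
          calc (‖x‖ / r) ^ 2 ≤ (S.lam * A * S.lam⁻¹ ^ i) ^ 2 := by gcongr
            _ = (S.lam * A) ^ 2 * (S.lam⁻¹ ^ i * S.lam⁻¹ ^ i) := by ring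
            _ ≤ (S.lam * A) ^ 2 * (S.lam⁻¹ ^ i * 1) := by gcongr
            _ = _ := by ring
        linarith [sq_nonneg (S.rel (S.sc N) j 0 - S.rel (S.sc N) j x),
          sq_nonneg (S.rel (S.sc N) j 0 - ‖x‖ / r), sq_nonneg (S.rel (S.sc N) j x - ‖x‖ / r)]
      have hstep := S.exp_mul_norm_sub_le hrj (S.abs_step hρ j 0) hDz
        (a := S.flow (S.sc N) j x) (b := S.flow (S.sc N) j 0)
        (by
          rw [hm]; refine hxn.trans ?_
          have := mul_nonneg hrj.le (hrel0 0)
          rw [mul_add, mul_add, ← hxr]; linarith)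
        (by
          rw [hm, h0n]
          have := hrel0 x
          gcongr
          linarith)
      rw [Finset.sum_range_succ, add_comm, Real.exp_add, mul_assoc]
      exact (mul_le_mul_of_nonneg_left (ih (by omega)) (Real.exp_pos _).le).trans hstep
  have hfin := hind n le_rfl
  rw [add_assoc N k n, ← hN] at hfin
  refine le_trans (mul_le_mul_of_nonneg_right (Real.exp_le_exp.2 ?_) (by positivity)) hfin
  have hs1 : ∑ l ∈ Finset.range n, S.step (S.sc N) (N + k + l) 0 =
      S.U (S.lam ^ k) 0 - S.U (S.lam ^ N) 0 := by
    rw [hN, pow_add S.lam k n, ← S.sum_step]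
    refine Finset.sum_congr rfl fun l _ => ?_
    rw [step, step, ← hN, hscale, add_assoc (N + k) l 1, hscale, pow_add, pow_add]
  have hs2 : ∑ l ∈ Finset.range n, S.step (S.sc N) (N + k + l) 0 ^ 2 ≤ C :=
    sum_shift_le (f := fun j => S.step (S.sc N) j 0 ^ 2) (fun j => sq_nonneg _)
      (fun J => hst _ hρ J 0) _ _
  have hs3 : ∑ l ∈ Finset.range n, Y l ≤ C + 3 * C * (C + C + (S.lam * A) ^ 2 * T) := by
    have h1 := sum_shift_le (f := fun j => e (S.sc N * S.lam ^ j) 0) (fun j => he0 _ _)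
      (fun J => hes _ hρ J 0) (N + k) n
    have h2 := sum_shift_le (f := fun j => S.rel (S.sc N) j 0 ^ 2) (fun j => sq_nonneg _)
      (fun J => hrel _ hρ J 0) (N + k) n
    have h3 := sum_shift_le (f := fun j => S.rel (S.sc N) j x ^ 2) (fun j => sq_nonneg _)
      (fun J => hrel _ hρ J x) (N + k) n
    have h4 : ∑ i ∈ Finset.range n, S.lam⁻¹ ^ i ≤ T := by
      rw [hT, ← tsum_geometric_of_lt_one hinv0.le hinv1]
      exact (summable_geometric_of_lt_one hinv0.le hinv1).sum_le_tsum _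
        fun k _ => pow_nonneg hinv0.le k
    simp only [hY]
    rw [Finset.sum_add_distrib, ← Finset.mul_sum, ← Finset.mul_sum, Finset.sum_add_distrib,
      Finset.sum_add_distrib, ← Finset.mul_sum]
    calc _ ≤ C + C * (3 * (C + C + (S.lam * A) ^ 2 * T)) := by gcongr
      _ = _ := by ring
  rw [Finset.sum_sub_distrib, Finset.sum_sub_distrib, ← Finset.mul_sum, ← Finset.mul_sum, hs1]
  linarith

lemma exists_norm_le_of_approx_le (Q : ℝ) : ∃ R, ∀ N x, ‖S.approx N x‖ ≤ Q → ‖x‖ ≤ R := by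
  have hl := S.lam_pos
  have hl1 := S.one_lt_lam
  have hM0 := S.M_nonneg
  set A := 4 * S.M + 1 with hA
  have hA1 : 1 ≤ A := by linarith
  obtain ⟨C, hC0, hC⟩ := S.exists_flow_sub_ge (A := A) (by linarith) (by linarith)
  have hδ : 0 < Real.log S.lam / 2 := half_pos (Real.log_pos hl1)
  obtain ⟨K, hK0, hK⟩ := S.exists_abs_U_le hδ 0
  refine ⟨max A ((2 * Real.exp (K + C) * Q) ^ 2), fun N x hQ => ?_⟩
  by_contra! hlt
  obtain ⟨hxA, hxQ⟩ := max_lt_iff.1 hlt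
  have hx0 : 0 < ‖x‖ := by linarith
  have hAx : 1 ≤ ‖x‖ / A := by rw [le_div_iff₀ (by linarith)]; linarith
  obtain ⟨k₀, hk1, hk2⟩ := exists_nat_pow_near hAx hl1
  rw [le_div_iff₀ (by linarith)] at hk1
  rw [div_lt_iff₀ (by linarith)] at hk2
  have hex : ∃ k, k ≤ N ∧ A * S.lam ^ k ≤ ‖x‖ ∧ (k = N ∨ ‖x‖ ≤ A * S.lam ^ (k + 1)) := by
    rcases le_total N k₀ with h | h
    · refine ⟨N, le_rfl, ?_, Or.inl rfl⟩
      refine le_trans ?_ hk1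
      rw [mul_comm]
      gcongr
      exact hl1.le
    · exact ⟨k₀, h, by linarith, Or.inr (by linarith)⟩
  obtain ⟨k, hkN, hk3, hk4⟩ := hex
  have hG := hC N k x hkN hk3 hk4
  have hU := (abs_le.1 (hK 0 (by simp) N (N + k))).1
  rw [S.sc_mul_add, Nat.add_sub_cancel_left] at hU
  have hG2 : Real.exp (S.U (S.lam ^ k) 0 - C) * (‖x‖ / 2) ≤ ‖S.approx N x‖ := by
    rw [approx, sc_mul_two, norm_smul, Real.norm_of_nonneg (Real.exp_pos _).le]
    refine le_trans (le_of_eq ?_) (mul_le_mul_of_nonneg_left hG (Real.exp_pos _).le)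
    rw [← mul_assoc, ← Real.exp_add]
    congr 2; ring
  have hG3 : Real.exp (-(K + C)) * Real.exp (-(Real.log S.lam / 2 * k)) * (‖x‖ / 2) ≤ Q := by
    refine le_trans ?_ (hG2.trans hQ)
    rw [← Real.exp_add]
    refine mul_le_mul_of_nonneg_right (Real.exp_le_exp.2 ?_) (by positivity)
    linarith
  set E := Real.exp (Real.log S.lam / 2 * k) with hE
  have hE0 : 0 < E := Real.exp_pos _
  have hE2 : E ^ 2 ≤ ‖x‖ := by
    have : E ^ 2 = S.lam ^ k := by
      rw [hE, ← Real.exp_nat_mul, ← Real.exp_log (pow_pos hl k), Real.log_pow]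
      congr 1; push_cast; ring
    rw [this]
    have := pow_pos hl k
    nlinarith
  rw [Real.exp_neg, Real.exp_neg] at hG3
  have hP := Real.exp_pos (K + C)
  have hG4 : ‖x‖ ≤ 2 * Real.exp (K + C) * Q * E := by
    have h5 : (Real.exp (K + C))⁻¹ * E⁻¹ * (‖x‖ / 2) = ‖x‖ / (2 * Real.exp (K + C) * E) := by
      field_simp
    rw [h5, div_le_iff₀ (by positivity)] at hG3
    linarith
  have hsq : ‖x‖ ^ 2 ≤ (2 * Real.exp (K + C) * Q) ^ 2 * ‖x‖ := by
    calc ‖x‖ ^ 2 ≤ (2 * Real.exp (K + C) * Q * E) ^ 2 := by gcongr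
      _ = (2 * Real.exp (K + C) * Q) ^ 2 * E ^ 2 := by ring
      _ ≤ _ := by gcongr
  nlinarith

end ScaleField

lemma exists_tendsto_of_norm_le {V : Type*} [NormedAddCommGroup V] [ProperSpace V]
    (l : Ultrafilter ℕ) {g : ℕ → V} {K : ℝ} (hg : ∀ N, ‖g N‖ ≤ K) :
    ∃ v, Tendsto g l (𝓝 v) := by
  obtain ⟨v, -, hv⟩ := (isCompact_closedBall (0 : V) K).ultrafilter_le_nhds (l.map g)
    (by
      rw [Ultrafilter.coe_map, le_principal_iff, mem_map]
      exact univ_mem' fun N => by simpa using hg N)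
  exact ⟨v, hv⟩

/-- A family of maps which is uniformly Lipschitz on every ball. -/
def EquiLipschitz (g : ℕ → Eu 4 → Eu 4) : Prop :=
  ∀ R, ∃ L, 0 ≤ L ∧ ∀ N a b, ‖a‖ ≤ R → ‖b‖ ≤ R → ‖g N a - g N b‖ ≤ L * ‖a - b‖

lemma EquiLipschitz.exists_tendsto {g : ℕ → Eu 4 → Eu 4} (hg : EquiLipschitz g)
    (h0 : ∀ N, g N 0 = 0) (l : Ultrafilter ℕ) (x : Eu 4) : ∃ v, Tendsto (fun N => g N x) l (𝓝 v) := by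
  obtain ⟨L, hL0, hL⟩ := hg ‖x‖
  refine exists_tendsto_of_norm_le l (K := L * ‖x‖) fun N => ?_
  simpa [h0] using hL N x 0 le_rfl (by simp)

lemma EquiLipschitz.continuous_limit {g : ℕ → Eu 4 → Eu 4} (hg : EquiLipschitz g)
    {l : Filter ℕ} [l.NeBot] {F : Eu 4 → Eu 4} (hF : ∀ x, Tendsto (fun N => g N x) l (𝓝 (F x))) :
    Continuous F := by
  rw [continuous_iff_continuousAt]
  intro x
  obtain ⟨L, hL0, hL⟩ := hg (‖x‖ + 1)
  have hlip : LipschitzOnWith ⟨L, hL0⟩ F (closedBall 0 (‖x‖ + 1)) := by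
    refine LipschitzOnWith.of_dist_le_mul fun a ha b hb => ?_
    rw [dist_eq_norm, dist_eq_norm]
    refine le_of_tendsto ((hF a).sub (hF b)).norm (Eventually.of_forall fun N => ?_)
    exact hL N a b (by simpa using ha) (by simpa using hb)
  refine hlip.continuousOn.continuousAt ?_
  filter_upwards [ball_mem_nhds x one_pos] with y hy
  rw [mem_closedBall_zero_iff]
  rw [mem_ball, dist_eq_norm] at hy
  linarith [norm_le_norm_add_norm_sub' y x]

lemma EquiLipschitz.limit_apply_limit {g h : ℕ → Eu 4 → Eu 4} (hh : EquiLipschitz h)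
    (hinv : ∀ N x, h N (g N x) = x) {l : Filter ℕ} [l.NeBot] {F H : Eu 4 → Eu 4}
    (hF : ∀ x, Tendsto (fun N => g N x) l (𝓝 (F x)))
    (hH : ∀ x, Tendsto (fun N => h N x) l (𝓝 (H x))) (x : Eu 4) : H (F x) = x := by
  obtain ⟨L, hL0, hL⟩ := hh (‖F x‖ + 1)
  have h1 : Tendsto (fun N => L * ‖F x - g N x‖) l (𝓝 0) := by
    have := ((tendsto_const_nhds (x := F x)).sub (hF x)).norm.const_mul L
    simpa using this
  have h2 : ∀ᶠ N in l, ‖h N (F x) - x‖ ≤ L * ‖F x - g N x‖ := by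
    filter_upwards [(hF x) (ball_mem_nhds (F x) one_pos)] with N hN
    rw [mem_preimage, mem_ball, dist_eq_norm] at hN
    have h3 := hL N (F x) (g N x) (by linarith)
      (by linarith [norm_le_norm_add_norm_sub' (g N x) (F x)])
    rwa [hinv N x] at h3
  have h3 : Tendsto (fun N => h N (F x)) l (𝓝 x) :=
    tendsto_iff_norm_sub_tendsto_zero.2
      (squeeze_zero' (Eventually.of_forall fun N => norm_nonneg _) h2 h1)
  exact tendsto_nhds_unique (hH (F x)) h3

lemma det_ne_zero_of_lower_bound {A : Eu 4 →L[ℝ] Eu 4} {c : ℝ} (hc : 0 < c)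
    (hA : ∀ h, c * ‖h‖ ≤ ‖A h‖) : A.det ≠ 0 := by
  intro h0
  have hk := LinearMap.bot_lt_ker_of_det_eq_zero (f := (A : Eu 4 →ₗ[ℝ] Eu 4)) h0
  obtain ⟨v, hv, hv0⟩ := Submodule.exists_mem_ne_zero_of_ne_bot hk.ne'
  have h1 := hA v
  have h2 : A v = 0 := hv
  rw [h2, norm_zero] at h1
  have := mul_pos hc (norm_pos_iff.2 hv0)
  linarith

lemma hasFDerivAt_limit {g : ℕ → Eu 4 → Eu 4} {g' : ℕ → Eu 4 → Eu 4 →L[ℝ] Eu 4}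
    (hg : ∀ N x, HasFDerivAt (g N) (g' N x) x)
    (hlip : ∀ R, 0 ≤ R → ∃ L, 0 ≤ L ∧ ∀ N a b, ‖a‖ ≤ R → ‖b‖ ≤ R →
      ‖g' N a - g' N b‖ ≤ L * ‖a - b‖)
    {l : Filter ℕ} [l.NeBot] {F : Eu 4 → Eu 4} (hF : ∀ x, Tendsto (fun N => g N x) l (𝓝 (F x)))
    {x : Eu 4} {A : Eu 4 →L[ℝ] Eu 4} (hA : Tendsto (fun N => g' N x) l (𝓝 A)) :
    HasFDerivAt F A x := by
  obtain ⟨L, hL0, hL⟩ := hlip (‖x‖ + 1) (by positivity)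
  have key : ∀ y, ‖y - x‖ ≤ 1 → ‖F y - F x - A (y - x)‖ ≤ L * ‖y - x‖ * ‖y - x‖ := by
    intro y hy
    have hlim : Tendsto (fun N => ‖g N y - g N x - g' N x (y - x)‖) l
        (𝓝 ‖F y - F x - A (y - x)‖) :=
      (((hF y).sub (hF x)).sub
        (((ContinuousLinearMap.apply ℝ (Eu 4) (y - x)).continuous.tendsto A).comp hA)).norm
    refine le_of_tendsto hlim (Eventually.of_forall fun N => ?_)
    refine (convex_closedBall x ‖y - x‖).norm_image_sub_le_of_norm_hasFDerivWithin_le'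
      (f := g N) (f' := g' N) (φ := g' N x)
      (fun z _ => (hg N z).hasFDerivWithinAt) (fun z hz => ?_) (by simp)
      (by simp [dist_eq_norm])
    rw [mem_closedBall, dist_eq_norm] at hz
    refine (hL N z x ?_ (by linarith)).trans (by gcongr)
    linarith [norm_le_norm_add_norm_sub' z x]
  rw [hasFDerivAt_iff_isLittleO, Asymptotics.isLittleO_iff]
  intro ε hε
  have hpos : 0 < min 1 (ε / (L + 1)) := by positivity
  filter_upwards [ball_mem_nhds x hpos] with y hy
  rw [mem_ball, dist_eq_norm, lt_min_iff, lt_div_iff₀ (by positivity)] at hy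
  refine (key y hy.1.le).trans ?_
  gcongr
  nlinarith [norm_nonneg (y - x)]

/-- A properly normalised sequence of homeomorphisms with locally equi-Lipschitz, uniformly
conformal derivatives subconverges to a homeomorphism with the limiting conformal bounds. -/
lemma exists_limit_homeomorph {u : Eu 4 → ℝ} {G : ℕ → Eu 4 ≃ₜ Eu 4}
    {G' : ℕ → Eu 4 → Eu 4 →L[ℝ] Eu 4} {w : ℕ → Eu 4 → ℝ} {C : ℝ}
    (hG : ∀ N x, HasFDerivAt (G N) (G' N x) x) (hdet : ∀ N x, 0 < (G' N x).det)
    (hlip : ∀ R, 0 ≤ R → ∃ L, 0 ≤ L ∧ ∀ N a b, ‖a‖ ≤ R → ‖b‖ ≤ R →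
      ‖G' N a - G' N b‖ ≤ L * ‖a - b‖)
    (hb : ∀ N x h, Real.exp (w N x - C) * ‖h‖ ≤ ‖G' N x h‖ ∧
      ‖G' N x h‖ ≤ Real.exp (w N x + C) * ‖h‖)
    (hw : ∀ x, Tendsto (fun N => w N x) atTop (𝓝 (u x)))
    (hwb : ∀ R, ∃ K, 0 ≤ K ∧ ∀ N x, ‖x‖ ≤ R → |w N x| ≤ K)
    (h0 : ∀ N, G N 0 = 0) (hp : ∀ Q, ∃ R, ∀ N x, ‖G N x‖ ≤ Q → ‖x‖ ≤ R) :
    ∃ (F : Eu 4 ≃ₜ Eu 4) (F' : Eu 4 → Eu 4 →L[ℝ] Eu 4), ∀ x, HasFDerivAt F (F' x) x ∧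
      0 < (F' x).det ∧ ∀ h, Real.exp (u x - C) * ‖h‖ ≤ ‖F' x h‖ ∧
        ‖F' x h‖ ≤ Real.exp (u x + C) * ‖h‖ := by
  have hnorm : ∀ N x, ‖G' N x‖ ≤ Real.exp (w N x + C) := fun N x =>
    ContinuousLinearMap.opNorm_le_bound _ (Real.exp_pos _).le fun h => (hb N x h).2
  have hlipG : EquiLipschitz fun N => G N := by
    intro R
    obtain ⟨K, hK0, hK⟩ := hwb R
    refine ⟨Real.exp (K + C), (Real.exp_pos _).le, fun N a b ha hb => ?_⟩
    refine (convex_closedBall (0 : Eu 4) R).norm_image_sub_le_of_norm_hasFDerivWithin_le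
      (fun z _ => (hG N z).hasFDerivWithinAt) (fun z hz => (hnorm N z).trans ?_)
      (by simpa using hb) (by simpa using ha)
    gcongr
    exact (abs_le.1 (hK N z (by simpa using hz))).2
  have hlipS : EquiLipschitz fun N => (G N).symm := by
    intro Q
    obtain ⟨R, hR⟩ := hp Q
    obtain ⟨K, hK0, hK⟩ := hwb R
    refine ⟨Real.exp (K + C), (Real.exp_pos _).le, fun N a b ha hb' => ?_⟩
    have hd : ∀ y, HasFDerivAt (G N).symm
        (((G' N ((G N).symm y)).toContinuousLinearEquivOfDetNeZero
          (hdet N _).ne').symm : Eu 4 →L[ℝ] Eu 4) y := by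
      intro y
      refine HasFDerivAt.of_local_left_inverse (f := G N) (G N).symm.continuous.continuousAt ?_
        (Eventually.of_forall fun z => (G N).apply_symm_apply z)
      exact hG N _
    refine (convex_closedBall (0 : Eu 4) Q).norm_image_sub_le_of_norm_hasFDerivWithin_le
      (fun z _ => (hd z).hasFDerivWithinAt) (fun z hz => ?_)
      (by simpa using hb') (by simpa using ha)
    refine ContinuousLinearMap.opNorm_le_bound _ (Real.exp_pos _).le fun h => ?_
    set x := (G N).symm z with hx
    set A := (G' N x).toContinuousLinearEquivOfDetNeZero (hdet N x).ne' with hA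
    have hxR : ‖x‖ ≤ R := hR N x (by rw [hx, Homeomorph.apply_symm_apply]; simpa using hz)
    have h1 := (hb N x (A.symm h)).1
    have h2 : G' N x (A.symm h) = h := A.apply_symm_apply h
    rw [h2] at h1
    have h3 := (abs_le.1 (hK N x hxR)).1
    change ‖A.symm h‖ ≤ _
    calc ‖A.symm h‖ = Real.exp (-(w N x - C)) * (Real.exp (w N x - C) * ‖A.symm h‖) := by
          rw [← mul_assoc, ← Real.exp_add, neg_add_cancel, Real.exp_zero, one_mul]
      _ ≤ Real.exp (-(w N x - C)) * ‖h‖ := by gcongr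
      _ ≤ Real.exp (K + C) * ‖h‖ := by gcongr; linarith
  have hS0 : ∀ N, (G N).symm 0 = 0 := fun N => by
    rw [Homeomorph.symm_apply_eq, h0]
  choose F hF using fun x => hlipG.exists_tendsto h0 (hyperfilter ℕ) x
  choose I hI using fun x => hlipS.exists_tendsto hS0 (hyperfilter ℕ) x
  have hA : ∀ x, ∃ A, Tendsto (fun N => G' N x) (hyperfilter ℕ : Filter ℕ) (𝓝 A) := by
    intro x
    obtain ⟨K, hK0, hK⟩ := hwb ‖x‖
    have : ProperSpace (Eu 4 →L[ℝ] Eu 4) := FiniteDimensional.proper_real _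
    refine exists_tendsto_of_norm_le _ (K := Real.exp (K + C)) fun N => (hnorm N x).trans ?_
    gcongr
    exact (abs_le.1 (hK N x le_rfl)).2
  choose F' hF' using hA
  refine ⟨⟨⟨F, I, hlipS.limit_apply_limit (fun N x => (G N).symm_apply_apply x) hF hI,
    hlipG.limit_apply_limit (fun N x => (G N).apply_symm_apply x) hI hF⟩,
    hlipG.continuous_limit hF, hlipS.continuous_limit hI⟩, F', fun x => ?_⟩
  have hbounds : ∀ h, Real.exp (u x - C) * ‖h‖ ≤ ‖F' x h‖ ∧
      ‖F' x h‖ ≤ Real.exp (u x + C) * ‖h‖ := by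
    intro h
    have h1 : Tendsto (fun N => ‖G' N x h‖) (hyperfilter ℕ : Filter ℕ) (𝓝 ‖F' x h‖) :=
      (((ContinuousLinearMap.apply ℝ (Eu 4) h).continuous.tendsto (F' x)).comp (hF' x)).norm
    have h2 := (hw x).mono_left Nat.hyperfilter_le_atTop
    exact ⟨le_of_tendsto_of_tendsto (((Real.continuous_exp.tendsto _).comp
      (h2.sub_const C)).mul_const ‖h‖) h1 (Eventually.of_forall fun N => (hb N x h).1),
      le_of_tendsto_of_tendsto h1 (((Real.continuous_exp.tendsto _).comp
      (h2.add_const C)).mul_const ‖h‖) (Eventually.of_forall fun N => (hb N x h).2)⟩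
  refine ⟨hasFDerivAt_limit hG hlip hF (hF' x), lt_of_le_of_ne ?_ ?_, hbounds⟩
  · exact ge_of_tendsto ((ContinuousLinearMap.continuous_det.tendsto (F' x)).comp (hF' x))
      (Eventually.of_forall fun N => (hdet N x).le)
  · exact (det_ne_zero_of_lower_bound (Real.exp_pos _) fun h => (hbounds h).1).symm

lemma abs_det_le_pow {A : Eu 4 →L[ℝ] Eu 4} {c : ℝ} (hc : 0 ≤ c) (hA : ∀ h, ‖A h‖ ≤ c * ‖h‖) :
    |A.det| ≤ c ^ 4 := by
  have h1 : volume (A '' closedBall 0 1) ≤ volume (closedBall (0 : Eu 4) c) := by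
    refine measure_mono ?_
    rintro _ ⟨h, hh, rfl⟩
    rw [mem_closedBall_zero_iff] at hh ⊢
    exact (hA h).trans (mul_le_of_le_one_right hc hh)
  rw [Measure.addHaar_image_continuousLinearMap, Measure.addHaar_closedBall' _ _ hc,
    ENNReal.mul_le_mul_iff_left (measure_closedBall_pos volume _ one_pos).ne'
      measure_closedBall_lt_top.ne, ENNReal.ofReal_le_ofReal_iff (by positivity)] at h1
  simpa using h1

lemma pow_le_abs_det {A : Eu 4 →L[ℝ] Eu 4} {c : ℝ} (hc : 0 < c) (hA : ∀ h, c * ‖h‖ ≤ ‖A h‖) :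
    c ^ 4 ≤ |A.det| := by
  have hdet := det_ne_zero_of_lower_bound hc hA
  set e := A.toContinuousLinearEquivOfDetNeZero hdet with he
  have hcoe : (e : Eu 4 →L[ℝ] Eu 4) = A := A.coe_toContinuousLinearEquivOfDetNeZero hdet
  have h1 : ∀ h, ‖(e.symm : Eu 4 →L[ℝ] Eu 4) h‖ ≤ c⁻¹ * ‖h‖ := by
    intro h
    have h2 := hA (e.symm h)
    have h3 : A (e.symm h) = h := e.apply_symm_apply h
    rw [h3] at h2
    rw [inv_mul_eq_div, le_div_iff₀ hc, mul_comm]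
    exact h2
  have h2 := abs_det_le_pow (inv_nonneg.2 hc.le) h1
  rw [ContinuousLinearEquiv.det_coe_symm, hcoe, abs_inv, inv_pow] at h2
  exact (inv_le_inv₀ (abs_pos.2 hdet) (by positivity)).1 h2

/-- A differentiable map whose derivative is nearly conformal has small dilatation. -/
lemma limsup_dilatQuot_le {F : Eu 4 → Eu 4} {x : Eu 4} {A : Eu 4 →L[ℝ] Eu 4}
    (hF : HasFDerivAt F A x) {m k : ℝ} (hm : 0 < m) (hk : 0 ≤ k)
    (hl : ∀ h, m * ‖h‖ ≤ ‖A h‖) (hu : ∀ h, ‖A h‖ ≤ k * m * ‖h‖) :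
    limsup (fun r => dilatQuot F x r) (𝓝[>] 0) ≤ k + 1 := by
  set ε := m / (k + 2) with hε
  have hε0 : 0 < ε := by positivity
  have hεm : ε * (k + 2) = m := div_mul_cancel₀ _ (by positivity)
  have hεlt : 0 < m - ε := by nlinarith
  obtain ⟨δ, hδ, hδF⟩ := Metric.eventually_nhds_iff.1
    ((Asymptotics.isLittleO_iff.1 (hasFDerivAt_iff_isLittleO.1 hF)) hε0)
  have hev : ∀ᶠ r in 𝓝[>] (0 : ℝ), dilatQuot F x r ≤ k + 1 := by
    filter_upwards [Ioo_mem_nhdsGT hδ] with r hr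
    have hpt : ∀ a ∈ sphere x r, (m - ε) * r ≤ ‖F a - F x‖ ∧ ‖F a - F x‖ ≤ (k * m + ε) * r := by
      intro a ha
      have har : ‖a - x‖ = r := by rwa [mem_sphere, dist_eq_norm] at ha
      have h1 := hδF (y := a) (by rw [dist_eq_norm, har]; exact hr.2)
      rw [har] at h1
      have h2 := hl (a - x)
      have h3 := hu (a - x)
      rw [har] at h2 h3
      have h4 := norm_sub_norm_le (F a - F x) (A (a - x))
      have h5 := norm_sub_norm_le (A (a - x)) (F a - F x)
      rw [norm_sub_rev (A (a - x)) (F a - F x)] at h5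
      constructor <;> linarith
    have hne : (sphere x r).Nonempty := NormedSpace.sphere_nonempty.2 hr.1.le
    have hsup : sSup ((fun a => ‖F a - F x‖) '' sphere x r) ≤ (k * m + ε) * r := by
      refine csSup_le (hne.image _) ?_
      rintro _ ⟨a, ha, rfl⟩
      exact (hpt a ha).2
    have hinf : (m - ε) * r ≤ sInf ((fun a => ‖F a - F x‖) '' sphere x r) := by
      refine le_csInf (hne.image _) ?_
      rintro _ ⟨a, ha, rfl⟩
      exact (hpt a ha).1
    have hpos : 0 < (m - ε) * r := mul_pos hεlt hr.1
    rw [dilatQuot, div_le_iff₀ (hpos.trans_le hinf)]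
    calc _ ≤ (k * m + ε) * r := hsup
      _ = (k + 1) * ((m - ε) * r) := by rw [← hεm]; ring
      _ ≤ _ := by gcongr
  refine limsup_le_of_le ?_ hev
  refine IsCoboundedUnder.of_frequently_ge (a := 0) (Eventually.frequently ?_)
  refine Eventually.of_forall fun r => div_nonneg (Real.sSup_nonneg ?_) (Real.sInf_nonneg ?_) <;>
    (rintro _ ⟨a, -, rfl⟩; exact norm_nonneg _)

/-- Under the integral hypotheses on the conformal factor, the scale field exists. -/
lemma nonempty_scaleField_of_sigma2 {u : Eu 4 → ℝ} (hu : ContDiff ℝ ∞ u)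
    (hf : Integrable (lap (lap u))) (hE : Integrable fun x => confLap u x ^ 2)
    (hs : Integrable fun x => sigma2 (schoutenMatrix u x))
    (hlt : ∫ x, sigma2 (schoutenMatrix u x) < 2 * Real.pi ^ 2) : Nonempty (ScaleField u) := by
  obtain ⟨C, hC0, hC⟩ := exists_gradSq_ball_le hu hE
  have hc : Continuous fun y => -(8 * Real.pi ^ 2)⁻¹ * lap (lap u) y :=
    continuous_const.mul (contDiff_lap (contDiff_lap hu)).continuous
  have hi : Integrable fun y => -(8 * Real.pi ^ 2)⁻¹ * lap (lap u) y := hf.const_mul _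
  have hb : ∀ i x, pd i u x =
      ∫ y, newt i (x - y) * (-(8 * Real.pi ^ 2)⁻¹ * lap (lap u) y) := by
    intro i x
    have h1 := pd_eq_integral hu hf ⟨hC0, hC⟩ i x
    have h2 : ∫ y, newt i (x - y) * (-(8 * Real.pi ^ 2)⁻¹ * lap (lap u) y) =
        -(8 * Real.pi ^ 2)⁻¹ * ∫ y, (x - y) i / ‖x - y‖ ^ 2 * lap (lap u) y := by
      rw [← integral_const_mul]
      refine integral_congr_ae (Eventually.of_forall fun y => ?_)
      simp only [newt]
      ring
    rw [h2, ← h1]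
    have := Real.pi_pos
    field_simp
  have hm := mass_eq_zero hu hc hi hb hE hs hlt
  obtain ⟨D, hD0, hD⟩ := exists_gradSq_inv_dist_sq_le hu hc hi hb hm hE hC
  exact nonempty_scaleField hu hf ⟨hC0, hC⟩ hD0 hD

/-- A scale field integrates to a homeomorphism with uniformly conformal derivative. -/
lemma ScaleField.exists_homeomorph {u : Eu 4 → ℝ} (S : ScaleField u) :
    ∃ (C : ℝ) (F : Eu 4 ≃ₜ Eu 4) (F' : Eu 4 → Eu 4 →L[ℝ] Eu 4), 0 ≤ C ∧ ∀ x,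
      HasFDerivAt F (F' x) x ∧ 0 < (F' x).det ∧ ∀ h,
        Real.exp (u x - C) * ‖h‖ ≤ ‖F' x h‖ ∧ ‖F' x h‖ ≤ Real.exp (u x + C) * ‖h‖ := by
  obtain ⟨C, hC0, hC⟩ := S.exists_approxDeriv_bounds
  choose G hG using S.exists_homeomorph_approx
  have hGfun : ∀ N, ⇑(G N) = S.approx N := fun N => funext (hG N)
  obtain ⟨F, F', hF⟩ := exists_limit_homeomorph (u := u) (G := G) (G' := S.approxDeriv)
    (w := S.logFactor) (C := C) (fun N x => by rw [hGfun]; exact S.hasFDerivAt_approx N x)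
    S.det_approxDeriv_pos S.exists_approxDeriv_sub_le hC S.tendsto_logFactor
    S.exists_abs_logFactor_le (fun N => by rw [hG, S.approx_zero])
    (fun Q => by simpa only [hG] using S.exists_norm_le_of_approx_le Q)
  exact ⟨C, F, F', hC0, hF⟩

/-- **Theorem (quasiconformal map from `σ₂` pinching).** On `(ℝ⁴, e^{2u}|dx|²)` complete,
with `∫|Δ²u| < ∞`, `∫ R² e^{4u} < ∞` and `∫ σ₂(M) dx < 2π²`, there is an
`H`-quasiconformal orientation-preserving homeomorphism `F : ℝ⁴ → ℝ⁴`, differentiable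
a.e., whose Jacobian is comparable to `e^{4u}`. -/
theorem quasiconformal_of_sigma2
    (u : Eu 4 → ℝ) (hu : ContDiff ℝ (⊤ : ℕ∞) u)
    (R : Eu 4 → ℝ)
    (hR : ∀ x, R x = -6 * Real.exp (-2 * u x) * (lap u x + ‖gradient u x‖ ^ 2))
    (hcomplete : ConfComplete u)
    (hQL1 : Integrable (fun x => lapIter 2 u x))
    (hRL2 : Integrable (fun x => R x ^ 2 * Real.exp (4 * u x)))
    (hsigmaL1 : Integrable (fun x => sigma2 (schoutenMatrix u x)))
    (hsigma : (∫ x, sigma2 (schoutenMatrix u x)) < 2 * Real.pi ^ 2) :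
    ∃ H : ℝ, 1 ≤ H ∧ ∃ F : Eu 4 ≃ₜ Eu 4, QuasiconformalWith H F ∧
      ∃ C : ℝ, 1 ≤ C ∧
        ∀ᵐ x ∂(volume : Measure (Eu 4)),
          DifferentiableAt ℝ (⇑F) x ∧ 0 < jacDet (⇑F) x ∧
            C⁻¹ * Real.exp (4 * u x) ≤ |jacDet (⇑F) x| ∧
            |jacDet (⇑F) x| ≤ C * Real.exp (4 * u x) := by
  have hE : Integrable fun x => confLap u x ^ 2 := by
    refine (hRL2.const_mul (1 / 36)).congr (Filter.Eventually.of_forall fun x => ?_)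
    have h1 : Real.exp (-2 * u x) ^ 2 * Real.exp (4 * u x) = 1 := by
      rw [← Real.exp_nat_mul, ← Real.exp_add]
      simp
      ring
    simp only [hR, norm_gradient_sq]
    change _ = (lap u x + ∑ i, pd i u x ^ 2) ^ 2
    linear_combination (lap u x + ∑ i, pd i u x ^ 2) ^ 2 * h1
  obtain ⟨S⟩ := nonempty_scaleField_of_sigma2 hu hQL1 hE hsigmaL1 hsigma
  obtain ⟨C, F, F', hC0, hF⟩ := S.exists_homeomorph
  refine ⟨Real.exp (2 * C) + 1, by linarith [Real.exp_pos (2 * C)], F, fun x => ?_,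
    Real.exp (4 * C), Real.one_le_exp (by positivity), Filter.Eventually.of_forall fun x => ?_⟩
  · obtain ⟨h1, -, h2⟩ := hF x
    refine limsup_dilatQuot_le h1 (Real.exp_pos (u x - C)) (Real.exp_pos _).le
      (fun h => (h2 h).1) (fun h => ?_)
    rw [← Real.exp_add, show 2 * C + (u x - C) = u x + C by ring]
    exact (h2 h).2
  · obtain ⟨h1, hd, h2⟩ := hF x
    have hjac : jacDet F x = (F' x).det := by
      rw [jacDet, h1.fderiv]
    refine ⟨h1.differentiableAt, by rwa [hjac], ?_, ?_⟩
    · rw [hjac]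
      refine le_trans (le_of_eq ?_) (pow_le_abs_det (Real.exp_pos _) fun h => (h2 h).1)
      rw [← Real.exp_neg, ← Real.exp_add, ← Real.exp_nat_mul]
      congr 1; push_cast; ring
    · rw [hjac]
      refine (abs_det_le_pow (Real.exp_pos _).le fun h => (h2 h).2).trans (le_of_eq ?_)
      rw [← Real.exp_add, ← Real.exp_nat_mul]
      congr 1; push_cast; ring
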